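/- arXiv:2303.02380 — 4 statements merged into one kernel-verified Lean document; each statement's English description precedes it below -/
import Mathlib

section
/- Fix q ∈ (0,1), m ≥ 1, and x ∈ W_m. Consider the Markov chain on W_m with one-step transition matrix Υ_m started at y(0) = x, viewed as the random point configuration {(y_j(t), t) : 1 ≤ j ≤ m, t ∈ ℤ≥0} ⊂ ℤ≥0². Then this configuration is determinantal with kernel K_walks: for any ℓ ≥ 1 and pairwise distinct points (u_1,t_1), …, (u_ℓ,t_ℓ) ∈ ℤ≥0 × ℤ≥1, the probability that the configuration contains all the points (u_i,t_i) equals det[ K_walks(u_i,t_i; u_j,t_j) ]_{i,j=1}^{ℓ}. Here if t(1) < … < t(s) are the distinct values among t_1,…,t_ℓ and U_k = {u_i : t_i = t(k)}, the probability on the left-hand side is by definition Σ over (y^{(1)},…,y^{(s)}) ∈ W_m^s with U_k ⊆ {y^{(k)}_1,…,y^{(k)}_m} for each k, of Υ_m^{(t(1))}(x, y^{(1)}) ∏_{k=1}^{s−1} Υ_m^{(t(k+1)−t(k))}(y^{(k)}, y^{(k+1)}), where Υ_m^{(s)} denotes the s-fold matrix power of Υ_m. -/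
/-- `W_m = {x₁ > x₂ > … > x_m ≥ 0}`. -/
def Wm (m : ℕ) (x : Fin m → ℤ) : Prop := StrictAnti x ∧ ∀ i, 0 ≤ x i

/-- Transition matrix of `m` independent `q`-exchangeable walks. -/
noncomputable def UpsInd (q : ℝ) (m : ℕ) (x y : Fin m → ℤ) : ℝ :=
  ∏ i : Fin m, (q ^ (x i) * (if y i = x i then 1 else 0)
    + (1 - q ^ (x i)) * (if y i = x i - 1 then 1 else 0))

/-- The noncolliding `q`-exchangeable walk transition matrix `Υ_m`. -/
noncomputable def UpsM (q : ℝ) (m : ℕ) (x y : Fin m → ℤ) : ℝ :=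
  q ^ (-((m : ℤ) * ((m : ℤ) - 1) / 2) + ((m : ℤ) - 1) * ((∑ i, x i) - ∑ i, y i)) *
    (∏ i : Fin m, ∏ j ∈ Finset.Ioi i, (q ^ (y j) - q ^ (y i)) / (q ^ (x j) - q ^ (x i))) *
    UpsInd q m x y

/-- `s`-fold matrix power of `Υ_m` (as a matrix indexed by `W_m`). -/
noncomputable def UpsPow (q : ℝ) (m : ℕ) : ℕ → (Fin m → ℤ) → (Fin m → ℤ) → ℝ
  | 0, x, y => if x = y then 1 else 0
  | s + 1, x, y => ∑' z : {z : Fin m → ℤ // Wm m z}, UpsPow q m s x z.1 * UpsM q m z.1 y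

/-- `(a;q)_k = ∏_{i=0}^{k−1}(1 − a q^i)` for complex `a, q`. -/
noncomputable def qPochC (q a : ℂ) (k : ℕ) : ℂ := ∏ i ∈ Finset.range k, (1 - a * q ^ i)

/-- `(q^s;q)_k = ∏_{i=0}^{k−1}(1 − q^{s+i})` for an arbitrary integer `s`. -/
noncomputable def qPochCInt (q : ℂ) (s : ℤ) (k : ℕ) : ℂ :=
  ∏ i ∈ Finset.range k, (1 - q ^ (s + i))

/-- `(a;q)_∞ = ∏_{i=0}^{∞}(1 − a q^i)`. -/
noncomputable def qPochCInf (q a : ℂ) : ℂ := ∏' i : ℕ, (1 - a * q ^ i)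

/-- The correlation kernel `K_walks` of the noncolliding `q`-exchangeable random walks
started from `x ∈ W_m`, written with a canonical admissible choice of the radii
(`q^{y₂+t₂} < r_z < q^{y₂+t₂−1}`, `0 < r_w < min(q^{y₁+t₁}, q^{x₁}, r_z)`);
the contour-integral value does not depend on this choice. -/
noncomputable def Kwalks (q : ℝ) (m : ℕ) (x : Fin m → ℤ)
    (y₁ : ℤ) (t₁ : ℕ) (y₂ : ℤ) (t₂ : ℕ) : ℂ :=
  let x₁ : ℤ := if h : 0 < m then x ⟨0, h⟩ else 0
  let rz : ℝ := (q ^ (y₂ + t₂) + q ^ (y₂ + t₂ - 1)) / 2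
  let rw : ℝ := min (q ^ (y₁ + t₁)) (min (q ^ x₁) rz) / 2
  (if t₁ = t₂ ∧ y₁ = y₂ then 1 else 0)
  - (if t₁ < t₂ ∧ y₁ + t₁ < y₂ + t₂ then
      (q : ℂ) ^ (((t₁ : ℤ) - t₂) * (y₁ + t₁)) *
        qPochCInt (q : ℂ) (y₁ - y₂ + (t₁ : ℤ) - t₂ + 1) (t₂ - t₁ - 1) /
        qPochC (q : ℂ) (q : ℂ) (t₂ - t₁ - 1)
    else 0)
  - (q : ℂ) ^ (-(t₁ : ℤ) - y₁) * ((2 * (Real.pi : ℂ) * Complex.I)⁻¹) ^ 2 *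
      ∮ z in C(0, rz), ∮ w in C(0, rw),
        (z ^ (-(t₂ : ℤ)) * w ^ t₁ / (w - z)) *
          (qPochC (q : ℂ) (q : ℂ) t₁ / qPochC (q : ℂ) (w * (q : ℂ) ^ (-y₁ - t₁)) (t₁ + 1)) *
          (qPochC (q : ℂ) (z * (q : ℂ) ^ (1 - y₂ - t₂)) (t₂ - 1) /
            qPochC (q : ℂ) (q : ℂ) (t₂ - 1)) *
          (qPochCInf (q : ℂ) w⁻¹ / qPochCInf (q : ℂ) z⁻¹) *
          ∏ r : Fin m, ((1 - (q : ℂ) ^ (x r) / z) / (1 - (q : ℂ) ^ (x r) / w))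

theorem circleIntegral_eq_circleIntegral_inv (F : ℂ → ℂ) {ρ : ℝ} (hρ : 0 < ρ) :
    (∮ w in C(0, ρ), F w) = ∮ v in C(0, ρ⁻¹), (v ^ 2)⁻¹ * F v⁻¹ := by
  have key : ∀ θ : ℝ, circleMap 0 ρ (2 * Real.pi - θ) = (circleMap 0 ρ⁻¹ θ)⁻¹ := by
    intro θ
    simp only [circleMap, zero_add]
    rw [mul_inv, ← Complex.exp_neg]
    congr 1
    · push_cast; simp
    · rw [Complex.exp_eq_exp_iff_exists_int]
      exact ⟨1, by push_cast; ring⟩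
  simp only [circleIntegral, deriv_circleMap, smul_eq_mul]
  have h := intervalIntegral.integral_comp_sub_left (a := 0) (b := 2 * Real.pi)
    (fun θ => circleMap 0 ρ θ * Complex.I * F (circleMap 0 ρ θ)) (2 * Real.pi)
  simp only [sub_self, sub_zero] at h
  rw [← h]
  apply intervalIntegral.integral_congr
  intro θ _
  have hne : circleMap 0 ρ⁻¹ θ ≠ 0 := circleMap_ne_center (inv_pos.2 hρ).ne'
  simp only [key]
  field_simp

theorem qPochCInf_summable {q : ℂ} (hq : ‖q‖ < 1) (a : ℂ) :
    Summable fun i : ℕ => ‖-(a * q ^ i)‖ := by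
  simp only [norm_neg, norm_mul, norm_pow]
  exact (summable_geometric_of_lt_one (norm_nonneg _) hq).mul_left _

theorem qPochCInf_split {q : ℂ} (hq : ‖q‖ < 1) (a : ℂ) (N : ℕ) :
    qPochCInf q a = qPochC q a N * qPochCInf q (a * q ^ N) := by
  unfold qPochCInf qPochC
  have hm : Multipliable fun i : ℕ => 1 - a * q ^ N * q ^ i := by
    simp only [sub_eq_add_neg]
    exact multipliable_one_add_of_summable (qPochCInf_summable hq (a * q ^ N))
  rw [← Multipliable.prod_mul_tprod_nat_mul' (f := fun i : ℕ => 1 - a * q ^ i) (k := N)]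
  · simp only [pow_add, mul_assoc, mul_comm (q ^ N)]
  · simpa only [pow_add, mul_assoc, mul_comm (q ^ N)] using hm

theorem qPochCInf_ne_zero {q : ℂ} (hq : ‖q‖ < 1) {a : ℂ} (ha : ∀ i : ℕ, 1 - a * q ^ i ≠ 0) :
    qPochCInf q a ≠ 0 := by
  unfold qPochCInf
  simp only [sub_eq_add_neg] at ha ⊢
  exact tprod_one_add_ne_zero_of_summable ha (qPochCInf_summable hq a)

theorem differentiable_qPochCInf {q : ℂ} (hq : ‖q‖ < 1) : Differentiable ℂ (qPochCInf q) := by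
  intro a
  have hs : Summable fun i : ℕ => (‖a‖ + 1) * ‖q‖ ^ i :=
    (summable_geometric_of_lt_one (norm_nonneg _) hq).mul_left _
  have h := Summable.hasProdLocallyUniformlyOn_nat_one_add (f := fun (i : ℕ) (v : ℂ) => -(v * q ^ i))
    (K := Metric.ball (0 : ℂ) (‖a‖ + 1)) Metric.isOpen_ball hs
    (Filter.Eventually.of_forall fun i v hv => by
      rw [norm_neg, norm_mul, norm_pow]
      gcongr
      simpa using (mem_ball_zero_iff.1 hv).le)
    (fun i => by fun_prop)
  have hd := h.differentiableOn (Filter.Eventually.of_forall fun s => by fun_prop)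
    Metric.isOpen_ball
  have hda := hd.differentiableAt
    (Metric.isOpen_ball.mem_nhds (by simp : a ∈ Metric.ball (0 : ℂ) (‖a‖ + 1)))
  have he : qPochCInf q = fun x => ∏' i : ℕ, (1 + -(x * q ^ i)) := by
    ext x
    simp only [qPochCInf, sub_eq_add_neg]
  rw [he]
  exact hda

theorem circleIntegral_div_sub_of_lt {f : ℂ → ℂ} {R : ℝ} {b : ℂ} (hb : ‖b‖ < R)
    (hf : DifferentiableOn ℂ f (Metric.closedBall 0 R)) :
    (∮ v in C(0, R), f v / (v - b)) = 2 * Real.pi * Complex.I * f b := by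
  have := Complex.circleIntegral_sub_inv_smul_of_differentiable_on_off_countable
    (s := ∅) (c := 0) (w := b) (f := f) (R := R) Set.countable_empty (by simpa using hb)
    hf.continuousOn (fun z hz => (hf z (Metric.ball_subset_closedBall hz.1)).differentiableAt
      (Metric.closedBall_mem_nhds_of_mem hz.1))
  simp only [smul_eq_mul] at this
  rw [← this]
  congr 1; ext v; rw [div_eq_inv_mul]

theorem circleIntegral_div_sub_of_gt {f : ℂ → ℂ} {R : ℝ} (hR : 0 ≤ R) {b : ℂ} (hb : R < ‖b‖)
    (hf : Differentiable ℂ f) :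
    (∮ v in C(0, R), f v / (v - b)) = 0 := by
  have hne : ∀ z : ℂ, z ∈ Metric.closedBall (0 : ℂ) R → z - b ≠ 0 := by
    intro z hz h
    rw [sub_eq_zero] at h
    subst h
    simp at hz
    linarith
  apply Complex.circleIntegral_eq_zero_of_differentiable_on_off_countable hR Set.countable_empty
  · exact fun z hz => ((hf z).div (by fun_prop) (hne z hz)).continuousAt.continuousWithinAt
  · exact fun z hz => (hf z).div (by fun_prop) (hne z (Metric.ball_subset_closedBall hz.1))

theorem circleIntegrable_of_continuousAt {F : ℂ → ℂ} {R : ℝ} (hR : 0 ≤ R)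
    (h : ∀ v : ℂ, ‖v‖ = R → ContinuousAt F v) : CircleIntegrable F 0 R :=
  ContinuousOn.circleIntegrable hR fun v hv =>
    (h v (by simpa using hv)).continuousWithinAt

/-- Small-circle integral of an entire function of `1 / w` against two simple poles
outside of the circle. -/
theorem circleIntegral_entire_inv {E : ℂ → ℂ} (hE : Differentiable ℂ E) {ρ : ℝ} (hρ : 0 < ρ)
    {z p : ℂ} (hz : ρ < ‖z‖) (hp : p ≠ 0) (hpρ : ρ * ‖p‖ < 1) (hzp : z * p ≠ 1) :
    (2 * Real.pi * Complex.I)⁻¹ * (∮ w in C(0, ρ), E w⁻¹ / ((w - z) * (1 - w * p))) =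
      (E z⁻¹ - E p) / (z * p - 1) := by
  have hz0 : z ≠ 0 := by
    rintro rfl; simp at hz; linarith
  have hR : 0 < ρ⁻¹ := inv_pos.2 hρ
  have hzi : ‖z⁻¹‖ < ρ⁻¹ := by
    rw [norm_inv]; exact inv_strictAnti₀ hρ hz
  have hpi : ‖p‖ < ρ⁻¹ := by
    rw [lt_inv_comm₀ (norm_pos_iff.2 hp) hρ, lt_inv_comm₀ hρ (norm_pos_iff.2 hp), ← one_div,
      lt_div_iff₀ hρ]; linarith
  have hzp' : z * p - 1 ≠ 0 := sub_ne_zero.2 hzp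
  rw [circleIntegral_eq_circleIntegral_inv _ hρ]
  have hne : ∀ b : ℂ, ‖b‖ < ρ⁻¹ → ∀ v : ℂ, ‖v‖ = ρ⁻¹ → v - b ≠ 0 := by
    intro b hb v hv h
    rw [sub_eq_zero] at h
    subst h; linarith
  have hI : ∀ b : ℂ, ‖b‖ < ρ⁻¹ → CircleIntegrable (fun v => E v / (v - b)) 0 ρ⁻¹ := fun b hb =>
    circleIntegrable_of_continuousAt hR.le fun v hv =>
      ((hE v).div (by fun_prop) (hne b hb v hv)).continuousAt
  have hcongr : (∮ v in C(0, ρ⁻¹), (v ^ 2)⁻¹ * (E (v⁻¹)⁻¹ / ((v⁻¹ - z) * (1 - v⁻¹ * p)))) =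
      ∮ v in C(0, ρ⁻¹), (z * p - 1)⁻¹ * (E v / (v - z⁻¹) - E v / (v - p)) := by
    apply circleIntegral.integral_congr hR.le
    intro v hv
    have hv' : ‖v‖ = ρ⁻¹ := by simpa using hv
    have hv0 : v ≠ 0 := by rintro rfl; simp at hv'; linarith
    have h1 := hne _ hzi v hv'
    have h2 := hne _ hpi v hv'
    have h3 : v⁻¹ - z ≠ 0 := by
      intro h
      apply h1
      rw [sub_eq_zero] at h ⊢
      rw [← h, inv_inv]
    have h4 : 1 - v⁻¹ * p ≠ 0 := by
      intro h
      apply h2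
      field_simp at h
      simpa using h
    have h5 : 1 - v * z ≠ 0 := by
      intro h; apply h3; field_simp; simpa using h
    have h6 : v * z - 1 ≠ 0 := by
      intro h; apply h5; linear_combination -h
    simp only [inv_inv]
    field_simp
    ring
  rw [hcongr, circleIntegral.integral_const_mul,
    circleIntegral.integral_sub (hI _ hzi) (hI _ hpi),
    circleIntegral_div_sub_of_lt hzi hE.differentiableOn,
    circleIntegral_div_sub_of_lt hpi hE.differentiableOn]
  have := Complex.two_pi_I_ne_zero
  field_simp

/-- `∏_{i=1}^{k} (1 − q^{−i})`. -/
noncomputable def negQFact (q : ℝ) (k : ℕ) : ℝ := ∏ i ∈ Finset.range k, (1 - (q ^ (i + 1))⁻¹)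

theorem negQFact_succ (q : ℝ) (k : ℕ) :
    negQFact q (k + 1) = negQFact q k * (1 - (q ^ (k + 1))⁻¹) := Finset.prod_range_succ _ _

theorem negQFact_ne_zero {q : ℝ} (hq0 : 0 < q) (hq1 : q < 1) (k : ℕ) : negQFact q k ≠ 0 := by
  rw [negQFact, Finset.prod_ne_zero_iff]
  intro i _
  have : 1 < (q ^ (i + 1))⁻¹ :=
    (one_lt_inv₀ (by positivity)).2 (pow_lt_one₀ hq0.le hq1 (by omega))
  linarith

theorem norm_ofReal_lt_one {q : ℝ} (hq0 : 0 < q) (hq1 : q < 1) : ‖(q : ℂ)‖ < 1 := by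
  simpa [abs_of_pos hq0] using hq1

theorem prod_range_erase_eq {M : Type*} [CommMonoid M] (f : ℕ → M) (k n : ℕ) :
    ∏ j ∈ (Finset.range (k + 1 + n)).erase k, f j =
      (∏ j ∈ Finset.range k, f j) * ∏ j ∈ Finset.range n, f (k + 1 + j) := by
  have h : ∏ j ∈ (Finset.range (k + 1 + n)).erase k, f j =
      ∏ j ∈ Finset.range (k + 1 + n), if j = k then 1 else f j := by
    rw [← Finset.mul_prod_erase (Finset.range (k + 1 + n)) _
      (Finset.mem_range.2 (by omega : k < k + 1 + n))]
    simp only [if_true, one_mul]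
    apply Finset.prod_congr rfl
    intro j hj
    rw [if_neg (Finset.ne_of_mem_erase hj)]
  rw [h, Finset.prod_range_add, Finset.prod_range_succ, if_pos rfl, mul_one]
  congr 1
  · exact Finset.prod_congr rfl fun j hj => if_neg (Finset.mem_range.1 hj).ne
  · exact Finset.prod_congr rfl fun j _ => if_neg (by omega)

theorem prod_erase_one_sub_pow_div {q : ℝ} (hq0 : 0 < q) (hq1 : q < 1) {k M : ℕ} (hk : k < M) :
    (∏ j ∈ (Finset.range M).erase k, (1 - ((q : ℂ) ^ k)⁻¹ * (q : ℂ) ^ j)) *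
      qPochCInf (q : ℂ) (((q : ℂ) ^ k)⁻¹ * (q : ℂ) ^ M) =
    qPochCInf (q : ℂ) (q : ℂ) * (negQFact q k : ℂ) := by
  obtain ⟨n, rfl⟩ := Nat.exists_eq_add_of_lt hk
  have hqc : (q : ℂ) ≠ 0 := by exact_mod_cast hq0.ne'
  rw [show k + n + 1 = k + 1 + n by ring, prod_range_erase_eq,
    qPochCInf_split (norm_ofReal_lt_one hq0 hq1) (q : ℂ) n]
  have h1 : ∏ j ∈ Finset.range k, (1 - ((q : ℂ) ^ k)⁻¹ * (q : ℂ) ^ j) = (negQFact q k : ℂ) := by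
    rw [negQFact, ← Finset.prod_range_reflect]
    push_cast
    apply Finset.prod_congr rfl
    intro j hj
    have : k = (k - 1 - j) + (j + 1) := by
      have := Finset.mem_range.1 hj
      omega
    congr 1
    conv_lhs => rw [this]
    rw [show (k - 1 - j + (j + 1) - 1 - j) = k - 1 - j by omega, pow_add]
    field_simp
  have h2 : ∏ j ∈ Finset.range n, (1 - ((q : ℂ) ^ k)⁻¹ * (q : ℂ) ^ (k + 1 + j)) =
      qPochC (q : ℂ) (q : ℂ) n := by
    unfold qPochC
    apply Finset.prod_congr rfl
    intro j _
    congr 1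
    rw [pow_add, pow_add]
    field_simp
  have h3 : ((q : ℂ) ^ k)⁻¹ * (q : ℂ) ^ (k + 1 + n) = q * q ^ n := by
    rw [pow_add, pow_add]
    field_simp
  rw [h1, h2, h3]
  ring

theorem circleIntegral_div_qPochCInf {q : ℝ} (hq0 : 0 < q) (hq1 : q < 1) {g : ℂ → ℂ}
    (hg : Differentiable ℂ g) {M : ℕ} (hM : 0 < M) {R : ℝ} (hR0 : 0 < R) (hlo : ∀ k < M, (q ^ k)⁻¹ < R)
    (hhi : R < (q ^ M)⁻¹) :
    (2 * Real.pi * Complex.I)⁻¹ * (∮ v in C(0, R), g v / qPochCInf (q : ℂ) v) =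
      ∑ k ∈ Finset.range M, g ((q : ℂ) ^ k)⁻¹ *
        (-((q : ℂ) ^ k)⁻¹ / (qPochCInf (q : ℂ) (q : ℂ) * (negQFact q k : ℂ))) := by
  have hqn := norm_ofReal_lt_one hq0 hq1
  have hqc : (q : ℂ) ≠ 0 := by exact_mod_cast hq0.ne'
  have hnorm : ∀ k : ℕ, ‖((q : ℂ) ^ k)⁻¹‖ = (q ^ k)⁻¹ := by
    intro k; simp [abs_of_pos hq0]
  have htail : ∀ v : ℂ, ‖v‖ ≤ R → qPochCInf (q : ℂ) (v * (q : ℂ) ^ M) ≠ 0 := by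
    intro v hv
    apply qPochCInf_ne_zero hqn
    intro i h
    have h1 : ‖v * (q : ℂ) ^ M * (q : ℂ) ^ i‖ < 1 := by
      rw [norm_mul, norm_mul, norm_pow, norm_pow]
      have hq : ‖(q : ℂ)‖ = q := by simp [abs_of_pos hq0]
      rw [hq]
      have h2 : ‖v‖ * q ^ M < 1 := by
        rw [lt_inv_comm₀ hR0 (by positivity)] at hhi
        calc ‖v‖ * q ^ M ≤ R * q ^ M := by gcongr
          _ < R * R⁻¹ := by gcongr
          _ = 1 := mul_inv_cancel₀ hR0.ne'
      have h3 : q ^ i ≤ 1 := pow_le_one₀ hq0.le hq1.le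
      calc ‖v‖ * q ^ M * q ^ i ≤ ‖v‖ * q ^ M * 1 := by gcongr
        _ < 1 := by linarith
    rw [sub_eq_zero] at h
    rw [← h] at h1
    simp at h1
  set b : ℕ → ℂ := fun k => ((q : ℂ) ^ k)⁻¹ with hb
  have hbinj : Function.Injective b := by
    intro i j hij
    have : (q ^ i : ℝ) = q ^ j := by
      have := inv_injective hij
      exact_mod_cast this
    exact (pow_right_strictAnti₀ hq0 hq1).injective this
  set h : ℂ → ℂ := fun v => g v / qPochCInf (q : ℂ) (v * (q : ℂ) ^ M) with hh
  have hdh : DifferentiableOn ℂ h (Metric.closedBall 0 R) := by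
    intro v hv
    exact ((hg v).div (((differentiable_qPochCInf hqn).comp
      (g := qPochCInf (q : ℂ)) (f := fun v => v * (q : ℂ) ^ M) (by fun_prop)) v)
      (htail v (by simpa using hv))).differentiableWithinAt
  have hnb : ∀ k < M, ∀ v : ℂ, ‖v‖ = R → v - b k ≠ 0 := by
    intro k hk v hv h0
    rw [sub_eq_zero] at h0
    have := hlo k hk
    rw [← hnorm k] at this
    rw [h0] at hv
    linarith
  have hcongr : (∮ v in C(0, R), g v / qPochCInf (q : ℂ) v) =
      ∮ v in C(0, R), ∑ k ∈ Finset.range M,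
        ((∏ j ∈ Finset.range M, -(q : ℂ) ^ j)⁻¹ * Lagrange.nodalWeight (Finset.range M) b k) *
          (h v / (v - b k)) := by
    apply circleIntegral.integral_congr hR0.le
    intro v hv
    have hv' : ‖v‖ = R := by simpa using hv
    have hpoch : qPochC (q : ℂ) v M = (∏ j ∈ Finset.range M, -(q : ℂ) ^ j) *
        Polynomial.eval v (Lagrange.nodal (Finset.range M) b) := by
      rw [Lagrange.eval_nodal, ← Finset.prod_mul_distrib, qPochC]
      apply Finset.prod_congr rfl
      intro j _
      simp only [hb]
      field_simp
      ring
    have hint := Lagrange.eval_interpolate_not_at_node (s := Finset.range M) (v := b)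
      (x := v) (fun _ => (1 : ℂ)) (fun i hi => by
        have := hnb i (Finset.mem_range.1 hi) v hv'
        exact sub_ne_zero.1 this)
    have hone : Lagrange.interpolate (Finset.range M) b (fun _ => (1 : ℂ)) = 1 :=
      Lagrange.interpolate_one hbinj.injOn ⟨0, Finset.mem_range.2 hM⟩
    rw [hone, Polynomial.eval_one] at hint
    have hnod : Polynomial.eval v (Lagrange.nodal (Finset.range M) b) ≠ 0 := by
      intro h0
      rw [h0, zero_mul] at hint
      exact one_ne_zero hint
    have hpr : (∏ j ∈ Finset.range M, -(q : ℂ) ^ j) ≠ 0 :=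
      Finset.prod_ne_zero_iff.2 fun j _ => neg_ne_zero.2 (pow_ne_zero _ hqc)
    have hs : ∑ k ∈ Finset.range M, ((∏ j ∈ Finset.range M, -(q : ℂ) ^ j)⁻¹ *
        Lagrange.nodalWeight (Finset.range M) b k) * (h v / (v - b k)) =
        (∏ j ∈ Finset.range M, -(q : ℂ) ^ j)⁻¹ * h v * ∑ k ∈ Finset.range M,
          Lagrange.nodalWeight (Finset.range M) b k * (v - b k)⁻¹ * 1 := by
      rw [Finset.mul_sum]
      apply Finset.sum_congr rfl
      intro k _
      rw [div_eq_mul_inv]; ring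
    have hi : ∑ k ∈ Finset.range M, Lagrange.nodalWeight (Finset.range M) b k * (v - b k)⁻¹ * 1 =
        (Polynomial.eval v (Lagrange.nodal (Finset.range M) b))⁻¹ :=
      eq_inv_of_mul_eq_one_right hint.symm
    simp only
    rw [hs, hi, qPochCInf_split hqn v M, hpoch, hh]
    have := htail v hv'.le
    field_simp
  rw [hcongr, circleIntegral.integral_fun_sum]
  · rw [Finset.mul_sum]
    apply Finset.sum_congr rfl
    intro k hk
    have hk' := Finset.mem_range.1 hk
    rw [circleIntegral.integral_const_mul, circleIntegral_div_sub_of_lt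
      (by rw [hb]; simp only; rw [hnorm]; exact hlo k hk') hdh]
    have hpe := prod_erase_one_sub_pow_div hq0 hq1 hk'
    have hw : Lagrange.nodalWeight (Finset.range M) b k =
        (∏ j ∈ (Finset.range M).erase k, (b k - b j))⁻¹ := by
      rw [Lagrange.nodalWeight, Finset.prod_inv_distrib]
    have hsplit : (∏ j ∈ Finset.range M, -(q : ℂ) ^ j) *
        ∏ j ∈ (Finset.range M).erase k, (b k - b j) =
        -(q : ℂ) ^ k * ∏ j ∈ (Finset.range M).erase k, (1 - ((q : ℂ) ^ k)⁻¹ * (q : ℂ) ^ j) := by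
      rw [← Finset.mul_prod_erase _ _ hk, mul_assoc, ← Finset.prod_mul_distrib]
      congr 1
      apply Finset.prod_congr rfl
      intro j _
      simp only [hb]
      field_simp
      ring
    have hqk : (q : ℂ) ^ k ≠ 0 := pow_ne_zero _ hqc
    have h2 := Complex.two_pi_I_ne_zero
    rw [hw, ← mul_inv, hsplit, hh, ← hpe]
    simp only [hb]
    generalize (∏ j ∈ (Finset.range M).erase k, (1 - ((q : ℂ) ^ k)⁻¹ * (q : ℂ) ^ j)) = A
    generalize qPochCInf (q : ℂ) (((q : ℂ) ^ k)⁻¹ * (q : ℂ) ^ M) = B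
    generalize g ((q : ℂ) ^ k)⁻¹ = C
    generalize (q : ℂ) ^ k = D
    calc _ = (2 * Real.pi * Complex.I)⁻¹ * (2 * Real.pi * Complex.I) *
          ((-D * A)⁻¹ * (C / B)) := by ring
      _ = _ := by
        rw [inv_mul_cancel₀ h2, neg_mul, inv_neg, mul_inv, div_eq_mul_inv, div_eq_mul_inv, mul_inv]
        ring
  · intro k hk
    apply circleIntegrable_of_continuousAt hR0.le
    intro v hv
    have h1 : DifferentiableAt ℂ h v := (hg v).div
      (((differentiable_qPochCInf hqn).comp
      (g := qPochCInf (q : ℂ)) (f := fun v => v * (q : ℂ) ^ M) (by fun_prop)) v) (htail v hv.le)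
    exact (continuousAt_const.mul ((h1.continuousAt).div (by fun_prop)
      (hnb k (Finset.mem_range.1 hk) v hv)))

theorem qPochCInf_inv_pow_eq_zero {q : ℝ} (hq0 : 0 < q) (hq1 : q < 1) (k : ℕ) :
    qPochCInf (q : ℂ) ((q : ℂ) ^ k)⁻¹ = 0 := by
  have hqc : (q : ℂ) ≠ 0 := by exact_mod_cast hq0.ne'
  rw [qPochCInf_split (norm_ofReal_lt_one hq0 hq1) _ (k + 1), qPochC, Finset.prod_range_succ]
  simp [hqc]

theorem qPochCInf_ne_zero_of_ne {q : ℝ} (hq0 : 0 < q) (hq1 : q < 1) {v : ℂ}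
    (hv : ∀ k : ℕ, v ≠ ((q : ℂ) ^ k)⁻¹) : qPochCInf (q : ℂ) v ≠ 0 := by
  have hqc : (q : ℂ) ≠ 0 := by exact_mod_cast hq0.ne'
  apply qPochCInf_ne_zero (norm_ofReal_lt_one hq0 hq1)
  intro i h
  apply hv i
  have : (q : ℂ) ^ i ≠ 0 := pow_ne_zero _ hqc
  field_simp
  linear_combination -h

theorem one_sub_inv_pow_mul_pow_ne_zero {q : ℝ} (hq0 : 0 < q) (hq1 : q < 1) {i j : ℕ}
    (hij : i ≠ j) : 1 - ((q : ℂ) ^ i)⁻¹ * (q : ℂ) ^ j ≠ 0 := by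
  have hqc : (q : ℂ) ≠ 0 := by exact_mod_cast hq0.ne'
  intro h
  apply hij
  have : (q ^ i : ℝ) = q ^ j := by
    have h2 : (q : ℂ) ^ i ≠ 0 := pow_ne_zero _ hqc
    field_simp at h
    have h3 : (q : ℂ) ^ i = q ^ j := by
      have : (q : ℂ) ^ i - q ^ j = 0 := by simpa using h
      linear_combination this
    exact_mod_cast h3
  exact (pow_right_strictAnti₀ hq0 hq1).injective this

theorem exists_qPochCInf_factor {q : ℝ} (hq0 : 0 < q) (hq1 : q < 1) {m : ℕ} {X : Fin m → ℕ}
    (hX : Function.Injective X) :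
    ∃ E : ℂ → ℂ, Differentiable ℂ E ∧
      (∀ v, qPochCInf (q : ℂ) v = (∏ r, (1 - v * (q : ℂ) ^ X r)) * E v) ∧
      (∀ y : ℕ, (∀ r, X r ≠ y) → E ((q : ℂ) ^ y)⁻¹ = 0) ∧
      ∀ r, E ((q : ℂ) ^ X r)⁻¹ *
        ∏ s ∈ Finset.univ.erase r, (1 - ((q : ℂ) ^ X r)⁻¹ * (q : ℂ) ^ X s) =
          qPochCInf (q : ℂ) (q : ℂ) * (negQFact q (X r) : ℂ) := by
  classical
  obtain ⟨N, hN⟩ : ∃ N, ∀ r, X r < N :=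
    ⟨(∑ r, X r) + 1, fun r => Nat.lt_succ_of_le
      (Finset.single_le_sum (f := X) (fun _ _ => Nat.zero_le _) (Finset.mem_univ r))⟩
  have hqn := norm_ofReal_lt_one hq0 hq1
  have himg : Finset.univ.image X ⊆ Finset.range N := by
    intro k hk
    obtain ⟨r, -, rfl⟩ := Finset.mem_image.1 hk
    exact Finset.mem_range.2 (hN r)
  have hfac : ∀ v, qPochCInf (q : ℂ) v = (∏ r, (1 - v * (q : ℂ) ^ X r)) *
      ((∏ k ∈ Finset.range N \ Finset.univ.image X, (1 - v * (q : ℂ) ^ k)) *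
        qPochCInf (q : ℂ) (v * (q : ℂ) ^ N)) := by
    intro v
    rw [qPochCInf_split hqn v N, qPochC, ← Finset.prod_sdiff himg,
      Finset.prod_image (fun a _ b _ h => hX h)]
    ring
  refine ⟨fun v => (∏ k ∈ Finset.range N \ Finset.univ.image X, (1 - v * (q : ℂ) ^ k)) *
    qPochCInf (q : ℂ) (v * (q : ℂ) ^ N), ?_, hfac, ?_, ?_⟩
  · apply Differentiable.mul (by fun_prop)
    exact (differentiable_qPochCInf hqn).comp
      (g := qPochCInf (q : ℂ)) (f := fun v => v * (q : ℂ) ^ N) (by fun_prop)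
  · intro y hy
    have h := hfac ((q : ℂ) ^ y)⁻¹
    rw [qPochCInf_inv_pow_eq_zero hq0 hq1] at h
    refine (mul_eq_zero.1 h.symm).resolve_left ?_
    exact Finset.prod_ne_zero_iff.2 fun r _ =>
      one_sub_inv_pow_mul_pow_ne_zero hq0 hq1 (hy r).symm
  · intro r
    rw [← prod_erase_one_sub_pow_div hq0 hq1 (hN r)]
    have hsub : (Finset.univ.erase r).image X ⊆ (Finset.range N).erase (X r) := by
      intro k hk
      obtain ⟨s, hs, rfl⟩ := Finset.mem_image.1 hk
      exact Finset.mem_erase.2 ⟨fun h => Finset.ne_of_mem_erase hs (hX h),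
        Finset.mem_range.2 (hN s)⟩
    rw [← Finset.prod_sdiff hsub, Finset.prod_image (fun a _ b _ h => hX h)]
    have : (Finset.range N).erase (X r) \ (Finset.univ.erase r).image X =
        Finset.range N \ Finset.univ.image X := by
      ext k
      simp only [Finset.mem_sdiff, Finset.mem_erase, Finset.mem_image, Finset.mem_univ, and_true,
        true_and, not_exists, not_and]
      constructor
      · rintro ⟨⟨h1, h2⟩, h3⟩
        exact ⟨h2, fun s hs => if hsr : s = r then h1 (hsr ▸ hs.symm) else h3 s hsr hs⟩
      · rintro ⟨h1, h2⟩
        exact ⟨⟨fun h => h2 r h.symm, h1⟩, fun s _ => h2 s⟩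
    rw [this]
    ring

/-- The `w`-dependent factor of the double contour integrand. -/
noncomputable def wKer (q : ℝ) (t y : ℕ) (w : ℂ) : ℂ :=
  (q : ℂ) ^ (-(t : ℤ) - y) * (w ^ t * qPochC (q : ℂ) (q : ℂ) t /
    qPochC (q : ℂ) (w * (q : ℂ) ^ (-(y : ℤ) - t)) (t + 1))

theorem qPochC_wKer_ne_zero {q : ℝ} (hq0 : 0 < q) (hq1 : q < 1) {t y : ℕ} {w : ℂ}
    (hw : ‖w‖ < q ^ (y + t)) :
    qPochC (q : ℂ) (w * (q : ℂ) ^ (-(y : ℤ) - t)) (t + 1) ≠ 0 := by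
  have hqc : (q : ℂ) ≠ 0 := by exact_mod_cast hq0.ne'
  rw [qPochC, Finset.prod_ne_zero_iff]
  intro i _ h
  rw [sub_eq_zero] at h
  have h1 : ‖w * (q : ℂ) ^ (-(y : ℤ) - t) * (q : ℂ) ^ i‖ < 1 := by
    have h2 : (q : ℂ) ^ (-(y : ℤ) - t) = ((q : ℂ) ^ (y + t))⁻¹ := by
      rw [← zpow_natCast, ← zpow_neg]; congr 1; push_cast; ring
    have hqi : q ^ i ≤ 1 := pow_le_one₀ hq0.le hq1.le
    have hp : 0 < q ^ (y + t) := by positivity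
    rw [h2, norm_mul, norm_mul, norm_inv, norm_pow, norm_pow, Complex.norm_real, Real.norm_eq_abs,
      abs_of_pos hq0]
    calc ‖w‖ * (q ^ (y + t))⁻¹ * q ^ i ≤ ‖w‖ * (q ^ (y + t))⁻¹ * 1 := by gcongr
      _ < q ^ (y + t) * (q ^ (y + t))⁻¹ := by rw [mul_one]; gcongr
      _ = 1 := mul_inv_cancel₀ hp.ne'
  rw [← h] at h1
  simp at h1

theorem wKer_succ {q : ℝ} (hq0 : 0 < q) (hq1 : q < 1) {t y : ℕ} {w : ℂ}
    (hw : ‖w‖ < q ^ (y + t + 1)) :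
    wKer q (t + 1) y w = (q : ℂ) ^ (y + t) * (q * wKer q t (y + 1) w - wKer q t y w) := by
  have hqc : (q : ℂ) ≠ 0 := by exact_mod_cast hq0.ne'
  have hlt : q ^ (y + t + 1) ≤ q ^ (y + t) := pow_le_pow_of_le_one hq0.le hq1.le (by omega)
  have h1 := qPochC_wKer_ne_zero hq0 hq1 (t := t) (y := y) (w := w) (hw.trans_le hlt)
  have h2 := qPochC_wKer_ne_zero hq0 hq1 (t := t) (y := y + 1) (w := w)
    (by rwa [show y + 1 + t = y + t + 1 by ring])
  have h3 := qPochC_wKer_ne_zero hq0 hq1 (t := t + 1) (y := y) (w := w) (by rwa [← add_assoc])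
  have e1 : qPochC (q : ℂ) (w * (q : ℂ) ^ (-(y : ℤ) - (t + 1 : ℕ))) (t + 1 + 1) =
      qPochC (q : ℂ) (w * (q : ℂ) ^ (-(y : ℤ) - t)) (t + 1) *
        (1 - w * (q : ℂ) ^ (-(y : ℤ) - (t + 1 : ℕ))) := by
    rw [qPochC, Finset.prod_range_succ', pow_zero, mul_one, qPochC]
    congr 1
    apply Finset.prod_congr rfl
    intro i _
    rw [pow_succ', show (-(y : ℤ) - t) = (-(y : ℤ) - (t + 1 : ℕ)) + 1 by push_cast; ring,
      zpow_add_one₀ hqc]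
    ring
  have e2 : qPochC (q : ℂ) (w * (q : ℂ) ^ (-(y : ℤ) - (t + 1 : ℕ))) (t + 1 + 1) =
      qPochC (q : ℂ) (w * (q : ℂ) ^ (-((y + 1 : ℕ) : ℤ) - t)) (t + 1) *
        (1 - w * (q : ℂ) ^ (-(y : ℤ))) := by
    rw [qPochC, Finset.prod_range_succ, qPochC]
    congr 1
    · apply Finset.prod_congr rfl
      intro i _
      congr 4
      push_cast; ring
    · rw [mul_assoc, ← zpow_natCast, ← zpow_add₀ hqc]
      congr 3
      push_cast; ring
  have e3 : qPochC (q : ℂ) (q : ℂ) (t + 1) = qPochC (q : ℂ) (q : ℂ) t * (1 - (q : ℂ) ^ (t + 1)) := by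
    rw [qPochC, Finset.prod_range_succ, qPochC]
    ring
  rw [e1] at h3
  have hA := (mul_ne_zero_iff.1 h3).2
  rw [← e1, e2] at h3
  have hB := (mul_ne_zero_iff.1 h3).2
  have d1 : wKer q t y w = (q : ℂ) ^ (-(t : ℤ) - y) * (w ^ t * qPochC (q : ℂ) (q : ℂ) t *
      (1 - w * (q : ℂ) ^ (-(y : ℤ) - (t + 1 : ℕ))) /
      qPochC (q : ℂ) (w * (q : ℂ) ^ (-(y : ℤ) - (t + 1 : ℕ))) (t + 1 + 1)) := by
    rw [e1, wKer]; field_simp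
  have d2 : wKer q t (y + 1) w = (q : ℂ) ^ (-(t : ℤ) - (y + 1 : ℕ)) *
      (w ^ t * qPochC (q : ℂ) (q : ℂ) t *
      (1 - w * (q : ℂ) ^ (-(y : ℤ))) /
      qPochC (q : ℂ) (w * (q : ℂ) ^ (-(y : ℤ) - (t + 1 : ℕ))) (t + 1 + 1)) := by
    rw [e2, wKer]; field_simp
  rw [d1, d2, wKer, e3]
  have z1 : (q : ℂ) ^ (-(t : ℤ) - y) = ((q : ℂ) ^ (y + t))⁻¹ := by
    rw [← zpow_natCast, ← zpow_neg]; congr 1; push_cast; ring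
  have z2 : (q : ℂ) ^ (-(t : ℤ) - (y + 1 : ℕ)) = ((q : ℂ) ^ (y + t))⁻¹ * (q : ℂ)⁻¹ := by
    rw [← mul_inv, ← pow_succ, ← zpow_natCast, ← zpow_neg]; congr 1; push_cast; ring
  have z3 : (q : ℂ) ^ (-((t + 1 : ℕ) : ℤ) - y) = ((q : ℂ) ^ (y + t))⁻¹ * (q : ℂ)⁻¹ := by
    rw [← mul_inv, ← pow_succ, ← zpow_natCast, ← zpow_neg]; congr 1; push_cast; ring
  have z4 : (q : ℂ) ^ (-(y : ℤ)) = ((q : ℂ) ^ (y + t))⁻¹ * q ^ t := by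
    rw [pow_add, zpow_neg, zpow_natCast]; field_simp
  have z5 : (q : ℂ) ^ (-(y : ℤ) - (t + 1 : ℕ)) = ((q : ℂ) ^ (y + t))⁻¹ * (q : ℂ)⁻¹ := by
    rw [← mul_inv, ← pow_succ, ← zpow_natCast, ← zpow_neg]; congr 1; push_cast; ring
  rw [z1, z2, z3, z4]
  generalize qPochC (q : ℂ) (w * (q : ℂ) ^ (-(y : ℤ) - (t + 1 : ℕ))) (t + 1 + 1) = D
  rw [z5]
  field_simp
  ring

/-- Closed form of the inner contour integral, defined through its recursion in time. -/
noncomputable def wInt (q : ℝ) (E : ℂ → ℂ) : ℕ → ℕ → ℂ → ℂ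
  | 0, y, z => ((q : ℂ) ^ y)⁻¹ * ((E z⁻¹ - E ((q : ℂ) ^ y)⁻¹) / (z * ((q : ℂ) ^ y)⁻¹ - 1))
  | t + 1, y, z => (q : ℂ) ^ (y + t) * (q * wInt q E t (y + 1) z - wInt q E t y z)

theorem circleIntegral_wKer {q : ℝ} (hq0 : 0 < q) (hq1 : q < 1) {E : ℂ → ℂ}
    (hE : Differentiable ℂ E) {z : ℂ} (hz : ∀ k : ℕ, z ≠ (q : ℂ) ^ k) {ρ : ℝ} (hρ : 0 < ρ)
    (hρz : ρ < ‖z‖) (t y : ℕ) (hρy : ρ < q ^ (y + t)) :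
    (2 * Real.pi * Complex.I)⁻¹ * (∮ w in C(0, ρ), wKer q t y w * (E w⁻¹ / (w - z))) =
      wInt q E t y z := by
  have hqc : (q : ℂ) ≠ 0 := by exact_mod_cast hq0.ne'
  induction t generalizing y with
  | zero =>
    have hp : ((q : ℂ) ^ y)⁻¹ ≠ 0 := inv_ne_zero (pow_ne_zero _ hqc)
    have h := circleIntegral_entire_inv hE hρ hρz hp (by
      rw [norm_inv, norm_pow, Complex.norm_real, Real.norm_eq_abs, abs_of_pos hq0]
      have : 0 < q ^ y := by positivity
      rw [← div_eq_mul_inv, div_lt_one this]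
      simpa using hρy) (by
      intro h
      apply hz y
      field_simp at h
      exact h)
    rw [wInt, ← h, mul_left_comm ((q : ℂ) ^ y)⁻¹,
      ← circleIntegral.integral_const_mul ((q : ℂ) ^ y)⁻¹]
    congr 1
    apply circleIntegral.integral_congr hρ.le
    intro w _
    simp only [wKer, qPochC, Finset.range_zero, Finset.prod_empty, zero_add, Finset.range_one,
      Finset.prod_singleton, pow_zero, mul_one, CharP.cast_eq_zero, neg_zero, zero_sub, sub_zero,
      zpow_neg, zpow_natCast]
    simp only [div_eq_mul_inv, mul_inv]
    ring
  | succ t ih =>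
    have hlt : q ^ (y + (t + 1)) ≤ q ^ (y + t) := pow_le_pow_of_le_one hq0.le hq1.le (by omega)
    have h1 := ih (y + 1) (by rwa [show y + 1 + t = y + (t + 1) by ring])
    have h2 := ih y (hρy.trans_le hlt)
    have hint : ∀ y', ρ < q ^ (y' + t) →
        CircleIntegrable (fun w => wKer q t y' w * (E w⁻¹ / (w - z))) 0 ρ := by
      intro y' hy'
      apply circleIntegrable_of_continuousAt hρ.le
      intro w hw
      have hw0 : w ≠ 0 := by rintro rfl; simp at hw; linarith
      apply ContinuousAt.mul
      · apply ContinuousAt.mul continuousAt_const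
        apply ContinuousAt.div (by fun_prop)
        · unfold qPochC; fun_prop
        · exact qPochC_wKer_ne_zero hq0 hq1 (by rwa [hw])
      · apply ContinuousAt.div
        · exact ContinuousAt.comp (g := E) hE.continuous.continuousAt (continuousAt_inv₀ hw0)
        · fun_prop
        · intro h
          rw [sub_eq_zero] at h
          rw [h] at hw
          linarith
    rw [wInt, ← h1, ← h2]
    have hcongr : (∮ w in C(0, ρ), wKer q (t + 1) y w * (E w⁻¹ / (w - z))) =
        ∮ w in C(0, ρ), ((q : ℂ) ^ (y + t) * (q * (wKer q t (y + 1) w * (E w⁻¹ / (w - z))) -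
          (wKer q t y w * (E w⁻¹ / (w - z))))) := by
      apply circleIntegral.integral_congr hρ.le
      intro w hw
      have hw' : ‖w‖ = ρ := by simpa using hw
      simp only
      rw [wKer_succ hq0 hq1 (by rw [hw', add_assoc]; exact hρy)]
      ring
    have hi1 := hint (y + 1) (by rwa [show y + 1 + t = y + (t + 1) by ring])
    rw [hcongr, circleIntegral.integral_const_mul, circleIntegral.integral_sub
      (by simpa using hi1.const_fun_smul (a := (q : ℂ))) (hint y (hρy.trans_le hlt)),
      circleIntegral.integral_const_mul]
    ring

/-- The `z`-dependent factor of the double contour integrand. -/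
noncomputable def zWt (q : ℝ) {m : ℕ} (X : Fin m → ℕ) (s y : ℕ) (z : ℂ) : ℂ :=
  (z ^ (-((s + 1 : ℕ) : ℤ)) * (qPochC (q : ℂ) (z * (q : ℂ) ^ (1 - (y : ℤ) - (s + 1 : ℕ))) s /
    qPochC (q : ℂ) (q : ℂ) s)) *
    ((∏ r, (1 - (q : ℂ) ^ X r / z)) / qPochCInf (q : ℂ) z⁻¹)

/-- The radius of the outer contour. -/
noncomputable def zRad (q : ℝ) (s y : ℕ) : ℝ :=
  (q ^ ((y : ℤ) + (s + 1 : ℕ)) + q ^ ((y : ℤ) + (s + 1 : ℕ) - 1)) / 2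

theorem zRad_eq (q : ℝ) (s y : ℕ) :
    zRad q s y = (q ^ (y + s + 1) + q ^ (y + s)) / 2 := by
  rw [zRad]
  rw [← zpow_natCast, ← zpow_natCast]
  congr 3
  push_cast; ring

theorem zRad_gt {q : ℝ} (hq0 : 0 < q) (hq1 : q < 1) (s y : ℕ) : q ^ (y + s + 1) < zRad q s y := by
  have h : q ^ (y + s + 1) < q ^ (y + s) := pow_lt_pow_right_of_lt_one₀ hq0 hq1 (by omega)
  rw [zRad_eq]; linarith

theorem zRad_lt {q : ℝ} (hq0 : 0 < q) (hq1 : q < 1) (s y : ℕ) : zRad q s y < q ^ (y + s) := by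
  have h : q ^ (y + s + 1) < q ^ (y + s) := pow_lt_pow_right_of_lt_one₀ hq0 hq1 (by omega)
  rw [zRad_eq]; linarith

theorem zRad_pos {q : ℝ} (hq0 : 0 < q) (hq1 : q < 1) (s y : ℕ) : 0 < zRad q s y :=
  (pow_pos hq0 _).trans (zRad_gt hq0 hq1 s y)

theorem ne_pow_of_norm_eq_zRad {q : ℝ} (hq0 : 0 < q) (hq1 : q < 1) {s y : ℕ} {z : ℂ}
    (hz : ‖z‖ = zRad q s y) (k : ℕ) : z ≠ (q : ℂ) ^ k := by
  rintro rfl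
  rw [norm_pow, Complex.norm_real, Real.norm_eq_abs, abs_of_pos hq0] at hz
  have h1 := zRad_gt hq0 hq1 s y
  have h2 := zRad_lt hq0 hq1 s y
  rw [← hz] at h1 h2
  have h3 := (pow_lt_pow_iff_right_of_lt_one₀ hq0 hq1).1 h1
  have h4 := (pow_lt_pow_iff_right_of_lt_one₀ hq0 hq1).1 h2
  omega

theorem Kwalks_eq_circleIntegral {q : ℝ} (hq0 : 0 < q) (hq1 : q < 1) {m : ℕ} (hm : 0 < m)
    {X : Fin m → ℕ} (hX : StrictAnti X) {E : ℂ → ℂ} (hE : Differentiable ℂ E)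
    (hfac : ∀ v, qPochCInf (q : ℂ) v = (∏ r, (1 - v * (q : ℂ) ^ X r)) * E v)
    (y₁ t₁ y₂ s : ℕ) :
    Kwalks q m (fun r => (X r : ℤ)) y₁ t₁ y₂ (s + 1) =
      (if t₁ = s + 1 ∧ (y₁ : ℤ) = y₂ then 1 else 0)
      - (if t₁ < s + 1 ∧ (y₁ : ℤ) + t₁ < y₂ + (s + 1 : ℕ) then
          (q : ℂ) ^ (((t₁ : ℤ) - (s + 1 : ℕ)) * (y₁ + t₁)) *
            qPochCInt (q : ℂ) (y₁ - y₂ + (t₁ : ℤ) - (s + 1 : ℕ) + 1) (s + 1 - t₁ - 1) /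
            qPochC (q : ℂ) (q : ℂ) (s + 1 - t₁ - 1)
        else 0)
      - (2 * Real.pi * Complex.I)⁻¹ *
          ∮ z in C(0, zRad q s y₂), zWt q X s y₂ z * wInt q E t₁ y₁ z := by
  have hqc : (q : ℂ) ≠ 0 := by exact_mod_cast hq0.ne'
  have hrz := zRad_pos hq0 hq1 s y₂
  rw [Kwalks]
  simp only [hm, dif_pos]
  rw [← zRad]
  congr 1
  set ρ : ℝ := min (q ^ ((y₁ : ℤ) + t₁)) (min (q ^ ((X ⟨0, hm⟩ : ℕ) : ℤ)) (zRad q s y₂)) / 2 with hρ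
  have hmin : 0 < min (q ^ ((y₁ : ℤ) + t₁)) (min (q ^ ((X ⟨0, hm⟩ : ℕ) : ℤ)) (zRad q s y₂)) :=
    lt_min (zpow_pos hq0 _) (lt_min (zpow_pos hq0 _) hrz)
  have hρ0 : 0 < ρ := half_pos hmin
  have hρ1 : ρ < min (q ^ ((y₁ : ℤ) + t₁)) (min (q ^ ((X ⟨0, hm⟩ : ℕ) : ℤ)) (zRad q s y₂)) :=
    half_lt_self hmin
  have hρy : ρ < q ^ (y₁ + t₁) := by
    have := hρ1.trans_le (min_le_left _ _)
    exact_mod_cast this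
  have hρz : ρ < zRad q s y₂ := hρ1.trans_le ((min_le_right _ _).trans (min_le_right _ _))
  have hρx : ∀ r, ρ < q ^ X r := by
    intro r
    have h1 : ρ < q ^ X ⟨0, hm⟩ := by
      have := hρ1.trans_le ((min_le_right _ _).trans (min_le_left _ _))
      exact_mod_cast this
    refine h1.trans_le (pow_le_pow_of_le_one hq0.le hq1.le (hX.antitone ?_))
    exact Fin.mk_le_of_le_val (Nat.zero_le _)
  rw [sq, ← mul_assoc, mul_comm _ (2 * (Real.pi : ℂ) * Complex.I)⁻¹, mul_assoc, mul_assoc]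
  congr 1
  rw [← mul_assoc, ← circleIntegral.integral_const_mul]
  apply circleIntegral.integral_congr hrz.le
  intro z hz
  have hz' : ‖z‖ = zRad q s y₂ := by simpa using hz
  simp only
  rw [← circleIntegral_wKer hq0 hq1 hE (ne_pow_of_norm_eq_zRad hq0 hq1 hz') hρ0
    (by rwa [hz']) t₁ y₁ hρy, mul_comm ((q : ℂ) ^ _), mul_assoc,
    mul_left_comm (zWt q X s y₂ z)]
  congr 1
  rw [← circleIntegral.integral_const_mul, ← circleIntegral.integral_const_mul]
  apply circleIntegral.integral_congr hρ0.le
  intro w hw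
  have hw' : ‖w‖ = ρ := by simpa using hw
  simp only
  have hprod : ∏ r, (1 - w⁻¹ * (q : ℂ) ^ X r) ≠ 0 := by
    rw [Finset.prod_ne_zero_iff]
    intro r _ h
    have hw0 : w ≠ 0 := by rintro rfl; simp at hw'; linarith
    have : w = (q : ℂ) ^ X r := by
      field_simp at h
      linear_combination h
    have h2 := hρx r
    rw [← hw', this, norm_pow, Complex.norm_real, Real.norm_eq_abs, abs_of_pos hq0] at h2
    exact lt_irrefl _ h2
  rw [Finset.prod_div_distrib, hfac w⁻¹, zWt, wKer]
  have e : ∏ r, (1 - (q : ℂ) ^ X r / w) = ∏ r, (1 - w⁻¹ * (q : ℂ) ^ X r) := by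
    apply Finset.prod_congr rfl; intro r _; rw [div_eq_inv_mul]
  simp only [zpow_natCast, Nat.add_sub_cancel]
  rw [e]
  generalize ∏ r, (1 - w⁻¹ * (q : ℂ) ^ X r) = P at *
  generalize hQ : ∏ r, (1 - (q : ℂ) ^ X r / z) = Q
  have hP : P * P⁻¹ = 1 := mul_inv_cancel₀ hprod
  simp only [div_eq_mul_inv]
  rw [show ∀ a b c d e f g h i j k l n : ℂ, a * (b * c * d * (e * f) * (g * h) * (i * j * k) * (l * n)) = a * b * c * d * e * f * g * h * j * k * l * (i * n) from by intros; ring]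
  rw [hP]
  ring

theorem ne_inv_pow_of_ne_pow {q : ℝ} {z : ℂ} (hz : ∀ k : ℕ, z ≠ (q : ℂ) ^ k) (k : ℕ) :
    z⁻¹ ≠ ((q : ℂ) ^ k)⁻¹ :=
  fun h => hz k (inv_injective h)

theorem continuousAt_wInt {q : ℝ} (hq0 : 0 < q) {E : ℂ → ℂ} (hE : Differentiable ℂ E) {z : ℂ}
    (hz0 : z ≠ 0) (hz : ∀ k : ℕ, z ≠ (q : ℂ) ^ k) (t y : ℕ) : ContinuousAt (wInt q E t y) z := by
  have hqc : (q : ℂ) ≠ 0 := by exact_mod_cast hq0.ne'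
  induction t generalizing y with
  | zero =>
    change ContinuousAt (fun z => ((q : ℂ) ^ y)⁻¹ * ((E z⁻¹ - E ((q : ℂ) ^ y)⁻¹) /
      (z * ((q : ℂ) ^ y)⁻¹ - 1))) z
    apply ContinuousAt.mul continuousAt_const
    apply ContinuousAt.div
    · exact (ContinuousAt.comp (g := E) hE.continuous.continuousAt (continuousAt_inv₀ hz0)).sub
        continuousAt_const
    · fun_prop
    · intro h
      apply hz y
      have : (q : ℂ) ^ y ≠ 0 := pow_ne_zero _ hqc
      field_simp at h
      linear_combination h
  | succ t ih =>
    change ContinuousAt (fun z => (q : ℂ) ^ (y + t) * (q * wInt q E t (y + 1) z -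
      wInt q E t y z)) z
    exact continuousAt_const.mul ((continuousAt_const.mul (ih _)).sub (ih _))

theorem continuousAt_zWt {q : ℝ} (hq0 : 0 < q) (hq1 : q < 1) {m : ℕ} (X : Fin m → ℕ) (s y : ℕ)
    {z : ℂ} (hz0 : z ≠ 0) (hz : ∀ k : ℕ, z ≠ (q : ℂ) ^ k) : ContinuousAt (zWt q X s y) z := by
  unfold zWt
  apply ContinuousAt.mul
  · apply ContinuousAt.mul (continuousAt_zpow₀ _ _ (Or.inl hz0))
    apply ContinuousAt.div_const
    unfold qPochC
    fun_prop
  · apply ContinuousAt.div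
    · fun_prop (disch := assumption)
    · exact ContinuousAt.comp (g := qPochCInf (q : ℂ))
        (differentiable_qPochCInf (norm_ofReal_lt_one hq0 hq1)).continuous.continuousAt
        (continuousAt_inv₀ hz0)
    · exact qPochCInf_ne_zero_of_ne hq0 hq1 (ne_inv_pow_of_ne_pow hz)

/-- The double contour integral part of the kernel, with the inner integral evaluated. -/
noncomputable def outerInt (q : ℝ) {m : ℕ} (X : Fin m → ℕ) (E : ℂ → ℂ) (s y₂ t y : ℕ) : ℂ :=
  (2 * Real.pi * Complex.I)⁻¹ * ∮ z in C(0, zRad q s y₂), zWt q X s y₂ z * wInt q E t y z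

theorem outerInt_succ {q : ℝ} (hq0 : 0 < q) (hq1 : q < 1) {m : ℕ} (X : Fin m → ℕ) {E : ℂ → ℂ}
    (hE : Differentiable ℂ E) (s y₂ t y : ℕ) :
    outerInt q X E s y₂ (t + 1) y =
      (q : ℂ) ^ (y + t) * (q * outerInt q X E s y₂ t (y + 1) - outerInt q X E s y₂ t y) := by
  have hr := zRad_pos hq0 hq1 s y₂
  have hint : ∀ y', CircleIntegrable (fun z => zWt q X s y₂ z * wInt q E t y' z) 0 (zRad q s y₂) := by
    intro y'
    apply circleIntegrable_of_continuousAt hr.le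
    intro z hz
    have hz0 : z ≠ 0 := by rintro rfl; simp at hz; linarith
    have hz1 := ne_pow_of_norm_eq_zRad hq0 hq1 hz
    exact (continuousAt_zWt hq0 hq1 X s y₂ hz0 hz1).mul (continuousAt_wInt hq0 hE hz0 hz1 t y')
  have hcongr : (∮ z in C(0, zRad q s y₂), zWt q X s y₂ z * wInt q E (t + 1) y z) =
      ∮ z in C(0, zRad q s y₂), ((q : ℂ) ^ (y + t) * (q * (zWt q X s y₂ z * wInt q E t (y + 1) z) -
        zWt q X s y₂ z * wInt q E t y z)) := by
    congr 1; ext z; rw [wInt]; ring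
  rw [outerInt, hcongr, circleIntegral.integral_const_mul, circleIntegral.integral_sub
    (by simpa using (hint (y + 1)).const_fun_smul (a := (q : ℂ))) (hint y),
    circleIntegral.integral_const_mul, outerInt, outerInt]
  ring

/-- The polynomial in `v = 1 / z` that appears in the outer integrand. -/
noncomputable def zPoly (q : ℝ) (s y : ℕ) (v : ℂ) : ℂ :=
  (∏ i ∈ Finset.range s, (v - ((q : ℂ) ^ (y + s))⁻¹ * (q : ℂ) ^ i)) / qPochC (q : ℂ) (q : ℂ) s

theorem zWt_inv {q : ℝ} (hq0 : 0 < q) {m : ℕ} (X : Fin m → ℕ) (s y : ℕ) {v : ℂ} (hv : v ≠ 0) :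
    zWt q X s y v⁻¹ = v * zPoly q s y v *
      ((∏ r, (1 - v * (q : ℂ) ^ X r)) / qPochCInf (q : ℂ) v) := by
  have hqc : (q : ℂ) ≠ 0 := by exact_mod_cast hq0.ne'
  rw [zWt, inv_inv]
  congr 1
  · rw [qPochC, zPoly, zpow_neg, zpow_natCast, inv_pow, inv_inv, pow_succ', mul_assoc]
    congr 1
    rw [← mul_div_assoc]
    congr 1
    have hpow : v ^ s = ∏ _i ∈ Finset.range s, v := by rw [Finset.prod_const, Finset.card_range]
    rw [hpow, ← Finset.prod_mul_distrib]
    apply Finset.prod_congr rfl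
    intro i _
    rw [mul_sub, mul_one, ← mul_assoc, ← mul_assoc, mul_inv_cancel₀ hv, one_mul]
    congr 2
    rw [← zpow_natCast, ← zpow_neg]; congr 1; push_cast; ring
  · congr 1
    apply Finset.prod_congr rfl
    intro r _
    rw [div_inv_eq_mul, mul_comm]

/-- The jump part of the kernel. -/
noncomputable def jumpKer (q : ℝ) (s y₂ t y : ℕ) : ℂ :=
  if t < s + 1 ∧ (y : ℤ) + t < y₂ + (s + 1 : ℕ) then
    (q : ℂ) ^ (((t : ℤ) - (s + 1 : ℕ)) * (y + t)) *
      qPochCInt (q : ℂ) (y - y₂ + (t : ℤ) - (s + 1 : ℕ) + 1) (s + 1 - t - 1) /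
      qPochC (q : ℂ) (q : ℂ) (s + 1 - t - 1)
  else 0

theorem jumpKer_zero {q : ℝ} (hq0 : 0 < q) (s y₂ y : ℕ) :
    jumpKer q s y₂ 0 y =
      if y < y₂ + s + 1 then ((q : ℂ) ^ y)⁻¹ * zPoly q s y₂ ((q : ℂ) ^ y)⁻¹ else 0 := by
  have hqc : (q : ℂ) ≠ 0 := by exact_mod_cast hq0.ne'
  rw [jumpKer]
  have : (0 < s + 1 ∧ (y : ℤ) + (0 : ℕ) < y₂ + (s + 1 : ℕ)) ↔ y < y₂ + s + 1 := by
    constructor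
    · rintro ⟨_, h⟩; push_cast at h; omega
    · intro h; constructor <;> push_cast <;> omega
  rw [if_congr this rfl rfl]
  congr 1
  rw [zPoly, ← mul_div_assoc, Nat.sub_zero, Nat.add_sub_cancel, qPochCInt]
  congr 1
  have e : (q : ℂ) ^ ((((0 : ℕ) : ℤ) - (s + 1 : ℕ)) * (y + (0 : ℕ))) =
      ((q : ℂ) ^ y)⁻¹ * ∏ i ∈ Finset.range s, ((q : ℂ) ^ y)⁻¹ := by
    rw [Finset.prod_const, Finset.card_range, ← pow_succ', inv_pow, ← pow_mul, ← zpow_natCast,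
      ← zpow_neg]
    congr 1; push_cast; ring
  rw [e, mul_assoc, ← Finset.prod_mul_distrib]
  congr 1
  apply Finset.prod_congr rfl
  intro i _
  rw [mul_sub, mul_one]
  congr 1
  rw [← zpow_natCast, ← zpow_natCast, ← zpow_natCast, ← zpow_neg, ← zpow_neg, ← zpow_add₀ hqc,
    ← zpow_add₀ hqc]
  congr 1; push_cast; ring

theorem differentiable_zPoly (q : ℝ) (s y : ℕ) : Differentiable ℂ (zPoly q s y) := by
  unfold zPoly
  fun_prop

theorem outerInt_zero {q : ℝ} (hq0 : 0 < q) (hq1 : q < 1) {m : ℕ} (X : Fin m → ℕ) {E : ℂ → ℂ}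
    (hfac : ∀ v, qPochCInf (q : ℂ) v = (∏ r, (1 - v * (q : ℂ) ^ X r)) * E v) (s y₂ y : ℕ) :
    outerInt q X E s y₂ 0 y = -jumpKer q s y₂ 0 y - ((q : ℂ) ^ y)⁻¹ * E ((q : ℂ) ^ y)⁻¹ *
      ((2 * Real.pi * Complex.I)⁻¹ * ∮ v in C(0, (zRad q s y₂)⁻¹),
        zPoly q s y₂ v * (∏ r, (1 - v * (q : ℂ) ^ X r)) /
          (qPochCInf (q : ℂ) v * (((q : ℂ) ^ y)⁻¹ - v))) := by
  have hqc : (q : ℂ) ≠ 0 := by exact_mod_cast hq0.ne'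
  have hr := zRad_pos hq0 hq1 s y₂
  have hR : 0 < (zRad q s y₂)⁻¹ := inv_pos.2 hr
  have hpi : (2 * Real.pi * Complex.I : ℂ) ≠ 0 := Complex.two_pi_I_ne_zero
  have hp : ((q : ℂ) ^ y)⁻¹ ≠ 0 := inv_ne_zero (pow_ne_zero _ hqc)
  set p : ℂ := ((q : ℂ) ^ y)⁻¹ with hpdef
  have hv : ∀ v : ℂ, ‖v‖ = (zRad q s y₂)⁻¹ → v ≠ 0 ∧ ∀ k : ℕ, v ≠ ((q : ℂ) ^ k)⁻¹ := by
    intro v hv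
    refine ⟨by rintro rfl; simp at hv; linarith, fun k h => ?_⟩
    refine ne_pow_of_norm_eq_zRad hq0 hq1 (z := v⁻¹) (s := s) (y := y₂) ?_ k ?_
    · rw [norm_inv, hv, inv_inv]
    · rw [h, inv_inv]
  have hpn : ‖p‖ = (q ^ y)⁻¹ := by
    rw [hpdef, norm_inv, norm_pow, Complex.norm_real, Real.norm_eq_abs, abs_of_pos hq0]
  have hi1 : CircleIntegrable (fun v => zPoly q s y₂ v / (v - p)) 0 (zRad q s y₂)⁻¹ := by
    apply circleIntegrable_of_continuousAt hR.le
    intro v hvn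
    apply ContinuousAt.div (differentiable_zPoly q s y₂).continuous.continuousAt (by fun_prop)
    exact sub_ne_zero.2 ((hv v hvn).2 y)
  have hi2 : CircleIntegrable (fun v => zPoly q s y₂ v * (∏ r, (1 - v * (q : ℂ) ^ X r)) /
      (qPochCInf (q : ℂ) v * (p - v))) 0 (zRad q s y₂)⁻¹ := by
    apply circleIntegrable_of_continuousAt hR.le
    intro v hvn
    apply ContinuousAt.div
    · exact (differentiable_zPoly q s y₂).continuous.continuousAt.mul (by fun_prop)
    · exact ((differentiable_qPochCInf
        (norm_ofReal_lt_one hq0 hq1)).continuous.continuousAt).mul (by fun_prop)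
    · exact mul_ne_zero (qPochCInf_ne_zero_of_ne hq0 hq1 (hv v hvn).2)
        (sub_ne_zero.2 ((hv v hvn).2 y).symm)
  have hcongr : (∮ v in C(0, (zRad q s y₂)⁻¹),
      (v ^ 2)⁻¹ * (zWt q X s y₂ v⁻¹ * wInt q E 0 y v⁻¹)) =
      ∮ v in C(0, (zRad q s y₂)⁻¹), ((-p) * (zPoly q s y₂ v / (v - p)) -
        (p * E p) * (zPoly q s y₂ v * (∏ r, (1 - v * (q : ℂ) ^ X r)) /
          (qPochCInf (q : ℂ) v * (p - v)))) := by
    apply circleIntegral.integral_congr hR.le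
    intro v hvn
    have hvn' : ‖v‖ = (zRad q s y₂)⁻¹ := by simpa using hvn
    obtain ⟨h0, h1⟩ := hv v hvn'
    have hne := qPochCInf_ne_zero_of_ne hq0 hq1 h1
    have h2 : v - p ≠ 0 := sub_ne_zero.2 (h1 y)
    have h3 : p - v ≠ 0 := sub_ne_zero.2 (h1 y).symm
    simp only
    rw [zWt_inv hq0 X s y₂ h0, wInt, inv_inv, ← hpdef]
    have h4 : v⁻¹ * p - 1 = (p - v) / v := by field_simp
    rw [h4]
    have hEv : (∏ r, (1 - v * (q : ℂ) ^ X r)) * E v / qPochCInf (q : ℂ) v = 1 := by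
      rw [← hfac, div_self hne]
    have e1 : (v ^ 2)⁻¹ * (v * zPoly q s y₂ v * ((∏ r, (1 - v * (q : ℂ) ^ X r)) /
        qPochCInf (q : ℂ) v) * (p * ((E v - E p) / ((p - v) / v)))) =
        p * (zPoly q s y₂ v / (p - v)) *
          ((∏ r, (1 - v * (q : ℂ) ^ X r)) * E v / qPochCInf (q : ℂ) v) -
        (p * E p) * (zPoly q s y₂ v * (∏ r, (1 - v * (q : ℂ) ^ X r)) /
          (qPochCInf (q : ℂ) v * (p - v))) := by
      field_simp
    rw [e1, hEv, mul_one, ← neg_sub v p, div_neg]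
    ring
  rw [outerInt, circleIntegral_eq_circleIntegral_inv _ hr, hcongr, circleIntegral.integral_sub
    (by simpa using hi1.const_fun_smul (a := -p)) (by simpa using hi2.const_fun_smul (a := p * E p)),
    circleIntegral.integral_const_mul, circleIntegral.integral_const_mul, mul_sub]
  congr 1
  · rw [jumpKer_zero hq0]
    split_ifs with h
    · rw [circleIntegral_div_sub_of_lt]
      · rw [← hpdef]; field_simp
      · rw [hpn]
        apply inv_strictAnti₀ hr
        exact (zRad_lt hq0 hq1 s y₂).trans_le (pow_le_pow_of_le_one hq0.le hq1.le (by omega))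
      · exact (differentiable_zPoly q s y₂).differentiableOn
    · rw [circleIntegral_div_sub_of_gt hR.le]
      · simp
      · rw [hpn]
        apply inv_strictAnti₀ (by positivity)
        refine lt_of_le_of_lt ?_ (zRad_gt hq0 hq1 s y₂)
        exact pow_le_pow_of_le_one hq0.le hq1.le (by omega)
      · exact differentiable_zPoly q s y₂
  · ring

theorem Kwalks_eq_outerInt {q : ℝ} (hq0 : 0 < q) (hq1 : q < 1) {m : ℕ} (hm : 0 < m)
    {X : Fin m → ℕ} (hX : StrictAnti X) {E : ℂ → ℂ} (hE : Differentiable ℂ E)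
    (hfac : ∀ v, qPochCInf (q : ℂ) v = (∏ r, (1 - v * (q : ℂ) ^ X r)) * E v)
    (y₁ t₁ y₂ s : ℕ) :
    Kwalks q m (fun r => (X r : ℤ)) y₁ t₁ y₂ (s + 1) =
      (if t₁ = s + 1 ∧ y₁ = y₂ then 1 else 0) - jumpKer q s y₂ t₁ y₁ -
        outerInt q X E s y₂ t₁ y₁ := by
  rw [Kwalks_eq_circleIntegral hq0 hq1 hm hX hE hfac, jumpKer, outerInt]
  simp only [Nat.cast_inj]

/-- The residue sum giving the kernel at time zero. -/
noncomputable def startCoef (q : ℝ) {m : ℕ} (X : Fin m → ℕ) (r : Fin m) (s y : ℕ) : ℝ :=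
  negQFact q (X r) / (∏ j ∈ Finset.univ.erase r, (1 - (q ^ X r)⁻¹ * q ^ X j)) *
    ∑ k ∈ Finset.range (y + s + 1),
      ((∏ i ∈ Finset.range s, ((q ^ k)⁻¹ - (q ^ (y + s))⁻¹ * q ^ i)) /
          (∏ i ∈ Finset.range s, (1 - q * q ^ i))) *
        (∏ j ∈ Finset.univ.erase r, (1 - (q ^ k)⁻¹ * q ^ X j)) *
        (-(q ^ k)⁻¹ / negQFact q k)

theorem Kwalks_zero_left {q : ℝ} (hq0 : 0 < q) (hq1 : q < 1) {m : ℕ} (hm : 0 < m)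
    {X : Fin m → ℕ} (hX : StrictAnti X) (y y₂ s : ℕ) :
    Kwalks q m (fun r => (X r : ℤ)) y (0 : ℕ) y₂ (s + 1) =
      ((∑ r, if X r = y then startCoef q X r s y₂ else 0 : ℝ) : ℂ) := by
  have hqc : (q : ℂ) ≠ 0 := by exact_mod_cast hq0.ne'
  obtain ⟨E, hE, hfac, hE0, hEr⟩ := exists_qPochCInf_factor hq0 hq1 hX.injective
  have hr := zRad_pos hq0 hq1 s y₂
  rw [Kwalks_eq_outerInt hq0 hq1 hm hX hE hfac, outerInt_zero hq0 hq1 X hfac,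
    if_neg (by simp)]
  by_cases hy : ∃ r, X r = y
  · obtain ⟨r, rfl⟩ := hy
    have hsum : (∑ r', if X r' = X r then startCoef q X r' s y₂ else 0) =
        startCoef q X r s y₂ := by
      rw [Finset.sum_eq_single r]
      · simp
      · intro r' _ h; rw [if_neg (fun h' => h (hX.injective h'))]
      · simp
    rw [hsum]
    have hcongr : (∮ v in C(0, (zRad q s y₂)⁻¹),
        zPoly q s y₂ v * (∏ r, (1 - v * (q : ℂ) ^ X r)) /
          (qPochCInf (q : ℂ) v * (((q : ℂ) ^ X r)⁻¹ - v))) =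
        ∮ v in C(0, (zRad q s y₂)⁻¹), (q : ℂ) ^ X r *
          ((zPoly q s y₂ v * ∏ j ∈ Finset.univ.erase r, (1 - v * (q : ℂ) ^ X j)) /
            qPochCInf (q : ℂ) v) := by
      apply circleIntegral.integral_congr (inv_pos.2 hr).le
      intro v hv
      have hv' : ‖v‖ = (zRad q s y₂)⁻¹ := by simpa using hv
      simp only
      have hne : ((q : ℂ) ^ X r)⁻¹ - v ≠ 0 := by
        intro h
        refine ne_pow_of_norm_eq_zRad hq0 hq1 (z := v⁻¹) (s := s) (y := y₂) ?_ (X r) ?_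
        · rw [norm_inv, hv', inv_inv]
        · rw [← sub_eq_zero.1 h, inv_inv]
      rw [← Finset.mul_prod_erase _ _ (Finset.mem_univ r)]
      have h1 : 1 - v * (q : ℂ) ^ X r = (q : ℂ) ^ X r * (((q : ℂ) ^ X r)⁻¹ - v) := by
        have := pow_ne_zero (X r) hqc
        field_simp
      rw [h1, show ∀ a b c d e : ℂ, a * (b * c * d) / (e * c) = b * (a * d) * c / (e * c) from
        fun a b c d e => by ring, mul_div_mul_right _ _ hne, mul_div_assoc]
    rw [hcongr, circleIntegral.integral_const_mul, mul_left_comm _ ((q : ℂ) ^ X r),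
      circleIntegral_div_qPochCInf hq0 hq1
        (g := fun v => zPoly q s y₂ v * ∏ j ∈ Finset.univ.erase r, (1 - v * (q : ℂ) ^ X j))
        ((differentiable_zPoly q s y₂).mul (by fun_prop)) (M := y₂ + s + 1) (by omega)
        (inv_pos.2 hr)
        (fun k hk => inv_strictAnti₀ hr ((zRad_lt hq0 hq1 s y₂).trans_le
          (pow_le_pow_of_le_one hq0.le hq1.le (by omega))))
        (inv_strictAnti₀ (by positivity) (zRad_gt hq0 hq1 s y₂))]
    have hprod : ∏ j ∈ Finset.univ.erase r, (1 - ((q : ℂ) ^ X r)⁻¹ * (q : ℂ) ^ X j) ≠ 0 := by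
      rw [Finset.prod_ne_zero_iff]
      intro j hj
      exact one_sub_inv_pow_mul_pow_ne_zero hq0 hq1
        (fun h => Finset.ne_of_mem_erase hj (hX.injective h).symm)
    have hEp : E ((q : ℂ) ^ X r)⁻¹ = qPochCInf (q : ℂ) (q : ℂ) * (negQFact q (X r) : ℂ) /
        ∏ j ∈ Finset.univ.erase r, (1 - ((q : ℂ) ^ X r)⁻¹ * (q : ℂ) ^ X j) := by
      rw [← hEr r, mul_div_cancel_right₀ _ hprod]
    have hqq : qPochCInf (q : ℂ) (q : ℂ) ≠ 0 := by
      apply qPochCInf_ne_zero_of_ne hq0 hq1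
      intro k h
      have h2 : ((q * q ^ k : ℝ) : ℂ) = 1 := by
        push_cast
        nth_rewrite 1 [h]
        exact inv_mul_cancel₀ (pow_ne_zero _ hqc)
      have h3 : q * q ^ k = 1 := by exact_mod_cast h2
      have h4 : q ^ k ≤ 1 := pow_le_one₀ hq0.le hq1.le
      nlinarith
    rw [hEp, startCoef]
    push_cast
    rw [Finset.mul_sum, Finset.mul_sum, Finset.mul_sum]
    rw [zero_sub, sub_sub_cancel]
    apply Finset.sum_congr rfl
    intro k _
    rw [zPoly, qPochC]
    generalize (∏ x ∈ Finset.range s, (((q : ℂ) ^ k)⁻¹ - ((q : ℂ) ^ (y₂ + s))⁻¹ * (q : ℂ) ^ x)) = A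
    have := pow_ne_zero (X r) hqc
    generalize (∏ j ∈ Finset.univ.erase r, (1 - ((q : ℂ) ^ X r)⁻¹ * (q : ℂ) ^ X j)) = P at *
    generalize (∏ j ∈ Finset.univ.erase r, (1 - ((q : ℂ) ^ k)⁻¹ * (q : ℂ) ^ X j)) = P'
    generalize qPochCInf (q : ℂ) (q : ℂ) = Q at *
    simp only [div_eq_mul_inv, mul_inv]
    have i1 : Q * Q⁻¹ = 1 := mul_inv_cancel₀ hqq
    have i2 : (q : ℂ) ^ X r * ((q : ℂ) ^ X r)⁻¹ = 1 := mul_inv_cancel₀ this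
    linear_combination (A * (∏ x ∈ Finset.range s, (1 - (q : ℂ) * (q : ℂ) ^ x))⁻¹ * P' *
      ((negQFact q (X r) : ℂ) * P⁻¹) * (-((q : ℂ) ^ k)⁻¹ * (negQFact q k : ℂ)⁻¹)) *
      (Q * Q⁻¹ * i2 + i1)
  · push Not at hy
    rw [hE0 y hy, Finset.sum_eq_zero (fun r _ => if_neg (hy r))]
    push_cast
    ring

theorem jumpKer_add (q : ℝ) (n y₂ t y : ℕ) :
    jumpKer q (t + n) y₂ t y =
      if y < y₂ + n + 1 then (((q : ℂ) ^ (y + t)) ^ (n + 1))⁻¹ *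
        (qPochCInt (q : ℂ) ((y : ℤ) - y₂ - n) n / qPochC (q : ℂ) (q : ℂ) n) else 0 := by
  rw [jumpKer]
  have h1 : (t < t + n + 1 ∧ (y : ℤ) + t < y₂ + (t + n + 1 : ℕ)) ↔ y < y₂ + n + 1 := by
    push_cast
    constructor
    · rintro ⟨_, h⟩; omega
    · intro h; constructor <;> omega
  have h2 : t + n + 1 - t - 1 = n := by omega
  have h3 : (y : ℤ) - y₂ + (t : ℤ) - (t + n + 1 : ℕ) + 1 = (y : ℤ) - y₂ - n := by push_cast; ring
  have h4 : (q : ℂ) ^ (((t : ℤ) - (t + n + 1 : ℕ)) * (y + t)) =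
      (((q : ℂ) ^ (y + t)) ^ (n + 1))⁻¹ := by
    rw [← pow_mul, ← zpow_natCast, ← zpow_neg]; congr 1; push_cast; ring
  rw [if_congr h1 rfl rfl, h2, h3, h4, mul_div_assoc]

theorem jumpKer_of_lt (q : ℝ) {s t : ℕ} (h : s < t) (y₂ y : ℕ) : jumpKer q s y₂ t y = 0 := by
  rw [jumpKer, if_neg (by omega)]

theorem jumpKer_succ_of_lt {q : ℝ} (hq0 : 0 < q) (hq1 : q < 1) (n y₂ t y : ℕ) :
    jumpKer q (t + (n + 1)) y₂ (t + 1) y = (q : ℂ) ^ (y + t) *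
      (q * jumpKer q (t + (n + 1)) y₂ t (y + 1) - jumpKer q (t + (n + 1)) y₂ t y) := by
  have hqc : (q : ℂ) ≠ 0 := by exact_mod_cast hq0.ne'
  have e : jumpKer q (t + (n + 1)) y₂ (t + 1) y = jumpKer q ((t + 1) + n) y₂ (t + 1) y := by
    congr 1; ring
  rw [e, jumpKer_add, jumpKer_add, jumpKer_add]
  have hp1 : qPochC (q : ℂ) (q : ℂ) (n + 1) = qPochC (q : ℂ) (q : ℂ) n * (1 - (q : ℂ) ^ (n + 1)) := by
    rw [qPochC, Finset.prod_range_succ, qPochC, pow_succ']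
  have hpow : ∀ k : ℕ, 1 - (q : ℂ) ^ (k + 1) ≠ 0 := by
    intro k h
    have h1 : q ^ (k + 1) < 1 := pow_lt_one₀ hq0.le hq1 (by omega)
    have h2 : ((q ^ (k + 1) : ℝ) : ℂ) = 1 := by push_cast; linear_combination -h
    have h3 : q ^ (k + 1) = 1 := by exact_mod_cast h2
    linarith
  have hp0 : qPochC (q : ℂ) (q : ℂ) n ≠ 0 := by
    rw [qPochC, Finset.prod_ne_zero_iff]
    intro k _
    rw [← pow_succ']
    exact hpow k
  have hA : qPochCInt (q : ℂ) (((y + 1 : ℕ) : ℤ) - y₂ - (n + 1 : ℕ)) (n + 1) =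
      qPochCInt (q : ℂ) ((y : ℤ) - y₂ - n) n * (1 - (q : ℂ) ^ ((y : ℤ) - y₂)) := by
    rw [qPochCInt, Finset.prod_range_succ, qPochCInt]
    congr 1
    · apply Finset.prod_congr rfl; intro i _; congr 2; push_cast; ring
    · congr 2; push_cast; ring
  have hB : qPochCInt (q : ℂ) ((y : ℤ) - y₂ - (n + 1 : ℕ)) (n + 1) =
      qPochCInt (q : ℂ) ((y : ℤ) - y₂ - n) n * (1 - (q : ℂ) ^ ((y : ℤ) - y₂) *
        ((q : ℂ) ^ (n + 1))⁻¹) := by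
    rw [qPochCInt, Finset.prod_range_succ', qPochCInt]
    congr 1
    · apply Finset.prod_congr rfl; intro i _; congr 2; push_cast; ring
    · rw [← zpow_natCast, ← zpow_neg, ← zpow_add₀ hqc]; congr 2; push_cast; ring
  have hx : (q : ℂ) ^ (y + 1 + t) = q * (q : ℂ) ^ (y + t) := by rw [← pow_succ']; congr 1; ring
  have hx' : (q : ℂ) ^ (y + (t + 1)) = q * (q : ℂ) ^ (y + t) := by rw [← pow_succ']; congr 1
  have h0 : (q : ℂ) ^ (y + t) ≠ 0 := pow_ne_zero _ hqc
  rcases lt_trichotomy y (y₂ + n + 1) with h | h | h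
  · rw [if_pos h, if_pos (by omega), if_pos (by omega), hp1, hA, hB, hx, hx']
    generalize (q : ℂ) ^ (y + t) = x at *
    generalize qPochCInt (q : ℂ) ((y : ℤ) - y₂ - n) n = P
    generalize (q : ℂ) ^ ((y : ℤ) - y₂) = c
    generalize qPochC (q : ℂ) (q : ℂ) n = D at *
    have h1 := hpow n
    rw [mul_pow, mul_pow]
    have hq2 : (q : ℂ) ^ (n + 1) ≠ 0 := pow_ne_zero _ hqc
    rw [pow_succ (q : ℂ) (n + 1), pow_succ x (n + 1)]
    generalize (q : ℂ) ^ (n + 1) = b at *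
    have hx2 : x ^ (n + 1) ≠ 0 := pow_ne_zero _ h0
    generalize x ^ (n + 1) = xx at *
    field_simp
    ring
  · rw [if_neg (by omega), if_neg (by omega), if_pos (by omega)]
    have : qPochCInt (q : ℂ) ((y : ℤ) - y₂ - (n + 1 : ℕ)) (n + 1) = 0 := by
      rw [qPochCInt, Finset.prod_range_succ']
      have : (y : ℤ) - y₂ - (n + 1 : ℕ) + (0 : ℕ) = 0 := by push_cast; omega
      rw [this, zpow_zero, sub_self, mul_zero]
    rw [this]
    ring
  · rw [if_neg (by omega), if_neg (by omega), if_neg (by omega)]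
    ring

theorem jumpKer_top (q : ℝ) (y₂ s y : ℕ) :
    jumpKer q s y₂ s y = if y < y₂ + 1 then ((q : ℂ) ^ (y + s))⁻¹ else 0 := by
  have := jumpKer_add q 0 y₂ s y
  simpa [qPochCInt, qPochC] using this

/-- The part of the kernel that is not a double contour integral satisfies the same recursion in
time as the integral, up to a source at time `s + 1`. -/
theorem indicator_sub_jumpKer_succ {q : ℝ} (hq0 : 0 < q) (hq1 : q < 1) (s y₂ t y : ℕ) :
    (if t + 1 = s + 1 ∧ y = y₂ then (1 : ℂ) else 0) - jumpKer q s y₂ (t + 1) y =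
      (q : ℂ) ^ (y + t) * (q * ((if t = s + 1 ∧ y + 1 = y₂ then (1 : ℂ) else 0) -
          jumpKer q s y₂ t (y + 1)) -
        ((if t = s + 1 ∧ y = y₂ then (1 : ℂ) else 0) - jumpKer q s y₂ t y)) -
      (if t = s + 1 then (q : ℂ) ^ (y + t) * (q * (if y + 1 = y₂ then (1 : ℂ) else 0) -
        (if y = y₂ then (1 : ℂ) else 0)) else 0) := by
  have hqc : (q : ℂ) ≠ 0 := by exact_mod_cast hq0.ne'
  rcases lt_trichotomy t s with h | rfl | h
  · obtain ⟨n, rfl⟩ : ∃ n, s = t + (n + 1) := ⟨s - t - 1, by omega⟩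
    rw [jumpKer_succ_of_lt hq0 hq1, if_neg (by omega), if_neg (by omega), if_neg (by omega),
      if_neg (by omega)]
    ring
  · rw [jumpKer_of_lt q (Nat.lt_succ_self t), jumpKer_top, jumpKer_top]
    have h0 : (q : ℂ) ^ (y + t) ≠ 0 := pow_ne_zero _ hqc
    have hx : (q : ℂ) ^ (y + 1 + t) = q * (q : ℂ) ^ (y + t) := by rw [← pow_succ']; congr 1; ring
    rw [hx]
    rcases lt_trichotomy y y₂ with h | h | h
    · rw [if_neg (by omega), if_neg (by omega), if_pos (by omega), if_neg (by omega),
        if_pos (by omega), if_neg (by omega)]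
      field_simp
      ring
    · rw [if_pos (by omega), if_neg (by omega), if_neg (by omega), if_neg (by omega),
        if_pos (by omega), if_neg (by omega)]
      field_simp
      ring
    · rw [if_neg (by omega), if_neg (by omega), if_neg (by omega), if_neg (by omega),
        if_neg (by omega), if_neg (by omega)]
      ring
  · rw [jumpKer_of_lt q (by omega), jumpKer_of_lt q h, jumpKer_of_lt q h, if_neg (by omega)]
    by_cases h1 : t = s + 1
    · simp only [h1, true_and, if_true]
      ring
    · simp only [h1, false_and, if_false]
      ring

/-- The gauge factor conjugating the kernel into its probabilistic form. -/
noncomputable def gaugeFun (q : ℝ) (d : ℕ) : ℕ → ℕ → ℝ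
  | 0, y => (q ^ (d * y))⁻¹ / negQFact q y
  | t + 1, y => -(q ^ t)⁻¹ * gaugeFun q d t y

theorem gaugeFun_ne_zero {q : ℝ} (hq0 : 0 < q) (hq1 : q < 1) (d t y : ℕ) : gaugeFun q d t y ≠ 0 := by
  induction t with
  | zero =>
    exact div_ne_zero (inv_ne_zero (pow_ne_zero _ hq0.ne')) (negQFact_ne_zero hq0 hq1 y)
  | succ t ih =>
    exact mul_ne_zero (neg_ne_zero.2 (inv_ne_zero (pow_ne_zero _ hq0.ne'))) ih

theorem gaugeFun_succ_right {q : ℝ} (hq0 : 0 < q) (hq1 : q < 1) (d t y : ℕ) :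
    gaugeFun q d t (y + 1) * (q ^ d * (1 - q ^ (y + 1))) = -q ^ (y + 1) * gaugeFun q d t y := by
  induction t with
  | zero =>
    have h1 := negQFact_ne_zero hq0 hq1 y
    have h2 := negQFact_ne_zero hq0 hq1 (y + 1)
    rw [gaugeFun, gaugeFun]
    rw [negQFact_succ] at h2 ⊢
    have h3 := (mul_ne_zero_iff.1 h2).2
    have hq := hq0.ne'
    rw [show d * (y + 1) = d * y + d by ring, pow_add]
    have e : 1 - q ^ (y + 1) = -q ^ (y + 1) * (1 - (q ^ (y + 1))⁻¹) := by
      field_simp; ring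
    rw [e]
    generalize 1 - (q ^ (y + 1))⁻¹ = a at *
    field_simp
  | succ t ih =>
    rw [gaugeFun, gaugeFun]
    linear_combination (-(q ^ t)⁻¹) * ih

/-- Powers of the one-particle transition operator. -/
noncomputable def walkPow (q : ℝ) (d : ℕ) : ℕ → ℕ → ℕ → ℝ
  | 0, x, y => if x = y then 1 else 0
  | t + 1, x, y => walkPow q d t x y * q ^ y +
      walkPow q d t x (y + 1) * (q ^ d * (1 - q ^ (y + 1)))

/-- The functions biorthogonal to the one-particle transition probabilities. -/
noncomputable def dualFun (q : ℝ) {m : ℕ} (X : Fin m → ℕ) (r : Fin m) : ℕ → ℕ → ℝ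
  | 0, y => ∏ j ∈ Finset.univ.erase r, (q ^ y - q ^ X j) / (q ^ X r - q ^ X j)
  | s + 1, y => gaugeFun q (m - 1) 0 (X r) / gaugeFun q (m - 1) (s + 1) y * startCoef q X r s y

/-- The gauge-transformed kernel. -/
noncomputable def algKer (q : ℝ) {m : ℕ} (X : Fin m → ℕ) (y₂ t₂ t y : ℕ) : ℝ :=
  ∑ r, walkPow q (m - 1) t (X r) y * dualFun q X r t₂ y₂ -
    if t₂ < t then walkPow q (m - 1) (t - t₂) y₂ y else 0

theorem algKer_succ (q : ℝ) {m : ℕ} (X : Fin m → ℕ) (y₂ t₂ t y : ℕ) :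
    algKer q X y₂ t₂ (t + 1) y = algKer q X y₂ t₂ t y * q ^ y +
      algKer q X y₂ t₂ t (y + 1) * (q ^ (m - 1) * (1 - q ^ (y + 1))) -
      if t = t₂ then (if y = y₂ then 1 else 0) * q ^ y +
        (if y + 1 = y₂ then 1 else 0) * (q ^ (m - 1) * (1 - q ^ (y + 1))) else 0 := by
  have hs : ∑ r, walkPow q (m - 1) (t + 1) (X r) y * dualFun q X r t₂ y₂ =
      (∑ r, walkPow q (m - 1) t (X r) y * dualFun q X r t₂ y₂) * q ^ y +
      (∑ r, walkPow q (m - 1) t (X r) (y + 1) * dualFun q X r t₂ y₂) *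
        (q ^ (m - 1) * (1 - q ^ (y + 1))) := by
    rw [Finset.sum_mul, Finset.sum_mul, ← Finset.sum_add_distrib]
    apply Finset.sum_congr rfl
    intro r _
    rw [walkPow]; ring
  rw [algKer, algKer, algKer, hs]
  rcases lt_trichotomy t t₂ with h | rfl | h
  · rw [if_neg (by omega), if_neg (by omega), if_neg (by omega), if_neg (by omega)]
    ring
  · rw [if_pos (by omega), if_neg (by omega), if_neg (by omega), if_pos rfl]
    rw [show t + 1 - t = 0 + 1 by omega, walkPow, walkPow, walkPow]
    simp only [eq_comm (a := y₂)]
    ring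
  · rw [if_pos (by omega), if_pos h, if_pos h, if_neg (by omega),
      show t + 1 - t₂ = (t - t₂) + 1 by omega, walkPow]
    ring

theorem gaugeFun_algKer_succ {q : ℝ} (hq0 : 0 < q) (hq1 : q < 1) {m : ℕ} (X : Fin m → ℕ)
    (y₂ t₂ t y : ℕ) :
    gaugeFun q (m - 1) t₂ y₂ / gaugeFun q (m - 1) (t + 1) y * algKer q X y₂ t₂ (t + 1) y =
      q ^ (y + t) * (q * (gaugeFun q (m - 1) t₂ y₂ / gaugeFun q (m - 1) t (y + 1) *
          algKer q X y₂ t₂ t (y + 1)) -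
        gaugeFun q (m - 1) t₂ y₂ / gaugeFun q (m - 1) t y * algKer q X y₂ t₂ t y) -
      (if t = t₂ then q ^ (y + t) * (q * (if y + 1 = y₂ then 1 else 0) -
        (if y = y₂ then 1 else 0)) else 0) := by
  have h1 := gaugeFun_ne_zero hq0 hq1 (m - 1) t y
  have h2 := gaugeFun_ne_zero hq0 hq1 (m - 1) t (y + 1)
  have hR := gaugeFun_succ_right hq0 hq1 (m - 1) t y
  have hw : q ^ (m - 1) * (1 - q ^ (y + 1)) =
      -q ^ (y + 1) * gaugeFun q (m - 1) t y / gaugeFun q (m - 1) t (y + 1) := by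
    field_simp; linear_combination hR
  rw [algKer_succ, gaugeFun, hw]
  have hq := hq0.ne'
  by_cases ht : t = t₂
  · subst ht
    rw [if_pos rfl, if_pos rfl]
    by_cases hy : y = y₂
    · subst hy
      rw [if_pos rfl, if_neg (by omega)]
      field_simp
      ring
    · by_cases hy' : y + 1 = y₂
      · subst hy'
        rw [if_neg hy, if_pos rfl]
        field_simp
        ring
      · rw [if_neg hy, if_neg hy']
        field_simp
        ring
  · rw [if_neg ht, if_neg ht]
    field_simp
    ring

theorem Kwalks_succ_left {q : ℝ} (hq0 : 0 < q) (hq1 : q < 1) {m : ℕ} (hm : 0 < m)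
    {X : Fin m → ℕ} (hX : StrictAnti X) (y t y₂ s : ℕ) :
    Kwalks q m (fun r => (X r : ℤ)) y (t + 1) y₂ (s + 1) =
      (q : ℂ) ^ (y + t) * (q * Kwalks q m (fun r => (X r : ℤ)) (y + 1 : ℕ) t y₂ (s + 1) -
        Kwalks q m (fun r => (X r : ℤ)) y t y₂ (s + 1)) -
      (if t = s + 1 then (q : ℂ) ^ (y + t) * (q * (if y + 1 = y₂ then (1 : ℂ) else 0) -
        (if y = y₂ then (1 : ℂ) else 0)) else 0) := by
  obtain ⟨E, hE, hfac, -, -⟩ := exists_qPochCInf_factor hq0 hq1 hX.injective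
  rw [Kwalks_eq_outerInt hq0 hq1 hm hX hE hfac, Kwalks_eq_outerInt hq0 hq1 hm hX hE hfac,
    Kwalks_eq_outerInt hq0 hq1 hm hX hE hfac, outerInt_succ hq0 hq1 X hE,
    indicator_sub_jumpKer_succ hq0 hq1]
  ring

theorem Kwalks_eq_algKer {q : ℝ} (hq0 : 0 < q) (hq1 : q < 1) {m : ℕ} (hm : 0 < m)
    {X : Fin m → ℕ} (hX : StrictAnti X) (y t y₂ s : ℕ) :
    Kwalks q m (fun r => (X r : ℤ)) y t y₂ (s + 1) =
      ((gaugeFun q (m - 1) (s + 1) y₂ / gaugeFun q (m - 1) t y * algKer q X y₂ (s + 1) t y : ℝ) : ℂ) := by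
  induction t generalizing y with
  | zero =>
    rw [Kwalks_zero_left hq0 hq1 hm hX]
    congr 1
    rw [algKer, if_neg (by omega), sub_zero, Finset.mul_sum]
    apply Finset.sum_congr rfl
    intro r _
    rw [walkPow]
    split_ifs with h
    · subst h
      rw [dualFun]
      have h1 := gaugeFun_ne_zero hq0 hq1 (m - 1) 0 (X r)
      have h2 := gaugeFun_ne_zero hq0 hq1 (m - 1) (s + 1) y₂
      field_simp
    · ring
  | succ t ih =>
    rw [Kwalks_succ_left hq0 hq1 hm hX, ih, ih, gaugeFun_algKer_succ hq0 hq1]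
    push_cast
    congr 1
    split_ifs <;> push_cast <;> ring

/-- The polynomial factor of the residue at `q^{-k}`. -/
noncomputable def resPoly (q : ℝ) (s y k : ℕ) : ℝ :=
  (∏ i ∈ Finset.range s, ((q ^ k)⁻¹ - (q ^ (y + s))⁻¹ * q ^ i)) /
    ∏ i ∈ Finset.range s, (1 - q * q ^ i)

/-- The initial-condition factor of the residue at `q^{-k}`. -/
noncomputable def resWeight (q : ℝ) {m : ℕ} (X : Fin m → ℕ) (r : Fin m) (k : ℕ) : ℝ :=
  (∏ j ∈ Finset.univ.erase r, (1 - (q ^ k)⁻¹ * q ^ X j)) * (-(q ^ k)⁻¹ / negQFact q k)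

theorem startCoef_eq (q : ℝ) {m : ℕ} (X : Fin m → ℕ) (r : Fin m) (s y : ℕ) :
    startCoef q X r s y =
      negQFact q (X r) / (∏ j ∈ Finset.univ.erase r, (1 - (q ^ X r)⁻¹ * q ^ X j)) *
        ∑ k ∈ Finset.range (y + s + 1), resPoly q s y k * resWeight q X r k := by
  simp only [startCoef, resPoly, resWeight, mul_assoc]

theorem one_sub_pow_succ_ne_zero {q : ℝ} (hq0 : 0 < q) (hq1 : q < 1) (k : ℕ) :
    1 - q ^ (k + 1) ≠ 0 := by
  have h1 : q ^ (k + 1) < 1 := pow_lt_one₀ hq0.le hq1 (by omega)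
  linarith

/-- The factors shared by consecutive values of `resPoly`. -/
theorem resPoly_succ {q : ℝ} (hq0 : 0 < q) (n y k : ℕ) :
    resPoly q (n + 1) y k =
      resPoly q n y k * ((q ^ k)⁻¹ - (q ^ (y + n + 1))⁻¹) / (1 - q ^ (n + 1)) := by
  have hq := hq0.ne'
  rw [resPoly, Finset.prod_range_succ', Finset.prod_range_succ, resPoly, pow_zero, mul_one,
    ← pow_succ' q n]
  have : ∏ i ∈ Finset.range n, ((q ^ k)⁻¹ - (q ^ (y + (n + 1)))⁻¹ * q ^ (i + 1)) =
      ∏ i ∈ Finset.range n, ((q ^ k)⁻¹ - (q ^ (y + n))⁻¹ * q ^ i) := by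
    apply Finset.prod_congr rfl
    intro i _
    congr 1
    rw [← add_assoc, pow_succ, pow_succ]
    field_simp
  rw [this, ← add_assoc]
  simp only [div_eq_mul_inv, mul_inv]
  ring

theorem resPoly_succ_succ {q : ℝ} (hq0 : 0 < q) (n y k : ℕ) :
    resPoly q (n + 1) y k =
      resPoly q n (y + 1) k * ((q ^ k)⁻¹ - (q ^ (y + 1))⁻¹) / (1 - q ^ (n + 1)) := by
  have hq := hq0.ne'
  rw [resPoly, Finset.prod_range_succ, Finset.prod_range_succ, resPoly, ← pow_succ' q n]
  have : (q ^ (y + (n + 1)))⁻¹ * q ^ n = (q ^ (y + 1))⁻¹ := by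
    rw [show y + (n + 1) = (y + 1) + n by ring, pow_add]
    field_simp
  rw [this, show y + (n + 1) = y + 1 + n by ring]
  simp only [div_eq_mul_inv, mul_inv]
  ring

theorem resPoly_eq_zero {q : ℝ} (hq0 : 0 < q) {s y k : ℕ} (h1 : y < k) (h2 : k ≤ y + s) :
    resPoly q s y k = 0 := by
  have hq := hq0.ne'
  rw [resPoly, Finset.prod_eq_zero (i := y + s - k) (Finset.mem_range.2 (by omega)), zero_div]
  rw [sub_eq_zero]
  obtain ⟨c, hc⟩ : ∃ c, y + s = k + c := ⟨y + s - k, by omega⟩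
  rw [hc, Nat.add_sub_cancel_left, pow_add]
  field_simp

theorem sum_resPoly_succ {q : ℝ} (hq0 : 0 < q) {m : ℕ} (X : Fin m → ℕ)
    (r : Fin m) (n y : ℕ) :
    ∑ k ∈ Finset.range (y + (n + 1) + 1), resPoly q (n + 1) y k * resWeight q X r k =
      ∑ k ∈ Finset.range (y + n + 1), resPoly q (n + 1) y k * resWeight q X r k := by
  rw [← add_assoc, Finset.sum_range_succ _ (y + n + 1),
    resPoly_eq_zero hq0 (s := n + 1) (y := y) (by omega) (by omega), zero_mul, add_zero]

theorem dualFun_backward {q : ℝ} (hq0 : 0 < q) (hq1 : q < 1) {m : ℕ} {X : Fin m → ℕ}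
    (hX : Function.Injective X) (r : Fin m) (t y : ℕ) :
    q ^ y * dualFun q X r (t + 1) y +
      q ^ (m - 1) * (1 - q ^ y) * dualFun q X r (t + 1) (y - 1) = dualFun q X r t y := by
  have hq := hq0.ne'
  set C := gaugeFun q (m - 1) 0 (X r) *
    (negQFact q (X r) / (∏ j ∈ Finset.univ.erase r, (1 - (q ^ X r)⁻¹ * q ^ X j))) with hC
  set S : ℕ → ℕ → ℝ := fun s y => ∑ k ∈ Finset.range (y + s + 1),
    resPoly q s y k * resWeight q X r k with hS
  have hdual : ∀ s y, dualFun q X r (s + 1) y = C / gaugeFun q (m - 1) (s + 1) y * S s y := by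
    intro s y
    rw [dualFun, startCoef_eq, hC]; ring
  have hy1 : ∀ y, q ^ (m - 1) * (1 - q ^ (y + 1)) / gaugeFun q (m - 1) (t + 1) y =
      -q ^ (y + 1) / gaugeFun q (m - 1) (t + 1) (y + 1) := by
    intro y
    have h1 := gaugeFun_ne_zero hq0 hq1 (m - 1) (t + 1) y
    have h2 := gaugeFun_ne_zero hq0 hq1 (m - 1) (t + 1) (y + 1)
    rw [div_eq_div_iff h1 h2, ← gaugeFun_succ_right hq0 hq1]; ring
  have hgt := gaugeFun_ne_zero hq0 hq1 (m - 1) t y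
  cases t with
  | succ n =>
    rw [hdual n, hdual (n + 1)]
    cases y with
    | zero =>
      have e : S (n + 1) 0 = -(q ^ (n + 1))⁻¹ * S n 0 := by
        simp only [hS]
        rw [sum_resPoly_succ hq0, Finset.mul_sum]
        apply Finset.sum_congr rfl
        intro k hk
        rw [Finset.mem_range] at hk
        rw [resPoly_succ hq0]
        rcases Nat.eq_zero_or_pos k with rfl | hk0
        · have := one_sub_pow_succ_ne_zero hq0 hq1 n
          simp only [zero_add, pow_zero, inv_one]
          generalize resPoly q n 0 0 = R
          field_simp
          ring
        · rw [resPoly_eq_zero hq0 hk0 (by omega)]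
          ring
      rw [pow_zero, sub_self, mul_zero, zero_mul, add_zero, one_mul, e, gaugeFun]
      have : q ^ (n + 1) ≠ 0 := pow_ne_zero _ hq
      field_simp
    | succ y =>
      have e : q ^ (y + 1) * (S (n + 1) (y + 1) - S (n + 1) y) =
          -(q ^ (n + 1))⁻¹ * S n (y + 1) := by
        simp only [hS]
        rw [sum_resPoly_succ hq0, show y + (n + 1) + 1 = y + 1 + n + 1 by ring,
          ← Finset.sum_sub_distrib, Finset.mul_sum, Finset.mul_sum]
        apply Finset.sum_congr rfl
        intro k hk
        rw [resPoly_succ hq0, resPoly_succ_succ hq0]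
        have := one_sub_pow_succ_ne_zero hq0 hq1 n
        generalize resPoly q n (y + 1) k = R
        rw [show y + 1 + n + 1 = (y + 1) + (n + 1) by ring, pow_add q (y + 1) (n + 1)]
        have h3 : q ^ (y + 1) ≠ 0 := pow_ne_zero _ hq
        have h4 : q ^ (n + 1) ≠ 0 := pow_ne_zero _ hq
        generalize q ^ (y + 1) = a at *
        generalize q ^ (n + 1) = b at *
        field_simp
        ring
      rw [Nat.add_sub_cancel, hdual (n + 1) y]
      have h5 := hy1 y
      calc _ = C / gaugeFun q (m - 1) (n + 1 + 1) (y + 1) * (q ^ (y + 1) * S (n + 1) (y + 1)) +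
            (q ^ (m - 1) * (1 - q ^ (y + 1)) / gaugeFun q (m - 1) (n + 1 + 1) y) *
              (C * S (n + 1) y) := by ring
        _ = C / gaugeFun q (m - 1) (n + 1 + 1) (y + 1) *
            (q ^ (y + 1) * (S (n + 1) (y + 1) - S (n + 1) y)) := by rw [h5]; ring
        _ = _ := by
          rw [e, gaugeFun]
          have : q ^ (n + 1) ≠ 0 := pow_ne_zero _ hq
          field_simp
  | zero =>
    have hS0 : ∀ y, S 0 (y + 1) = S 0 y + resWeight q X r (y + 1) := by
      intro y
      simp only [hS, resPoly, Finset.range_zero, Finset.prod_empty, div_one, one_mul, add_zero]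
      rw [Finset.sum_range_succ]
    have hS1 : S 0 0 = resWeight q X r 0 := by simp [hS, resPoly]
    have hlhs : q ^ y * dualFun q X r (0 + 1) y +
        q ^ (m - 1) * (1 - q ^ y) * dualFun q X r (0 + 1) (y - 1) =
        C / gaugeFun q (m - 1) (0 + 1) y * (q ^ y * resWeight q X r y) := by
      rw [hdual 0 y]
      cases y with
      | zero => rw [hS1]; ring
      | succ y =>
        rw [Nat.add_sub_cancel, hdual 0 y, hS0]
        have h5 := hy1 y
        calc _ = C / gaugeFun q (m - 1) (0 + 1) (y + 1) * (q ^ (y + 1) *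
              (S 0 y + resWeight q X r (y + 1))) +
              (q ^ (m - 1) * (1 - q ^ (y + 1)) / gaugeFun q (m - 1) (0 + 1) y) *
                (C * S 0 y) := by ring
          _ = _ := by rw [h5]; ring
    rw [hlhs, hC, resWeight, dualFun, gaugeFun, gaugeFun, gaugeFun, Finset.prod_div_distrib]
    have hcard : (Finset.univ.erase r).card = m - 1 := by
      rw [Finset.card_erase_of_mem (Finset.mem_univ r), Finset.card_univ, Fintype.card_fin]
    have hfac : ∀ k : ℕ, ∏ j ∈ Finset.univ.erase r, (q ^ k - q ^ X j) =
        q ^ ((m - 1) * k) * ∏ j ∈ Finset.univ.erase r, (1 - (q ^ k)⁻¹ * q ^ X j) := by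
      intro k
      have h6 : q ^ ((m - 1) * k) = ∏ _j ∈ Finset.univ.erase r, q ^ k := by
        rw [Finset.prod_const, hcard, ← pow_mul, mul_comm]
      rw [h6, ← Finset.prod_mul_distrib]
      apply Finset.prod_congr rfl
      intro j _
      have : q ^ k ≠ 0 := pow_ne_zero _ hq
      field_simp
    rw [hfac, hfac]
    have hden : ∏ j ∈ Finset.univ.erase r, (1 - (q ^ X r)⁻¹ * q ^ X j) ≠ 0 := by
      rw [Finset.prod_ne_zero_iff]
      intro j hj h
      have h7 : q ^ X r ≠ 0 := pow_ne_zero _ hq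
      have h8 : q ^ X r = q ^ X j := by field_simp at h; linear_combination h
      exact Finset.ne_of_mem_erase hj (hX ((pow_right_strictAnti₀ hq0 hq1).injective h8)).symm
    have h9 := negQFact_ne_zero hq0 hq1 (X r)
    have h10 := negQFact_ne_zero hq0 hq1 y
    generalize (∏ j ∈ Finset.univ.erase r, (1 - (q ^ X r)⁻¹ * q ^ X j)) = D at *
    generalize (∏ j ∈ Finset.univ.erase r, (1 - (q ^ y)⁻¹ * q ^ X j)) = D'
    have h11 : q ^ ((m - 1) * X r) ≠ 0 := pow_ne_zero _ hq
    have h12 : q ^ ((m - 1) * y) ≠ 0 := pow_ne_zero _ hq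
    rw [pow_zero]
    generalize q ^ ((m - 1) * X r) = b at *
    generalize q ^ ((m - 1) * y) = b' at *
    have h13 : q ^ y ≠ 0 := pow_ne_zero _ hq
    field_simp

theorem dualFun_zero_apply {q : ℝ} (hq0 : 0 < q) (hq1 : q < 1) {m : ℕ} {X : Fin m → ℕ}
    (hX : Function.Injective X) (r j : Fin m) :
    dualFun q X r 0 (X j) = if j = r then 1 else 0 := by
  rw [dualFun]
  split_ifs with h
  · subst h
    apply Finset.prod_eq_one
    intro i hi
    apply div_self
    intro h
    exact Finset.ne_of_mem_erase hi
      (hX ((pow_right_strictAnti₀ hq0 hq1).injective (sub_eq_zero.1 h))).symm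
  · exact Finset.prod_eq_zero (Finset.mem_erase.2 ⟨h, Finset.mem_univ j⟩) (by simp)

/-- Strictly decreasing `m`-tuples in `{0, …, N - 1}`. -/
abbrev StrictTuple (m N : ℕ) : Type := {y : Fin m → Fin N // StrictAnti y}

noncomputable instance (m N : ℕ) : Fintype (StrictTuple m N) := Fintype.ofFinite _

theorem perm_eq_one_of_strictMono {m : ℕ} {σ : Equiv.Perm (Fin m)} (hσ : StrictMono σ) :
    σ = 1 := by
  have h : (σ : Fin m → Fin m) = id := by
    apply (hσ.range_inj strictMono_id).1
    rw [σ.surjective.range_eq, Set.range_id]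
  exact Equiv.ext fun i => congrFun h i

theorem exists_perm_strictAnti {m N : ℕ} {p : Fin m → Fin N} (hp : Function.Injective p) :
    ∃ σ : Equiv.Perm (Fin m), StrictAnti (p ∘ σ) := by
  refine ⟨Tuple.sort (fun i => OrderDual.toDual (p i)), ?_⟩
  have h := Tuple.monotone_sort (fun i => OrderDual.toDual (p i))
  apply Antitone.strictAnti_of_injective
  · intro a b hab
    exact h hab
  · exact hp.comp (Equiv.injective _)

/-- The Cauchy–Binet formula. -/
theorem sum_det_mul_det {R : Type*} [CommRing R] {m N : ℕ} (A : Matrix (Fin m) (Fin N) R)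
    (B : Matrix (Fin N) (Fin m) R) :
    ∑ y : StrictTuple m N, (A.submatrix id y.1).det * (B.submatrix y.1 id).det = (A * B).det := by
  classical
  have h1 : (A * B).det = ∑ p : Fin m → Fin N, (A.submatrix id p).det * ∏ i, B (p i) i := by
    rw [Matrix.det_apply']
    simp only [Matrix.mul_apply, Finset.prod_univ_sum, Fintype.piFinset_univ,
      Finset.mul_sum, Finset.prod_mul_distrib]
    rw [Finset.sum_comm]
    apply Finset.sum_congr rfl
    intro p _
    rw [Matrix.det_apply', Finset.sum_mul]
    apply Finset.sum_congr rfl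
    intro σ _
    simp only [Matrix.submatrix_apply, id]
    ring
  have h2 : ∑ p : Fin m → Fin N, (A.submatrix id p).det * ∏ i, B (p i) i =
      ∑ p ∈ Finset.univ.filter (fun p : Fin m → Fin N => Function.Injective p),
        (A.submatrix id p).det * ∏ i, B (p i) i := by
    rw [Finset.sum_filter_of_ne]
    intro p _ hne
    by_contra hp
    apply hne
    rw [Function.Injective] at hp
    push Not at hp
    obtain ⟨i, j, hij, hne'⟩ := hp
    rw [Matrix.det_zero_of_column_eq hne' (fun k => by simp [hij]), zero_mul]
  rw [h1, h2]
  have h3 : ∀ y : StrictTuple m N, (A.submatrix id y.1).det * (B.submatrix y.1 id).det =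
      ∑ σ : Equiv.Perm (Fin m), (A.submatrix id (y.1 ∘ σ)).det * ∏ i, B ((y.1 ∘ σ) i) i := by
    intro y
    rw [Matrix.det_apply' (B.submatrix y.1 id), Finset.mul_sum]
    apply Finset.sum_congr rfl
    intro σ _
    have : A.submatrix id (y.1 ∘ σ) = (A.submatrix id y.1).submatrix id σ := rfl
    rw [this, Matrix.det_permute']
    simp only [Matrix.submatrix_apply, id, Function.comp]
    ring
  simp only [h3]
  rw [← Finset.sum_product', Finset.univ_product_univ]
  apply Finset.sum_bij (fun (a : StrictTuple m N × Equiv.Perm (Fin m)) _ => a.1.1 ∘ a.2)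
  · rintro ⟨y, σ⟩ _
    simp only [Finset.mem_filter, Finset.mem_univ, true_and]
    exact y.2.injective.comp σ.injective
  · rintro ⟨⟨y, hy⟩, σ⟩ _ ⟨⟨y', hy'⟩, σ'⟩ _ h
    simp only at h
    have h4 : y' = y ∘ (σ * σ'⁻¹ : Equiv.Perm (Fin m)) := by
      ext i
      have := congrFun h (σ'⁻¹ i)
      simp only [Function.comp] at this
      rw [show σ' (σ'⁻¹ i) = i from σ'.apply_symm_apply i] at this
      rw [← this]
      rfl
    have h5 : σ * σ'⁻¹ = 1 := by
      apply perm_eq_one_of_strictMono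
      intro a b hab
      have h6 := hy' hab
      rw [h4] at h6
      exact hy.lt_iff_gt.1 h6
    rw [h5] at h4
    have h7 : σ = σ' := mul_inv_eq_one.1 h5
    subst h7
    simp at h4
    subst h4
    rfl
  · intro p hp
    simp only [Finset.mem_filter, Finset.mem_univ, true_and] at hp
    obtain ⟨σ, hσ⟩ := exists_perm_strictAnti hp
    refine ⟨(⟨p ∘ σ, hσ⟩, σ⁻¹), Finset.mem_univ _, ?_⟩
    ext i
    simp
  · intro a _
    rfl

/-- A minor of a bidiagonal matrix is the product of its diagonal entries. -/
theorem det_submatrix_of_bidiagonal {R : Type*} [CommRing R] {m N : ℕ}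
    {M : Matrix (Fin N) (Fin N) R}
    (hM : ∀ a b, M a b ≠ 0 → (b : ℕ) ≤ a ∧ (a : ℕ) ≤ b + 1) {x y : Fin m → Fin N}
    (hx : StrictAnti x) (hy : StrictAnti y) :
    (M.submatrix x y).det = ∏ i, M (x i) (y i) := by
  classical
  rw [Matrix.det_apply', Finset.sum_eq_single 1]
  · simp
  · intro σ _ hσ
    by_contra hne
    apply hσ
    have h1 : ∀ i, M (x (σ i)) (y i) ≠ 0 := by
      intro i h0
      apply hne
      rw [Finset.prod_eq_zero (Finset.mem_univ i) (by simpa using h0), mul_zero]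
    apply perm_eq_one_of_strictMono
    apply Monotone.strictMono_of_injective _ σ.injective
    intro i j hij
    rcases hij.eq_or_lt with rfl | hlt
    · exact le_rfl
    · have h2 := (hM _ _ (h1 i)).1
      have h3 := (hM _ _ (h1 j)).2
      have h4 : (y j : ℕ) < y i := hy hlt
      apply hx.le_iff_ge.1
      exact Fin.le_def.2 (by omega)
  · simp

/-- The one-particle transition operator, truncated to `{0, …, N - 1}`. -/
noncomputable def walkMat (q : ℝ) (d N : ℕ) : Matrix (Fin N) (Fin N) ℝ :=
  Matrix.of fun a b => (if (b : ℕ) = a then q ^ (a : ℕ) else 0) +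
    if (b : ℕ) + 1 = a then q ^ d * (1 - q ^ (a : ℕ)) else 0

theorem sum_walkMat_mul (q : ℝ) (d N : ℕ) (a : Fin N) (f : ℕ → ℝ) :
    ∑ b, walkMat q d N a b * f b =
      q ^ (a : ℕ) * f a + q ^ d * (1 - q ^ (a : ℕ)) * f (a - 1) := by
  simp only [walkMat, Matrix.of_apply, add_mul, Finset.sum_add_distrib]
  congr 1
  · rw [Finset.sum_eq_single a]
    · simp
    · intro b _ hb
      rw [if_neg (fun h => hb (Fin.ext h)), zero_mul]
    · simp
  · obtain ⟨a, ha⟩ := a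
    cases a with
    | zero => simp
    | succ a =>
      rw [Finset.sum_eq_single ⟨a, by omega⟩]
      · simp
      · intro b _ hb
        rw [if_neg (fun h => hb (Fin.ext (by simpa using h))), zero_mul]
      · simp

theorem walkMat_bidiagonal (q : ℝ) (d N : ℕ) (a b : Fin N) (h : walkMat q d N a b ≠ 0) :
    (b : ℕ) ≤ a ∧ (a : ℕ) ≤ b + 1 := by
  by_contra hc
  apply h
  rw [walkMat, Matrix.of_apply, if_neg (by omega), if_neg (by omega), add_zero]

theorem walkPow_eq_zero (q : ℝ) (d t : ℕ) {x y : ℕ} (h : x < y) : walkPow q d t x y = 0 := by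
  induction t generalizing y with
  | zero => rw [walkPow, if_neg (by omega)]
  | succ t ih => rw [walkPow, ih h, ih (by omega)]; ring

theorem walkMat_pow_apply (q : ℝ) (d N t : ℕ) (a b : Fin N) :
    (walkMat q d N ^ t) a b = walkPow q d t a b := by
  induction t generalizing b with
  | zero => simp [walkPow, Matrix.one_apply, Fin.ext_iff]
  | succ t ih =>
    rw [pow_succ, Matrix.mul_apply, walkPow]
    simp only [ih]
    simp only [walkMat, Matrix.of_apply, mul_add, Finset.sum_add_distrib]
    congr 1
    · rw [Finset.sum_eq_single b]
      · simp
      · intro c _ hc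
        rw [if_neg (fun h => hc (Fin.ext h.symm)), mul_zero]
      · simp
    · by_cases hb : (b : ℕ) + 1 < N
      · rw [Finset.sum_eq_single ⟨b + 1, hb⟩]
        · simp
        · intro c _ hc
          rw [if_neg (fun h => hc (Fin.ext h.symm)), mul_zero]
        · simp
      · rw [walkPow_eq_zero q d t (by omega), zero_mul]
        apply Finset.sum_eq_zero
        intro c _
        rw [if_neg (by omega), mul_zero]

theorem isUnit_walkMat {q : ℝ} (hq0 : 0 < q) (d N : ℕ) : IsUnit (walkMat q d N) := by
  rw [Matrix.isUnit_iff_isUnit_det, Matrix.det_of_isLowerTriangular]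
  · rw [isUnit_iff_ne_zero, Finset.prod_ne_zero_iff]
    intro a _
    rw [walkMat, Matrix.of_apply, if_pos rfl, if_neg (by omega), add_zero]
    exact pow_ne_zero _ hq0.ne'
  · intro a b hab
    have hab : (a : ℕ) < b := hab
    rw [walkMat, Matrix.of_apply, if_neg (by omega), if_neg (by omega), add_zero]

/-- The matrix of the biorthogonal functions at a given time. -/
noncomputable def dualMat (q : ℝ) {m : ℕ} (X : Fin m → ℕ) (N t : ℕ) : Matrix (Fin N) (Fin m) ℝ :=
  Matrix.of fun b r => dualFun q X r t b

theorem walkMat_mul_dualMat {q : ℝ} (hq0 : 0 < q) (hq1 : q < 1) {m : ℕ} {X : Fin m → ℕ}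
    (hX : Function.Injective X) (N t : ℕ) :
    walkMat q (m - 1) N * dualMat q X N (t + 1) = dualMat q X N t := by
  ext a r
  rw [Matrix.mul_apply]
  simp only [dualMat, Matrix.of_apply]
  rw [sum_walkMat_mul q (m - 1) N a (fun b => dualFun q X r (t + 1) b),
    dualFun_backward hq0 hq1 hX]

theorem walkMat_pow_mul_dualMat {q : ℝ} (hq0 : 0 < q) (hq1 : q < 1) {m : ℕ} {X : Fin m → ℕ}
    (hX : Function.Injective X) (N s t : ℕ) :
    walkMat q (m - 1) N ^ t * dualMat q X N (s + t) = dualMat q X N s := by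
  induction t with
  | zero => simp
  | succ t ih => rw [pow_succ, Matrix.mul_assoc, ← add_assoc, walkMat_mul_dualMat hq0 hq1 hX, ih]

/-- The rectangular Vandermonde matrix in the nodes `1, q, q², …`. -/
noncomputable def vandMat (q : ℝ) (m N : ℕ) : Matrix (Fin N) (Fin m) ℝ :=
  Matrix.of fun b k => (q ^ (b : ℕ)) ^ (k : ℕ)

theorem dualMat_zero_mul_vandermonde {q : ℝ} (hq0 : 0 < q) (hq1 : q < 1) {m : ℕ} {X : Fin m → ℕ}
    (hX : Function.Injective X) (N : ℕ) :
    dualMat q X N 0 * Matrix.vandermonde (fun r => q ^ X r) = vandMat q m N := by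
  classical
  ext b k
  have hinj : Set.InjOn (fun r => q ^ X r) (Finset.univ : Finset (Fin m)) := by
    intro r _ s _ h
    exact hX (pow_right_injective₀ hq0 hq1.ne h)
  have h := Lagrange.eq_interpolate (f := (Polynomial.X : Polynomial ℝ) ^ (k : ℕ)) hinj (by
    rw [Polynomial.degree_X_pow, Finset.card_univ, Fintype.card_fin]
    exact_mod_cast k.2)
  have h2 := congrArg (Polynomial.eval (q ^ (b : ℕ))) h
  rw [Lagrange.interpolate_apply, Polynomial.eval_finsetSum, Polynomial.eval_pow,
    Polynomial.eval_X] at h2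
  rw [vandMat, Matrix.of_apply, h2, Matrix.mul_apply]
  apply Finset.sum_congr rfl
  intro r _
  simp only [dualMat, Matrix.of_apply, dualFun, Matrix.vandermonde_apply, Polynomial.eval_mul,
    Polynomial.eval_C, Polynomial.eval_pow, Polynomial.eval_X, Lagrange.basis,
    Polynomial.eval_prod, Lagrange.basisDivisor, Polynomial.eval_sub]
  rw [mul_comm]
  congr 1
  apply Finset.prod_congr rfl
  intro j _
  rw [div_eq_mul_inv, mul_comm]

/-- The matrix of the one-particle transition operator in the basis `(q ^ x) ^ k`. -/
noncomputable def vandStep (q : ℝ) (m : ℕ) : Matrix (Fin m) (Fin m) ℝ :=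
  Matrix.of fun l k => (if (l : ℕ) = k then q ^ (m - 1 - k : ℕ) else 0) +
    if (l : ℕ) = k + 1 then 1 - q ^ (m - 1 - k : ℕ) else 0

theorem walkMat_mul_vandMat (q : ℝ) (m N : ℕ) :
    walkMat q (m - 1) N * vandMat q m N = vandMat q m N * vandStep q m := by
  ext a k
  rw [Matrix.mul_apply, Matrix.mul_apply]
  simp only [vandMat, Matrix.of_apply]
  rw [sum_walkMat_mul q (m - 1) N a (fun b => (q ^ b) ^ (k : ℕ))]
  simp only [vandStep, Matrix.of_apply, mul_add, Finset.sum_add_distrib]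
  have h1 : ∑ l : Fin m, (q ^ (a : ℕ)) ^ (l : ℕ) * (if (l : ℕ) = k then q ^ (m - 1 - k : ℕ) else 0) =
      (q ^ (a : ℕ)) ^ (k : ℕ) * q ^ (m - 1 - k : ℕ) := by
    rw [Finset.sum_eq_single k]
    · simp
    · intro b _ hb
      rw [if_neg (fun h => hb (Fin.ext h)), mul_zero]
    · simp
  have h2 : ∑ l : Fin m, (q ^ (a : ℕ)) ^ (l : ℕ) *
      (if (l : ℕ) = k + 1 then 1 - q ^ (m - 1 - k : ℕ) else 0) =
      (q ^ (a : ℕ)) ^ (k + 1 : ℕ) * (1 - q ^ (m - 1 - k : ℕ)) := by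
    by_cases hk : (k : ℕ) + 1 < m
    · rw [Finset.sum_eq_single ⟨k + 1, hk⟩]
      · simp
      · intro b _ hb
        rw [if_neg (fun h => hb (Fin.ext h)), mul_zero]
      · simp
    · rw [show m - 1 - k = 0 by omega, pow_zero, sub_self, mul_zero]
      simp
  rw [h1, h2]
  obtain ⟨a, ha⟩ := a
  cases a with
  | zero => simp
  | succ a =>
    have e : q ^ (m - 1) = q ^ (m - 1 - k : ℕ) * q ^ (k : ℕ) := by
      rw [← pow_add]; congr 1; omega
    simp only [Nat.add_sub_cancel]
    rw [e, pow_succ q a, mul_pow]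
    ring

theorem det_vandStep (q : ℝ) (m : ℕ) :
    (vandStep q m).det = q ^ (m * (m - 1) / 2) := by
  rw [Matrix.det_of_isLowerTriangular]
  · have : ∀ k : Fin m, vandStep q m k k = q ^ (m - 1 - k : ℕ) := by
      intro k
      simp [vandStep]
    simp only [this]
    rw [Finset.prod_pow_eq_pow_sum, Fin.sum_univ_eq_sum_range (fun k => m - 1 - k) m,
      Finset.sum_range_reflect (fun k => k), Finset.sum_range_id]
  · intro l k hlk
    have hlk : (l : ℕ) < k := hlk
    rw [vandStep, Matrix.of_apply, if_neg (by omega), if_neg (by omega), add_zero]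

theorem dualMat_mul_eq_vandMat {q : ℝ} (hq0 : 0 < q) (hq1 : q < 1) {m : ℕ} {X : Fin m → ℕ}
    (hX : Function.Injective X) (N t : ℕ) :
    dualMat q X N t * (Matrix.vandermonde (fun r => q ^ X r) * vandStep q m ^ t) =
      vandMat q m N := by
  have h1 : walkMat q (m - 1) N ^ t * vandMat q m N = vandMat q m N * vandStep q m ^ t := by
    induction t with
    | zero => simp
    | succ t ih =>
      rw [pow_succ, Matrix.mul_assoc, walkMat_mul_vandMat, ← Matrix.mul_assoc, ih,
        Matrix.mul_assoc, ← pow_succ]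
  have h2 := walkMat_pow_mul_dualMat hq0 hq1 hX N 0 t
  rw [zero_add] at h2
  have hu := (Matrix.isUnit_iff_isUnit_det _).1 ((isUnit_walkMat hq0 (m - 1) N).pow t)
  rw [← Matrix.nonsing_inv_mul_cancel_left _ (dualMat q X N t * _) hu,
    ← Matrix.nonsing_inv_mul_cancel_left _ (vandMat q m N) hu, ← Matrix.mul_assoc _ (dualMat q X N t),
    h2, ← Matrix.mul_assoc (dualMat q X N 0), dualMat_zero_mul_vandermonde hq0 hq1 hX, h1]

theorem det_mul_vandMat {q : ℝ} (hq0 : 0 < q) (hq1 : q < 1) {m : ℕ} {X : Fin m → ℕ}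
    (hX : Function.Injective X) (N t : ℕ) (A : Matrix (Fin m) (Fin N) ℝ) :
    (A * vandMat q m N).det = (A * dualMat q X N t).det *
      (Matrix.vandermonde (fun r => q ^ X r)).det * (q ^ (m * (m - 1) / 2)) ^ t := by
  rw [← dualMat_mul_eq_vandMat hq0 hq1 hX N t, ← Matrix.mul_assoc, Matrix.det_mul, Matrix.det_mul,
    Matrix.det_pow, det_vandStep, mul_assoc]

/-- A strictly decreasing tuple of naturals, viewed as an element of `W_m`. -/
def StrictTuple.toWm {m N : ℕ} (y : StrictTuple m N) : {z : Fin m → ℤ // Wm m z} :=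
  ⟨fun i => ((y.1 i : ℕ) : ℤ), fun i j hij => by
    have h : (y.1 j : ℕ) < y.1 i := y.2 hij
    exact Int.ofNat_lt.2 h, fun i => Int.natCast_nonneg _⟩

theorem StrictTuple.toWm_injective {m N : ℕ} :
    Function.Injective (StrictTuple.toWm (m := m) (N := N)) := by
  intro y z h
  apply Subtype.ext
  funext i
  have h1 : ((y.1 i : ℕ) : ℤ) = ((z.1 i : ℕ) : ℤ) := congrFun (congrArg Subtype.val h) i
  exact Fin.ext (by exact_mod_cast h1)

theorem StrictTuple.exists_toWm_eq {m N : ℕ} (z : {z : Fin m → ℤ // Wm m z})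
    (hz : ∀ i, z.1 i < N) : ∃ y : StrictTuple m N, y.toWm = z := by
  have h0 := z.2.2
  refine ⟨⟨fun i => ⟨(z.1 i).toNat, by have := hz i; have := h0 i; omega⟩, ?_⟩, ?_⟩
  · intro i j hij
    have h1 := z.2.1 hij
    have h2 := h0 i
    have h3 := h0 j
    exact Fin.lt_def.2 (by simp only; omega)
  · apply Subtype.ext
    funext i
    exact Int.toNat_of_nonneg (h0 i)

theorem tsum_wm_eq_sum {m N : ℕ} (f : {z : Fin m → ℤ // Wm m z} → ℝ)
    (hf : ∀ z, f z ≠ 0 → ∀ i, z.1 i < N) :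
    ∑' z, f z = ∑ y : StrictTuple m N, f y.toWm := by
  rw [← StrictTuple.toWm_injective.tsum_eq (f := f), tsum_fintype]
  intro z hz
  exact StrictTuple.exists_toWm_eq z (hf z hz)

theorem UpsM_support {q : ℝ} {m : ℕ} {x y : Fin m → ℤ} (h : UpsM q m x y ≠ 0) (i : Fin m) :
    y i ≤ x i := by
  have h1 := (mul_ne_zero_iff.1 h).2
  rw [UpsInd, Finset.prod_ne_zero_iff] at h1
  by_contra hc
  apply h1 i (Finset.mem_univ i)
  rw [if_neg (by omega), if_neg (by omega)]
  ring

theorem UpsPow_support {q : ℝ} {m s : ℕ} {x y : Fin m → ℤ} (h : UpsPow q m s x y ≠ 0)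
    (i : Fin m) : y i ≤ x i := by
  induction s generalizing y with
  | zero =>
    rw [UpsPow] at h
    by_contra hc
    exact h (if_neg fun e => hc (by rw [e]))
  | succ s ih =>
    by_contra hc
    apply h
    rw [UpsPow]
    refine (tsum_congr fun z => ?_).trans tsum_zero
    by_contra hz
    rw [mul_eq_zero, not_or] at hz
    exact hc ((UpsM_support hz.2 i).trans (ih hz.1))

theorem det_vandMat_submatrix (q : ℝ) {m N : ℕ} (y : Fin m → Fin N) :
    ((vandMat q m N).submatrix y id).det =
      ∏ i : Fin m, ∏ j ∈ Finset.Ioi i, (q ^ (y j : ℕ) - q ^ (y i : ℕ)) := by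
  rw [← Matrix.det_vandermonde]
  rfl

theorem det_vandMat_submatrix_ne_zero {q : ℝ} (hq0 : 0 < q) (hq1 : q < 1) {m N : ℕ}
    (y : StrictTuple m N) : ((vandMat q m N).submatrix y.1 id).det ≠ 0 := by
  rw [det_vandMat_submatrix, Finset.prod_ne_zero_iff]
  intro i _
  rw [Finset.prod_ne_zero_iff]
  intro j hj
  have h : (y.1 j : ℕ) < y.1 i := y.2 (Finset.mem_Ioi.1 hj)
  rw [sub_ne_zero]
  intro e
  exact h.ne (pow_right_injective₀ hq0 hq1.ne e)

theorem zpow_sum_eq_prod {ι K : Type*} [Field K] {q : K} (hq : q ≠ 0) (s : Finset ι) (f : ι → ℤ) :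
    q ^ (∑ i ∈ s, f i) = ∏ i ∈ s, q ^ f i := by
  classical
  induction s using Finset.induction_on with
  | empty => simp
  | insert a s ha ih => rw [Finset.sum_insert ha, Finset.prod_insert ha, zpow_add₀ hq, ih]

theorem UpsM_eq_det {q : ℝ} (hq0 : 0 < q) {m N : ℕ} (hm : 0 < m)
    (x y : StrictTuple m N) :
    UpsM q m x.toWm.1 y.toWm.1 = (q ^ (m * (m - 1) / 2))⁻¹ *
      (((vandMat q m N).submatrix y.1 id).det / ((vandMat q m N).submatrix x.1 id).det) *
      ((walkMat q (m - 1) N).submatrix x.1 y.1).det := by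
  have h1 : ∀ a b : Fin N, walkMat q (m - 1) N a b =
      q ^ (((m : ℤ) - 1) * (((a : ℕ) : ℤ) - ((b : ℕ) : ℤ))) *
        (q ^ ((a : ℕ) : ℤ) * (if ((b : ℕ) : ℤ) = ((a : ℕ) : ℤ) then 1 else 0) +
        (1 - q ^ ((a : ℕ) : ℤ)) * (if ((b : ℕ) : ℤ) = ((a : ℕ) : ℤ) - 1 then 1 else 0)) := by
    intro a b
    rw [walkMat, Matrix.of_apply]
    have hd : ((m : ℤ) - 1) = ((m - 1 : ℕ) : ℤ) := by omega
    by_cases h : (b : ℕ) = a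
    · rw [if_pos h, if_neg (by omega), if_pos (by omega), if_neg (by omega), h]
      simp
    · rw [if_neg h]
      by_cases h' : (b : ℕ) + 1 = a
      · rw [if_pos h', if_neg (by omega), if_pos (by omega),
          show (((a : ℕ) : ℤ) - ((b : ℕ) : ℤ)) = 1 by omega, mul_one, hd, zpow_natCast, zpow_natCast]
        ring
      · rw [if_neg h', if_neg (by omega), if_neg (by omega)]
        ring
  have hk : (m : ℤ) * ((m : ℤ) - 1) / 2 = ((m * (m - 1) / 2 : ℕ) : ℤ) := by
    push_cast [Nat.cast_sub hm]
    rfl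
  rw [det_submatrix_of_bidiagonal (walkMat_bidiagonal q (m - 1) N) x.2 y.2, UpsM, UpsInd, hk,
    zpow_add₀ hq0.ne', zpow_neg, zpow_natCast, ← Finset.sum_sub_distrib, Finset.mul_sum,
    det_vandMat_submatrix, det_vandMat_submatrix]
  simp only [h1, Finset.prod_mul_distrib, Finset.prod_div_distrib, StrictTuple.toWm, zpow_natCast]
  rw [zpow_sum_eq_prod hq0.ne']
  have hcomm : ∀ a b c e : ℝ, a * b * c * e = a * c * (b * e) := fun a b c e => by ring
  exact hcomm _ _ _ _

theorem UpsPow_eq_det {q : ℝ} (hq0 : 0 < q) (hq1 : q < 1) {m N : ℕ} (hm : 0 < m) (s : ℕ)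
    (x y : StrictTuple m N) :
    UpsPow q m s x.toWm.1 y.toWm.1 = ((q ^ (m * (m - 1) / 2)) ^ s)⁻¹ *
      (((vandMat q m N).submatrix y.1 id).det / ((vandMat q m N).submatrix x.1 id).det) *
      ((walkMat q (m - 1) N ^ s).submatrix x.1 y.1).det := by
  induction s generalizing y with
  | zero =>
    have hb : ∀ a b : Fin N, (1 : Matrix (Fin N) (Fin N) ℝ) a b ≠ 0 →
        (b : ℕ) ≤ a ∧ (a : ℕ) ≤ b + 1 := by
      intro a b h
      rw [Matrix.one_apply] at h
      have : a = b := by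
        by_contra hc
        exact h (if_neg hc)
      subst this
      exact ⟨le_rfl, by omega⟩
    rw [UpsPow, pow_zero, pow_zero, det_submatrix_of_bidiagonal hb x.2 y.2]
    by_cases h : x = y
    · subst h
      simp [det_vandMat_submatrix_ne_zero hq0 hq1 x]
    · rw [if_neg (fun e => h (StrictTuple.toWm_injective (Subtype.ext e)))]
      have : ∃ i, x.1 i ≠ y.1 i := by
        by_contra hc
        push Not at hc
        exact h (Subtype.ext (funext hc))
      obtain ⟨i, hi⟩ := this
      have h0 : ∏ i, (1 : Matrix (Fin N) (Fin N) ℝ) (x.1 i) (y.1 i) = 0 :=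
        Finset.prod_eq_zero (Finset.mem_univ i) (Matrix.one_apply_ne hi)
      rw [h0, mul_zero]
  | succ s ih =>
    rw [UpsPow, tsum_wm_eq_sum (N := N)]
    · have hmul : (walkMat q (m - 1) N ^ (s + 1)).submatrix x.1 y.1 =
          (walkMat q (m - 1) N ^ s).submatrix x.1 id * (walkMat q (m - 1) N).submatrix id y.1 := by
        rw [pow_succ]
        rfl
      rw [hmul, ← sum_det_mul_det, Finset.mul_sum]
      apply Finset.sum_congr rfl
      intro z _
      rw [ih, UpsM_eq_det hq0 hm]
      have hz := det_vandMat_submatrix_ne_zero hq0 hq1 z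
      have hq := hq0.ne'
      simp only [Matrix.submatrix_submatrix, Function.comp_id, Function.id_comp]
      field_simp
      ring
    · intro z hz i
      have h1 := UpsPow_support (mul_ne_zero_iff.1 hz).1 i
      have h2 : x.toWm.1 i < N := by
        show ((x.1 i : ℕ) : ℤ) < N
        exact_mod_cast (x.1 i).2
      exact h1.trans_lt h2

section Dressed

variable {R ι κ ν : Type*} [CommRing R] [Fintype ι] [DecidableEq ν]

/-- The one-time weight `∏ (1 + h i)` over the marked points at time `s` and position `b`. -/
def markWeight (u : ι → ν) (t : ι → ℕ) (h : ι → R) (s : ℕ) (b : ν) : R :=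
  ∏ i, if t i = s ∧ u i = b then 1 + h i else 1

theorem markWeight_eq {u : ι → ν} {t : ι → ℕ} (hut : Function.Injective fun i => (u i, t i))
    (h : ι → R) (s : ℕ) (b : ν) :
    markWeight u t h s b = 1 + ∑ i, if t i = s ∧ u i = b then h i else 0 := by
  rw [markWeight]
  by_cases hex : ∃ i, t i = s ∧ u i = b
  · obtain ⟨i, hi⟩ := hex
    have huniq : ∀ j, j ≠ i → ¬(t j = s ∧ u j = b) := by
      rintro j hj ⟨h1, h2⟩
      exact hj (hut (Prod.ext (h2.trans hi.2.symm) (h1.trans hi.1.symm)))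
    rw [Finset.prod_eq_single i (fun j _ hj => if_neg (huniq j hj)) (by simp),
      Finset.sum_eq_single i (fun j _ hj => if_neg (huniq j hj)) (by simp), if_pos hi, if_pos hi]
  · push Not at hex
    rw [Finset.prod_eq_one fun i _ => if_neg fun hi => hex i hi.1 hi.2,
      Finset.sum_eq_zero fun i _ => if_neg fun hi => hex i hi.1 hi.2, add_zero]

variable [Fintype ν]

/-- Products of transition matrices with the marked weights inserted at each time. -/
def dressed (u : ι → ν) (t : ι → ℕ) (h : ι → R) (V : Matrix ν ν R) (X₀ : Matrix κ ν R) :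
    ℕ → Matrix κ ν R
  | 0 => X₀
  | s + 1 => dressed u t h V X₀ s * Matrix.diagonal (markWeight u t h s) * V

variable {u : ι → ν} {t : ι → ℕ} (h : ι → R) (V : Matrix ν ν R) (X₀ : Matrix κ ν R)

theorem mul_diagonal_markWeight_mul {μ : Type*} (hut : Function.Injective fun i => (u i, t i))
    (s : ℕ) (A : Matrix κ ν R) (B : Matrix ν μ R) (r : κ) (b : μ) :
    (A * Matrix.diagonal (markWeight u t h s) * B) r b =
      (A * B) r b + ∑ i, if t i = s then h i * A r (u i) * B (u i) b else 0 := by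
  rw [Matrix.mul_apply]
  simp only [Matrix.mul_diagonal, markWeight_eq hut]
  simp only [mul_add, mul_one, add_mul, Finset.sum_add_distrib, Finset.mul_sum, Finset.sum_mul]
  rw [Matrix.mul_apply]
  congr 1
  rw [Finset.sum_comm]
  apply Finset.sum_congr rfl
  intro i _
  by_cases hi : t i = s
  · rw [if_pos hi, Finset.sum_eq_single (u i)]
    · rw [if_pos ⟨hi, rfl⟩]; ring
    · intro c _ hc
      rw [if_neg (fun e => hc e.2.symm)]; ring
    · simp
  · rw [if_neg hi]
    apply Finset.sum_eq_zero
    intro c _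
    rw [if_neg (fun e => hi e.1)]; ring

theorem dressed_apply (hut : Function.Injective fun i => (u i, t i)) (s : ℕ) (r : κ) (b : ν) :
    dressed u t h V X₀ s r b = (X₀ * V ^ s) r b + ∑ i, if t i < s then
      h i * dressed u t h V X₀ (t i) r (u i) * (V ^ (s - t i)) (u i) b else 0 := by
  induction s generalizing b with
  | zero => simp [dressed]
  | succ s ih =>
    rw [dressed, mul_diagonal_markWeight_mul h hut, Matrix.mul_apply]
    simp only [ih, add_mul, Finset.sum_add_distrib, Finset.sum_mul]
    rw [pow_succ, ← Matrix.mul_assoc, Matrix.mul_apply (M := X₀ * V ^ s), add_assoc]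
    congr 1
    rw [Finset.sum_comm, ← Finset.sum_add_distrib]
    apply Finset.sum_congr rfl
    intro i _
    rcases lt_trichotomy (t i) s with hi | hi | hi
    · simp only [if_pos hi, if_neg hi.ne, if_pos (show t i < s + 1 by omega), add_zero]
      rw [show s + 1 - t i = (s - t i) + 1 by omega, pow_succ, Matrix.mul_apply, Finset.mul_sum]
      exact Finset.sum_congr rfl fun c _ => by ring
    · subst hi
      simp only [lt_irrefl, if_false, if_pos (Nat.lt_succ_self (t i)), if_true, zero_mul,
        Finset.sum_const_zero, zero_add]
      rw [← ih, show t i + 1 - t i = 1 by omega, pow_one]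
    · simp only [if_neg (show ¬ t i < s by omega), if_neg hi.ne',
        if_neg (show ¬ t i < s + 1 by omega), zero_mul, Finset.sum_const_zero, add_zero]

variable [DecidableEq κ]

theorem dressed_mul_apply {Ψ : ℕ → Matrix ν κ R} (hut : Function.Injective fun i => (u i, t i))
    (h0 : X₀ * Ψ 0 = 1) (hΨ : ∀ s, V * Ψ (s + 1) = Ψ s) (s : ℕ) (r r' : κ) :
    (dressed u t h V X₀ s * Ψ s) r r' = (1 : Matrix κ κ R) r r' + ∑ i, if t i < s then
      h i * dressed u t h V X₀ (t i) r (u i) * Ψ (t i) (u i) r' else 0 := by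
  induction s with
  | zero => simp [dressed, h0]
  | succ s ih =>
    rw [dressed, Matrix.mul_assoc _ V, hΨ, mul_diagonal_markWeight_mul h hut, ih, add_assoc,
      ← Finset.sum_add_distrib]
    congr 1
    apply Finset.sum_congr rfl
    intro i _
    rcases lt_trichotomy (t i) s with hi | hi | hi
    · rw [if_pos hi, if_neg hi.ne, if_pos (by omega), add_zero]
    · subst hi
      rw [if_neg (lt_irrefl _), if_pos rfl, if_pos (by omega), zero_add]
    · rw [if_neg (by omega), if_neg (by omega), if_neg (by omega), add_zero]

theorem det_one_sub_diagonal_mul_of_time [DecidableEq ι] (t : ι → ℕ) (h : ι → R)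
    {W : Matrix ι ι R} (hW : ∀ i j, ¬ t i < t j → W i j = 0) :
    (1 - Matrix.diagonal h * W).det = 1 := by
  have hbt : (1 - Matrix.diagonal h * W).BlockTriangular t := by
    intro i j hij
    have hne : i ≠ j := by rintro rfl; exact lt_irrefl _ hij
    rw [Matrix.sub_apply, Matrix.one_apply_ne hne, Matrix.diagonal_mul, hW i j hij.asymm]
    ring
  rw [hbt.det]
  apply Finset.prod_eq_one
  intro s _
  have : (1 - Matrix.diagonal h * W).toSquareBlock t s = 1 := by
    ext ⟨i, hi⟩ ⟨j, hj⟩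
    rw [Matrix.toSquareBlock_def, Matrix.of_apply, Matrix.sub_apply, Matrix.diagonal_mul,
      hW i j (by rw [hi, hj]; exact lt_irrefl _), mul_zero, sub_zero, Matrix.one_apply,
      Matrix.one_apply]
    simp only [Subtype.mk.injEq]
  rw [this, Matrix.det_one]

theorem det_dressed [DecidableEq ι] [Fintype κ] {Ψ : ℕ → Matrix ν κ R}
    (hut : Function.Injective fun i => (u i, t i))
    (h0 : X₀ * Ψ 0 = 1) (hΨ : ∀ s, V * Ψ (s + 1) = Ψ s) (T : ℕ) (hT : ∀ i, t i ≤ T) :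
    (dressed u t h V X₀ T * Matrix.diagonal (markWeight u t h T) * Ψ T).det =
      (1 + Matrix.diagonal h * Matrix.of fun i j =>
        ∑ r, (X₀ * V ^ t j) r (u j) * Ψ (t i) (u i) r -
          if t i < t j then (V ^ (t j - t i)) (u i) (u j) else 0).det := by
  set c : Matrix κ ι R := Matrix.of fun r i => dressed u t h V X₀ (t i) r (u i) with hc
  set B : Matrix ι κ R := Matrix.of fun i r => Ψ (t i) (u i) r with hB
  set A : Matrix κ ι R := Matrix.of fun r j => (X₀ * V ^ t j) r (u j) with hA
  set W : Matrix ι ι R := Matrix.of fun i j =>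
    if t i < t j then (V ^ (t j - t i)) (u i) (u j) else 0 with hW
  have h1 : dressed u t h V X₀ T * Matrix.diagonal (markWeight u t h T) * Ψ T =
      1 + c * (Matrix.diagonal h * B) := by
    ext r r'
    have e := dressed_mul_apply h V X₀ hut h0 hΨ (T + 1) r r'
    rw [dressed, Matrix.mul_assoc _ V, hΨ] at e
    rw [e, Matrix.add_apply, Matrix.mul_apply]
    congr 1
    apply Finset.sum_congr rfl
    intro i _
    rw [if_pos (Nat.lt_succ_of_le (hT i)), Matrix.diagonal_mul, hc, hB, Matrix.of_apply,
      Matrix.of_apply]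
    ring
  have h2 : c = A + c * (Matrix.diagonal h * W) := by
    ext r j
    rw [Matrix.add_apply, Matrix.mul_apply, hc, hA, Matrix.of_apply, dressed_apply h V X₀ hut,
      Matrix.of_apply]
    congr 1
    apply Finset.sum_congr rfl
    intro i _
    rw [Matrix.diagonal_mul, hW, Matrix.of_apply, Matrix.of_apply]
    split_ifs <;> ring
  have h3 : (Matrix.of fun i j => ∑ r, (X₀ * V ^ t j) r (u j) * Ψ (t i) (u i) r -
      if t i < t j then (V ^ (t j - t i)) (u i) (u j) else 0) = B * A - W := by
    ext i j
    rw [Matrix.sub_apply, Matrix.mul_apply, Matrix.of_apply]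
    congr 1
    exact Finset.sum_congr rfl fun r _ => mul_comm _ _
  have h4 : (1 - Matrix.diagonal h * W).det = 1 :=
    det_one_sub_diagonal_mul_of_time t h fun i j hij => if_neg hij
  rw [h1, h3, Matrix.det_one_add_mul_comm, ← mul_one (Matrix.det _), ← h4, ← Matrix.det_mul]
  congr 1
  have h5 : Matrix.diagonal h * B * A =
      Matrix.diagonal h * B * c - Matrix.diagonal h * B * c * (Matrix.diagonal h * W) := by
    rw [eq_sub_of_add_eq h2.symm, Matrix.mul_sub]
    simp only [Matrix.mul_assoc]
  rw [Matrix.mul_sub, Matrix.mul_sub, ← Matrix.mul_assoc _ B A, h5]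
  noncomm_ring

end Dressed

theorem det_eq_sum_det_one_add {R ι : Type*} [CommRing R] [Fintype ι] [DecidableEq ι]
    (K : Matrix ι ι R) :
    K.det = ∑ S : Finset ι, (∏ i, if i ∈ S then (1 : R) else -1) *
      (1 + Matrix.diagonal (fun i => if i ∈ S then (1 : R) else 0) * K).det := by
  have h1 : K.det = Matrix.detRowAlternating ((fun i j => (1 + K : Matrix ι ι R) i j) +
      fun i j => (-1 : Matrix ι ι R) i j) := by
    show K.det = Matrix.det ((1 + K : Matrix ι ι R) + (-1 : Matrix ι ι R))
    congr 1
    rw [add_comm 1 K, add_neg_cancel_right]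
  rw [h1, ← AlternatingMap.coe_multilinearMap, MultilinearMap.map_add_univ]
  apply Finset.sum_congr rfl
  intro S _
  rw [← Matrix.det_diagonal, ← Matrix.det_mul]
  show Matrix.det _ = _
  congr 1
  ext i j
  rw [Matrix.diagonal_mul, Matrix.add_apply, Matrix.diagonal_mul]
  by_cases hi : i ∈ S
  · simp [Finset.piecewise, hi]
  · simp [Finset.piecewise, hi]

/-- Correlation functions from a determinantal generating function. -/
theorem sum_mul_prod_eq_det {R ι Ω : Type*} [CommRing R] [Fintype ι] [DecidableEq ι] [Fintype Ω]
    (w : Ω → R) (a : ι → Ω → R) (K : Matrix ι ι R)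
    (H : ∀ h : ι → R, ∑ ω, w ω * ∏ i, (1 + h i * a i ω) = (1 + Matrix.diagonal h * K).det) :
    ∑ ω, w ω * ∏ i, a i ω = K.det := by
  rw [det_eq_sum_det_one_add]
  simp only [← H]
  simp only [Finset.mul_sum]
  rw [Finset.sum_comm]
  apply Finset.sum_congr rfl
  intro ω _
  have h1 : ∏ i, a i ω = ∏ i, ((1 + a i ω) + -1) := by simp
  rw [h1, Finset.prod_add, Finset.mul_sum, Finset.powerset_univ]
  apply Finset.sum_congr rfl
  intro S _
  rw [mul_left_comm _ (w ω), ← Finset.prod_mul_distrib, ← Finset.prod_mul_prod_compl S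
    (fun i => (if i ∈ S then (1 : R) else -1) * (1 + (if i ∈ S then (1 : R) else 0) * a i ω))]
  congr 1
  congr 1
  · exact Finset.prod_congr rfl fun i hi => by simp [hi]
  · rw [← Finset.compl_eq_univ_sdiff]
    exact Finset.prod_congr rfl fun i hi => by simp [Finset.mem_compl.1 hi]

theorem sum_path_eq {R W : Type*} [CommRing R] [Fintype W] (n : ℕ) (v g : Fin (n + 1) → W → R)
    (M : Fin n → W → W → R)
    (hv : ∀ k z, v k.succ z = ∑ y, v k.castSucc y * g k.castSucc y * M k y z) :
    ∑ Y : Fin (n + 1) → W, (∏ k, g k (Y k)) *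
        (v 0 (Y 0) * ∏ k : Fin n, M k (Y k.castSucc) (Y k.succ)) =
      ∑ z, v (Fin.last n) z * g (Fin.last n) z := by
  induction n with
  | zero =>
    rw [Fintype.sum_equiv (Equiv.funUnique (Fin 1) W) _ (fun z => v 0 z * g 0 z)]
    · rfl
    · intro Y
      simp [mul_comm (g 0 _)]
  | succ n ih =>
    have h := ih (fun k => v k.succ) (fun k => g k.succ) (fun k => M k.succ)
      (fun k z => by rw [hv]; rfl)
    rw [← Fin.succ_last, ← h]
    rw [← Fintype.sum_equiv (Fin.consEquiv (fun _ : Fin (n + 2) => W)) (fun p =>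
      (∏ k, g k ((Fin.cons p.1 p.2 : Fin (n + 2) → W) k)) * (v 0 p.1 * ∏ k : Fin (n + 1),
        M k ((Fin.cons p.1 p.2 : Fin (n + 2) → W) k.castSucc)
          ((Fin.cons p.1 p.2 : Fin (n + 2) → W) k.succ)))]
    · rw [← Finset.univ_product_univ, Finset.sum_product_right]
      apply Finset.sum_congr rfl
      intro Y _
      rw [show (Fin.succ 0 : Fin (n + 2)) = (0 : Fin (n + 1)).succ from rfl, hv, Finset.sum_mul,
        Finset.mul_sum]
      apply Finset.sum_congr rfl
      intro z _
      simp only [Fin.prod_univ_succ (n := n + 1), Fin.prod_univ_succ (n := n), Fin.cons_succ,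
        Fin.castSucc_zero, Fin.cons_zero, ← Fin.succ_castSucc]
      ring
    · intro p
      rfl

theorem dressed_eq_of_le {R ι κ ν : Type*} [CommRing R] [Fintype ι] [DecidableEq ν] [Fintype ν]
    {u : ι → ν} {t : ι → ℕ} (h : ι → R) (V : Matrix ν ν R) (X₀ : Matrix κ ν R)
    {a b : ℕ} (hab : a < b) (hgap : ∀ i, t i ≤ a ∨ b ≤ t i) :
    dressed u t h V X₀ b =
      dressed u t h V X₀ a * Matrix.diagonal (markWeight u t h a) * V ^ (b - a) := by
  obtain ⟨n, rfl⟩ : ∃ n, b = a + 1 + n := ⟨b - (a + 1), by omega⟩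
  clear hab
  induction n with
  | zero => rw [show a + 1 + 0 - a = 1 by omega, pow_one]; rfl
  | succ n ih =>
    have h1 : markWeight u t h (a + 1 + n) = fun _ => 1 := by
      funext c
      exact Finset.prod_eq_one fun i _ => if_neg fun e => by have := hgap i; omega
    rw [show a + 1 + (n + 1) = (a + 1 + n) + 1 by omega, dressed, h1, Matrix.diagonal_one,
      Matrix.mul_one, ih (fun i => by have := hgap i; omega),
      show a + 1 + n + 1 - a = (a + 1 + n - a) + 1 by omega, pow_succ, Matrix.mul_assoc]

theorem dressed_eq_pow {R ι κ ν : Type*} [CommRing R] [Fintype ι] [DecidableEq ν] [Fintype ν]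
    {u : ι → ν} {t : ι → ℕ} (h : ι → R) (V : Matrix ν ν R) (X₀ : Matrix κ ν R)
    {b : ℕ} (hgap : ∀ i, b ≤ t i) : dressed u t h V X₀ b = X₀ * V ^ b := by
  induction b with
  | zero => simp [dressed]
  | succ b ih =>
    have h1 : markWeight u t h b = fun _ => 1 := by
      funext c
      exact Finset.prod_eq_one fun i _ => if_neg fun e => by have := hgap i; omega
    rw [dressed, h1, Matrix.diagonal_one, Matrix.mul_one, ih (fun i => by have := hgap i; omega),
      pow_succ, Matrix.mul_assoc]

theorem prod_markWeight {R : Type*} [CommRing R] {ι : Type*} [Fintype ι] {m N n : ℕ}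
    (u : ι → Fin N) (h : ι → R) {τ : Fin (n + 1) → ℕ} (hτ : Function.Injective τ)
    (σ : ι → Fin (n + 1)) (Y : Fin (n + 1) → StrictTuple m N) :
    ∏ k, ∏ j, markWeight u (τ ∘ σ) h (τ k) ((Y k).1 j) =
      ∏ i, (1 + h i * if ∃ j, (Y (σ i)).1 j = u i then 1 else 0) := by
  simp only [markWeight]
  have h1 : ∀ k, ∏ j, ∏ i, (if (τ ∘ σ) i = τ k ∧ u i = (Y k).1 j then 1 + h i else 1) =
      ∏ i, ∏ j, (if (τ ∘ σ) i = τ k ∧ u i = (Y k).1 j then 1 + h i else 1) :=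
    fun k => Finset.prod_comm
  simp only [h1]
  rw [Finset.prod_comm]
  apply Finset.prod_congr rfl
  intro i _
  rw [Finset.prod_eq_single (σ i)]
  · split_ifs with hex
    · obtain ⟨j, hj⟩ := hex
      rw [Finset.prod_eq_single j]
      · rw [if_pos ⟨rfl, hj.symm⟩, mul_one]
      · intro j' _ hne
        exact if_neg fun e => hne ((Y (σ i)).2.injective (e.2.symm.trans hj.symm))
      · simp
    · push Not at hex
      rw [Finset.prod_eq_one fun j _ => if_neg fun e => hex j e.2.symm, mul_zero, add_zero]
  · intro k _ hk
    exact Finset.prod_eq_one fun j _ => if_neg fun e => hk (hτ e.1).symm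
  · simp

theorem det_mul_diagonal_submatrix {R : Type*} [CommRing R] {m N : ℕ}
    (A : Matrix (Fin m) (Fin N) R) (d : Fin N → R) (y : Fin m → Fin N) :
    ((A * Matrix.diagonal d).submatrix id y).det = (A.submatrix id y).det * ∏ j, d (y j) := by
  have : (A * Matrix.diagonal d).submatrix id y =
      A.submatrix id y * Matrix.diagonal fun j => d (y j) := by
    ext i j
    rw [Matrix.submatrix_apply, Matrix.mul_diagonal, Matrix.mul_diagonal]
    rfl
  rw [this, Matrix.det_mul, Matrix.det_diagonal]

theorem submatrix_one_mul {R κ ν μ : Type*} [CommRing R] [Fintype ν] [DecidableEq ν]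
    (x : κ → ν) (A : Matrix ν μ R) : (1 : Matrix ν ν R).submatrix x id * A = A.submatrix x id := by
  conv_rhs => rw [← Matrix.one_mul A, Matrix.submatrix_mul _ _ x id id Function.bijective_id]
  rfl

/-- The multi-time generating function of the noncolliding walks. -/
theorem sum_walks_mul_prod {q : ℝ} (hq0 : 0 < q) (hq1 : q < 1) {m N n : ℕ} (hm : 0 < m)
    (x : StrictTuple m N) {ι : Type*} [Fintype ι] (u : ι → Fin N)
    {τ : Fin (n + 1) → ℕ} (hτ : StrictMono τ) (σ : ι → Fin (n + 1)) (h : ι → ℝ) :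
    ∑ Y : Fin (n + 1) → StrictTuple m N,
      (UpsPow q m (τ 0) x.toWm.1 (Y 0).toWm.1 * ∏ k : Fin n,
        UpsPow q m (τ k.succ - τ k.castSucc) (Y k.castSucc).toWm.1 (Y k.succ).toWm.1) *
      ∏ i, (1 + h i * if ∃ j, (Y (σ i)).1 j = u i then 1 else 0) =
    (dressed u (τ ∘ σ) h (walkMat q (m - 1) N) ((1 : Matrix (Fin N) (Fin N) ℝ).submatrix x.1 id)
        (τ (Fin.last n)) *
      Matrix.diagonal (markWeight u (τ ∘ σ) h (τ (Fin.last n))) *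
      dualMat q (fun r => (x.1 r : ℕ)) N (τ (Fin.last n))).det := by
  have hX : Function.Injective (fun r => (x.1 r : ℕ)) :=
    fun r s hrs => x.2.injective (Fin.ext hrs)
  set V := walkMat q (m - 1) N with hV
  set X₀ : Matrix (Fin m) (Fin N) ℝ := (1 : Matrix (Fin N) (Fin N) ℝ).submatrix x.1 id with hX₀
  set c : ℝ := q ^ (m * (m - 1) / 2) with hc
  have hc0 : c ≠ 0 := pow_ne_zero _ hq0.ne'
  set Δ : StrictTuple m N → ℝ := fun y => ((vandMat q m N).submatrix y.1 id).det with hΔ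
  have hΔ0 : ∀ y, Δ y ≠ 0 := det_vandMat_submatrix_ne_zero hq0 hq1
  set F : ℕ → Matrix (Fin m) (Fin N) ℝ := dressed u (τ ∘ σ) h V X₀ with hF
  set D : ℕ → Matrix (Fin N) (Fin N) ℝ := fun s => Matrix.diagonal (markWeight u (τ ∘ σ) h s) with hD
  have hΔx : (Matrix.vandermonde (fun r => q ^ (x.1 r : ℕ))).det = Δ x := rfl
  simp only [← prod_markWeight u h hτ.injective σ]
  have key := sum_path_eq n
    (fun k y => (c ^ τ k)⁻¹ * (Δ y / Δ x) * ((F (τ k)).submatrix id y.1).det)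
    (fun k y => ∏ j, markWeight u (τ ∘ σ) h (τ k) (y.1 j))
    (fun k y z => UpsPow q m (τ k.succ - τ k.castSucc) y.toWm.1 z.toWm.1) ?_
  · have hstart : ∀ y : StrictTuple m N, UpsPow q m (τ 0) x.toWm.1 y.toWm.1 =
        (c ^ τ 0)⁻¹ * (Δ y / Δ x) * ((F (τ 0)).submatrix id y.1).det := by
      intro y
      rw [UpsPow_eq_det hq0 hq1 hm, show F (τ 0) = X₀ * V ^ τ 0 from
        dressed_eq_pow h V X₀ fun i => hτ.monotone (Fin.zero_le _)]
      have e : (X₀ * V ^ τ 0).submatrix id y.1 = (V ^ τ 0).submatrix x.1 y.1 := by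
        rw [hX₀, submatrix_one_mul]; rfl
      rw [e]
    have hl := det_mul_vandMat hq0 hq1 hX N (τ (Fin.last n)) (F (τ (Fin.last n)) * D (τ (Fin.last n)))
    rw [hΔx, ← hc, ← sum_det_mul_det] at hl
    have hx := hΔ0 x
    have hl' : (F (τ (Fin.last n)) * D (τ (Fin.last n)) *
        dualMat q (fun r => (x.1 r : ℕ)) N (τ (Fin.last n))).det =
        (c ^ τ (Fin.last n))⁻¹ / Δ x * ∑ y : StrictTuple m N,
          ((F (τ (Fin.last n)) * D (τ (Fin.last n))).submatrix id y.1).det *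
          ((vandMat q m N).submatrix y.1 id).det := by
      rw [hl]
      field_simp
    rw [hl', Finset.mul_sum]
    refine Eq.trans ?_ (key.trans ?_)
    · apply Finset.sum_congr rfl
      intro Y _
      rw [hstart]
      exact mul_comm _ _
    · apply Finset.sum_congr rfl
      intro z _
      rw [det_mul_diagonal_submatrix]
      change _ = _ * (_ * Δ z)
      ring
  · intro k z
    have hlt : τ k.castSucc < τ k.succ := hτ k.castSucc_lt_succ
    have hgap : ∀ i, (τ ∘ σ) i ≤ τ k.castSucc ∨ τ k.succ ≤ (τ ∘ σ) i := by
      intro i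
      rcases le_or_gt (σ i) k.castSucc with hi | hi
      · exact Or.inl (hτ.monotone hi)
      · exact Or.inr (hτ.monotone (Fin.castSucc_lt_iff_succ_le.1 hi))
    have e1 : F (τ k.succ) = F (τ k.castSucc) * D (τ k.castSucc) * V ^ (τ k.succ - τ k.castSucc) :=
      dressed_eq_of_le h V X₀ hlt hgap
    have e2 : (F (τ k.succ)).submatrix id z.1 = F (τ k.castSucc) * D (τ k.castSucc) *
        (V ^ (τ k.succ - τ k.castSucc)).submatrix id z.1 := by
      rw [e1]; rfl
    have e3 : c ^ τ k.succ = c ^ τ k.castSucc * c ^ (τ k.succ - τ k.castSucc) := by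
      rw [← pow_add]; congr 1; omega
    rw [e2, ← sum_det_mul_det, Finset.mul_sum, e3]
    apply Finset.sum_congr rfl
    intro y _
    rw [UpsPow_eq_det hq0 hq1 hm, det_mul_diagonal_submatrix]
    have hy := hΔ0 y
    have hx := hΔ0 x
    change _ = (c ^ τ k.castSucc)⁻¹ * (Δ y / Δ x) * _ * _ *
      ((c ^ (τ k.succ - τ k.castSucc))⁻¹ * (Δ z / Δ y) *
        ((V ^ (τ k.succ - τ k.castSucc)).submatrix y.1 z.1).det)
    simp only [Matrix.submatrix_submatrix, Function.comp_id, Function.id_comp]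
    field_simp

theorem sum_walks_mul_indicator {q : ℝ} (hq0 : 0 < q) (hq1 : q < 1) {m N n : ℕ} (hm : 0 < m)
    (x : StrictTuple m N) {ι : Type*} [Fintype ι] [DecidableEq ι] (u : ι → Fin N)
    {τ : Fin (n + 1) → ℕ} (hτ : StrictMono τ) (σ : ι → Fin (n + 1))
    (hut : Function.Injective fun i => (u i, (τ ∘ σ) i)) :
    ∑ Y : Fin (n + 1) → StrictTuple m N,
      (UpsPow q m (τ 0) x.toWm.1 (Y 0).toWm.1 * ∏ k : Fin n,
        UpsPow q m (τ k.succ - τ k.castSucc) (Y k.castSucc).toWm.1 (Y k.succ).toWm.1) *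
      ∏ i, (if ∃ j, (Y (σ i)).1 j = u i then (1 : ℝ) else 0) =
    (Matrix.of fun i j : ι => algKer q (fun r => (x.1 r : ℕ)) (u i) (τ (σ i)) (τ (σ j)) (u j)).det := by
  have hX : Function.Injective (fun r => (x.1 r : ℕ)) :=
    fun r s hrs => x.2.injective (Fin.ext hrs)
  apply sum_mul_prod_eq_det _ (fun i (Y : Fin (n + 1) → StrictTuple m N) =>
    if ∃ j, (Y (σ i)).1 j = u i then (1 : ℝ) else 0)
  intro h
  rw [sum_walks_mul_prod hq0 hq1 hm x u hτ σ h, det_dressed h _ _ hut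
    (Ψ := fun s => dualMat q (fun r => (x.1 r : ℕ)) N s)]
  · congr 3
    ext i j
    simp only [Matrix.of_apply, submatrix_one_mul, Matrix.submatrix_apply, walkMat_pow_apply, id,
      dualMat, algKer, Function.comp]
  · rw [submatrix_one_mul]
    ext r r'
    rw [Matrix.submatrix_apply, dualMat, Matrix.of_apply, id,
      dualFun_zero_apply hq0 hq1 hX, Matrix.one_apply]
  · exact walkMat_mul_dualMat hq0 hq1 hX N
  · exact fun i => hτ.monotone (Fin.le_last _)

theorem tsum_wm_path_eq_sum {m N n : ℕ} (f : (Fin (n + 1) → {z : Fin m → ℤ // Wm m z}) → ℝ)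
    (hf : ∀ Y, f Y ≠ 0 → ∀ k i, (Y k).1 i < N) :
    ∑' Y, f Y = ∑ Y : Fin (n + 1) → StrictTuple m N, f fun k => (Y k).toWm := by
  have hinj : Function.Injective
      fun (Y : Fin (n + 1) → StrictTuple m N) k => (Y k).toWm :=
    fun Y Z h => funext fun k => StrictTuple.toWm_injective (congrFun h k)
  rw [← hinj.tsum_eq (f := f), tsum_fintype]
  intro Y hY
  choose Z hZ using fun k => StrictTuple.exists_toWm_eq (Y k) (hf Y hY k)
  exact ⟨Z, funext hZ⟩

theorem det_mul_div_transpose {R ι : Type*} [Field R] [Fintype ι] [DecidableEq ι] (g : ι → R)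
    (hg : ∀ i, g i ≠ 0) (A : Matrix ι ι R) :
    (Matrix.of fun i j => g j / g i * A j i).det = A.det := by
  have h : (Matrix.of fun i j => g j / g i * A j i) =
      Matrix.diagonal (fun i => (g i)⁻¹) * A.transpose * Matrix.diagonal g := by
    ext i j
    rw [Matrix.mul_diagonal, Matrix.diagonal_mul, Matrix.of_apply, Matrix.transpose_apply]
    ring
  rw [h, Matrix.det_mul, Matrix.det_mul, Matrix.det_transpose, Matrix.det_diagonal,
    Matrix.det_diagonal, Finset.prod_inv_distrib]
  have := Finset.prod_ne_zero_iff.2 fun i (_ : i ∈ Finset.univ) => hg i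
  field_simp

theorem UpsPow_path_support {q : ℝ} {m n : ℕ} {x : Fin m → ℤ} {s : ℕ} {r : Fin n → ℕ}
    {Y : Fin (n + 1) → Fin m → ℤ}
    (h : UpsPow q m s x (Y 0) * ∏ k : Fin n, UpsPow q m (r k) (Y k.castSucc) (Y k.succ) ≠ 0)
    (k : Fin (n + 1)) (i : Fin m) : Y k i ≤ x i := by
  obtain ⟨h1, h2⟩ := mul_ne_zero_iff.1 h
  rw [Finset.prod_ne_zero_iff] at h2
  induction k using Fin.induction with
  | zero => exact UpsPow_support h1 i
  | succ k ih => exact (UpsPow_support (h2 k (Finset.mem_univ k)) i).trans ih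

/-- The trajectory of the noncolliding `q`-exchangeable random walks started at `x` is a
determinantal point process with kernel `K_walks`: for pairwise distinct points
`(uᵢ, tᵢ)` with `t(1) < … < t(s)` the distinct time values (encoded via a strictly
monotone `τ : Fin (s′+1) → ℕ` and a surjection `σ` with `tᵢ = τ(σ i)`), the probability
that the configuration contains all `(uᵢ, tᵢ)` equals `det[K_walks(uᵢ,tᵢ;uⱼ,tⱼ)]`. -/
theorem stmt_10 (q : ℝ) (hq0 : 0 < q) (hq1 : q < 1) (m : ℕ) (hm : 1 ≤ m)
    (x : Fin m → ℤ) (hx : Wm m x)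
    (ℓ : ℕ) (hℓ : 1 ≤ ℓ) (u : Fin ℓ → ℤ) (t : Fin ℓ → ℕ)
    (hu : ∀ i, 0 ≤ u i) (ht : ∀ i, 1 ≤ t i)
    (hdist : Function.Injective fun i => (u i, t i))
    (s' : ℕ) (τ : Fin (s' + 1) → ℕ) (hτ : StrictMono τ)
    (σ : Fin ℓ → Fin (s' + 1)) (hσ : Function.Surjective σ)
    (htτ : ∀ i, t i = τ (σ i)) :
    ((∑' Y : Fin (s' + 1) → {z : Fin m → ℤ // Wm m z},
        (if ∀ i : Fin ℓ, ∃ j : Fin m, (Y (σ i)).1 j = u i then (1 : ℝ) else 0) *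
          (UpsPow q m (τ 0) x (Y 0).1 *
            ∏ k : Fin s',
              UpsPow q m (τ k.succ - τ k.castSucc) (Y k.castSucc).1 (Y k.succ).1) : ℝ) : ℂ)
      = Matrix.det (Matrix.of fun i j : Fin ℓ =>
          Kwalks q m x (u i) (t i) (u j) (t j)) := by
  obtain ⟨N, hN⟩ : ∃ N : ℕ, (∀ r, x r < N) ∧ ∀ i, u i < N := by
    refine ⟨(∑ r, x r).toNat + (∑ i, u i).toNat + 1, fun r => ?_, fun i => ?_⟩
    · have := Finset.single_le_sum (fun r _ => hx.2 r) (Finset.mem_univ r)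
      push_cast
      omega
    · have := Finset.single_le_sum (fun i _ => hu i) (Finset.mem_univ i)
      push_cast
      omega
  obtain ⟨X, hX⟩ := StrictTuple.exists_toWm_eq ⟨x, hx⟩ hN.1
  have hXx : x = X.toWm.1 := by rw [hX]
  subst hXx
  obtain ⟨U, hU⟩ : ∃ U : Fin ℓ → Fin N, ∀ i, ((U i : ℕ) : ℤ) = u i :=
    ⟨fun i => ⟨(u i).toNat, by have := hN.2 i; have := hu i; omega⟩,
      fun i => Int.toNat_of_nonneg (hu i)⟩
  have hut : Function.Injective fun i => (U i, (τ ∘ σ) i) := by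
    intro i j hij
    obtain ⟨h1, h2⟩ := Prod.ext_iff.1 hij
    apply hdist
    refine Prod.ext ?_ ?_
    · show u i = u j
      rw [← hU, ← hU, show U i = U j from h1]
    · show t i = t j
      rw [htτ, htτ]
      exact h2
  rw [tsum_wm_path_eq_sum (N := N)]
  · have hX' : StrictAnti fun r => (X.1 r : ℕ) := fun r s hrs => X.2 hrs
    have hL := sum_walks_mul_indicator hq0 hq1 hm X U hτ σ hut
    have hK : (Matrix.of fun i j : Fin ℓ => Kwalks q m X.toWm.1 (u i) (t i) (u j) (t j)) =
        Matrix.of fun i j => ((gaugeFun q (m - 1) (t j) (U j) : ℝ) : ℂ) /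
          ((gaugeFun q (m - 1) (t i) (U i) : ℝ) : ℂ) *
          ((Matrix.of fun i j : Fin ℓ => algKer q (fun r => (X.1 r : ℕ)) (U i) (τ (σ i))
            (τ (σ j)) (U j)).map Complex.ofRealHom) j i := by
      ext i j
      obtain ⟨s, hs⟩ : ∃ s, t j = s + 1 := ⟨t j - 1, by have := ht j; omega⟩
      have h := Kwalks_eq_algKer hq0 hq1 hm hX' (U i) (t i) (U j) s
      rw [hU, hU, ← hs] at h
      rw [Matrix.of_apply, Matrix.of_apply, Matrix.map_apply, Matrix.of_apply, ← htτ, ← htτ]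
      refine h.trans ?_
      push_cast
      rfl
    rw [hK, det_mul_div_transpose _ fun i => Complex.ofReal_ne_zero.2 (gaugeFun_ne_zero hq0 hq1 _ _ _),
      ← RingHom.mapMatrix_apply, ← RingHom.map_det, ← hL]
    show Complex.ofRealHom _ = _
    congr 1
    apply Finset.sum_congr rfl
    intro Y _
    rw [mul_comm]
    congr 1
    rw [Finset.prod_ite_zero]
    simp only [Finset.prod_const_one]
    congr 1
    apply propext
    simp only [Finset.mem_univ, true_imp_iff]
    refine forall_congr' fun i => exists_congr fun j => ?_
    rw [← hU]
    show ((((Y (σ i)).1 j : Fin N) : ℕ) : ℤ) = ((U i : ℕ) : ℤ) ↔ _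
    rw [Nat.cast_inj, Fin.ext_iff]
  · intro Y hY k i
    exact (UpsPow_path_support (Y := fun k => (Y k).1) (mul_ne_zero_iff.1 hY).2 k i).trans_lt (hN.1 i)
end

section
/- Fix γ > 0, L ≥ 1, reals 0 < C_1 < … < C_L and 0 = a_1 < … < a_{L+1} = 1, and τ, ρ > 0. Then the polynomial equation w e^{γ(τ+1)} (w e^{γρ} − 1) ∏_{i=1}^{L} (w e^{γ(a_i+C_i)} − 1) = (w − 1)(w e^{γ(ρ+τ)} − 1) ∏_{i=1}^{L} (w e^{γ(a_{i+1}+C_i)} − 1) has at most one solution w ∈ ℂ with Im w > 0. -/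
open Polynomial in
/-- Partial fraction expansion of a quotient of two monic polynomials of the same degree, the
denominator having simple roots. -/
theorem prod_sub_div_prod_sub_eq {ι F : Type*} [Fintype ι] [DecidableEq ι] [Field F]
    (p z : ι → F) (hp : Function.Injective p) (x : F) (hx : ∀ i, x ≠ p i) :
    (∏ i, (x - z i)) / ∏ i, (x - p i) =
      1 + ∑ k, Lagrange.nodalWeight Finset.univ p k * (∏ j, (p k - z j)) / (x - p k) := by
  have hdeg : (Lagrange.nodal Finset.univ z - Lagrange.nodal Finset.univ p).degree <
      (Finset.univ : Finset ι).card := by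
    have h := degree_sub_lt_left (p := Lagrange.nodal Finset.univ z) (q := Lagrange.nodal Finset.univ p)
      (by simp only [Lagrange.degree_nodal]) Lagrange.nodal_ne_zero
      (by rw [Lagrange.nodal_monic.leadingCoeff, Lagrange.nodal_monic.leadingCoeff])
    rwa [Lagrange.degree_nodal] at h
  have hint := Lagrange.eq_interpolate (s := Finset.univ) hp.injOn hdeg
  have heval := congrArg (eval x) hint
  rw [Lagrange.eval_interpolate_not_at_node _ fun i _ => hx i] at heval
  simp only [eval_sub, Lagrange.eval_nodal] at heval
  have hne : ∏ i, (x - p i) ≠ 0 := Finset.prod_ne_zero_iff.2 fun i _ => sub_ne_zero.2 (hx i)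
  have hzero (k : ι) : ∏ j, (p k - p j) = 0 :=
    Finset.prod_eq_zero (Finset.mem_univ k) (sub_self _)
  simp only [hzero, sub_zero] at heval
  rw [div_eq_iff hne, add_mul, one_mul, ← sub_eq_iff_eq_add', heval, mul_comm]
  congr 1
  refine Finset.sum_congr rfl fun k _ => ?_
  rw [div_eq_mul_inv]
  ring

/-- The residues of `∏ (x - z i) / ∏ (x - p i)` are positive when the roots interlace. -/
theorem nodalWeight_mul_prod_sub_pos {ι : Type*} [Fintype ι] [LinearOrder ι] (p z : ι → ℝ)
    (hzp : ∀ k, z k < p k) (hpz : ∀ j k, j < k → p k < z j) (k : ι) :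
    0 < Lagrange.nodalWeight Finset.univ p k * ∏ j, (p k - z j) := by
  rw [Lagrange.nodalWeight, ← Finset.mul_prod_erase _ _ (Finset.mem_univ k), mul_left_comm,
    ← Finset.prod_mul_distrib]
  refine mul_pos (sub_pos.2 (hzp k)) (Finset.prod_pos fun j hj => ?_)
  rcases lt_or_gt_of_ne (Finset.ne_of_mem_erase hj) with h | h
  · have h₁ := hpz j k h
    have h₂ := hzp j
    exact mul_pos_of_neg_of_neg (inv_lt_zero.2 (by linarith)) (by linarith)
  · have h₁ := hpz k j h
    have h₂ := hzp j
    have h₃ := hzp k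
    exact mul_pos (inv_pos.2 (by linarith)) (by linarith)

/-- A difference quotient form of the equation `∑ A k / (w - p k) = B / (w - r)`. -/
theorem sum_inv_sub_mul_inv_sub_eq {ι F : Type*} [Fintype ι] [Field F] (A p : ι → F)
    (B r w w' : F) (hw : ∀ k, w - p k ≠ 0) (hw' : ∀ k, w' - p k ≠ 0)
    (hr : w - r ≠ 0) (hr' : w' - r ≠ 0) (hne : w ≠ w')
    (h : ∑ k, A k / (w - p k) = B / (w - r)) (h' : ∑ k, A k / (w' - p k) = B / (w' - r)) :
    ∑ k, A k * ((w - p k)⁻¹ * (w' - p k)⁻¹) = B * ((w - r)⁻¹ * (w' - r)⁻¹) := by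
  have key (c q : F) (h₁ : w - q ≠ 0) (h₂ : w' - q ≠ 0) :
      (w' - w) * (c * ((w - q)⁻¹ * (w' - q)⁻¹)) = c / (w - q) - c / (w' - q) := by
    field_simp
    ring
  refine mul_left_cancel₀ (sub_ne_zero.2 hne.symm) ?_
  rw [Finset.mul_sum, key B r hr hr', ← h, ← h', ← Finset.sum_sub_distrib]
  exact Finset.sum_congr rfl fun k _ => key (A k) (p k) (hw k) (hw' k)

/-- An equation `∑ A k / (w - p k) = B / (w - r)` with positive weights and at least two distinct
real poles `p k` has at most one solution in the upper half-plane. -/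
theorem eq_of_sum_div_sub_eq {ι : Type*} [Fintype ι] [Nontrivial ι] (A p : ι → ℝ) (B r : ℝ)
    (hA : ∀ k, 0 < A k) (hp : Function.Injective p) {w₁ w₂ : ℂ} (h₁ : 0 < w₁.im)
    (h₂ : 0 < w₂.im) (e₁ : ∑ k, (A k : ℂ) / (w₁ - p k) = B / (w₁ - r))
    (e₂ : ∑ k, (A k : ℂ) / (w₂ - p k) = B / (w₂ - r)) : w₁ = w₂ := by
  by_contra hne
  have hsub (w : ℂ) (hw : w.im ≠ 0) (x : ℝ) : w - x ≠ 0 := fun h => hw (by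
    simpa using congrArg Complex.im h)
  have hconj (w : ℂ) (e : ∑ k, (A k : ℂ) / (w - p k) = B / (w - r)) :
      ∑ k, (A k : ℂ) / (starRingEnd ℂ w - p k) = B / (starRingEnd ℂ w - r) := by
    simpa using congrArg (starRingEnd ℂ) e
  have hmix (w w' : ℂ) (hw : 0 < w.im) (hw' : 0 < w'.im)
      (e : ∑ k, (A k : ℂ) / (w - p k) = B / (w - r))
      (e' : ∑ k, (A k : ℂ) / (w' - p k) = B / (w' - r)) :
      ∑ k, (A k : ℂ) * ((w - p k)⁻¹ * (starRingEnd ℂ w' - p k)⁻¹) =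
        B * ((w - r)⁻¹ * (starRingEnd ℂ w' - r)⁻¹) := by
    have him : (starRingEnd ℂ w').im ≠ 0 := by simpa using hw'.ne'
    refine sum_inv_sub_mul_inv_sub_eq _ _ _ _ _ _ (fun k => hsub w hw.ne' _)
      (fun k => hsub _ him _) (hsub w hw.ne' _) (hsub _ him _) ?_ e (hconj w' e')
    intro h
    have := congrArg Complex.im h
    rw [Complex.conj_im] at this
    linarith
  let d (k : ι) : ℂ := (w₂ - r)⁻¹ * (w₁ - p k)⁻¹ - (w₁ - r)⁻¹ * (w₂ - p k)⁻¹
  have hsum : ∑ k, A k * Complex.normSq (d k) = 0 := by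
    have hd (k : ι) : (A k : ℂ) * (Complex.normSq (d k) : ℂ) =
        (w₂ - r)⁻¹ * (starRingEnd ℂ w₂ - r)⁻¹ *
            (A k * ((w₁ - p k)⁻¹ * (starRingEnd ℂ w₁ - p k)⁻¹))
          - (w₂ - r)⁻¹ * (starRingEnd ℂ w₁ - r)⁻¹ *
            (A k * ((w₁ - p k)⁻¹ * (starRingEnd ℂ w₂ - p k)⁻¹))
          - (w₁ - r)⁻¹ * (starRingEnd ℂ w₂ - r)⁻¹ *
            (A k * ((w₂ - p k)⁻¹ * (starRingEnd ℂ w₁ - p k)⁻¹))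
          + (w₁ - r)⁻¹ * (starRingEnd ℂ w₁ - r)⁻¹ *
            (A k * ((w₂ - p k)⁻¹ * (starRingEnd ℂ w₂ - p k)⁻¹)) := by
      rw [← Complex.mul_conj]
      simp only [d, map_sub, map_mul, map_inv₀, Complex.conj_ofReal]
      ring
    have : ((∑ k, A k * Complex.normSq (d k) : ℝ) : ℂ) = 0 := by
      push_cast
      simp only [hd, Finset.sum_add_distrib, Finset.sum_sub_distrib, ← Finset.mul_sum]
      rw [hmix w₁ w₁ h₁ h₁ e₁ e₁, hmix w₁ w₂ h₁ h₂ e₁ e₂, hmix w₂ w₁ h₂ h₁ e₂ e₁,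
        hmix w₂ w₂ h₂ h₂ e₂ e₂]
      ring
    exact_mod_cast this
  have hpr (k : ι) : p k = r := by
    have hk := (Finset.sum_eq_zero_iff_of_nonneg fun k _ =>
      mul_nonneg (hA k).le (Complex.normSq_nonneg (d k))).1 hsum k (Finset.mem_univ k)
    have hdk : d k = 0 := by simpa [(hA k).ne'] using hk
    have n₁ := hsub w₁ h₁.ne' (p k)
    have n₂ := hsub w₂ h₂.ne' (p k)
    have n₃ := hsub w₁ h₁.ne' r
    have n₄ := hsub w₂ h₂.ne' r
    simp only [d] at hdk
    field_simp at hdk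
    have hmul : (w₁ - w₂) * ((p k : ℂ) - r) = 0 := by linear_combination -hdk
    have := (mul_eq_zero.1 hmul).resolve_left (sub_ne_zero.2 hne)
    exact_mod_cast sub_eq_zero.1 this
  obtain ⟨i, j, hij⟩ := exists_pair_ne ι
  exact hij (hp ((hpr i).trans (hpr j).symm))

/-- For interlacing real `z` and `p`, the equation
`∏ (w - z i) / ∏ (w - p i) = (w - s) / (w - r)` has at most one solution in the upper
half-plane. -/
theorem eq_of_prod_sub_mul_eq {ι : Type*} [Fintype ι] [LinearOrder ι] [Nontrivial ι]
    (p z : ι → ℝ) (r s : ℝ) (hzp : ∀ k, z k < p k) (hpz : ∀ j k, j < k → p k < z j)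
    {w₁ w₂ : ℂ} (h₁ : 0 < w₁.im) (h₂ : 0 < w₂.im)
    (e₁ : (w₁ - r) * ∏ i, (w₁ - z i) = (w₁ - s) * ∏ i, (w₁ - p i))
    (e₂ : (w₂ - r) * ∏ i, (w₂ - z i) = (w₂ - s) * ∏ i, (w₂ - p i)) : w₁ = w₂ := by
  have hp : StrictAnti p := fun j k h => (hpz j k h).trans (hzp j)
  have key (w : ℂ) (h : 0 < w.im)
      (e : (w - r) * ∏ i, (w - z i) = (w - s) * ∏ i, (w - p i)) :
      ∑ k, ((Lagrange.nodalWeight Finset.univ p k * ∏ j, (p k - z j) : ℝ) : ℂ) / (w - p k) =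
        (r - s : ℝ) / (w - r) := by
    have hsub (x : ℝ) : w - x ≠ 0 := fun h' => h.ne' (by
      simpa using congrArg Complex.im h')
    have hpf := prod_sub_div_prod_sub_eq (fun k => (p k : ℂ)) (fun k => (z k : ℂ))
      (Complex.ofReal_injective.comp hp.injective) w fun i => sub_ne_zero.1 (hsub _)
    have hquot : (∏ i, (w - z i)) / ∏ i, (w - p i) = (w - s) / (w - r) := by
      rw [div_eq_div_iff (Finset.prod_ne_zero_iff.2 fun i _ => hsub _) (hsub r)]
      linear_combination e
    rw [hquot, ← sub_eq_iff_eq_add'] at hpf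
    calc _ = (w - s) / (w - r) - 1 := by
          rw [hpf]
          simp [Lagrange.nodalWeight]
      _ = _ := by
          have := hsub r
          push_cast
          field_simp
          ring
  exact eq_of_sum_div_sub_eq _ p _ r (nodalWeight_mul_prod_sub_pos p z hzp hpz) hp.injective
    h₁ h₂ (key w₁ h₁ e₁) (key w₂ h₂ e₂)


/-- The critical point equation of the action `S(w;τ,ρ)`, in polynomial form, has at
most one solution in the open upper half-plane. -/
theorem stmt_13 (γ : ℝ) (hγ : 0 < γ) (L : ℕ) (hL : 1 ≤ L)
    (a : Fin (L + 1) → ℝ) (C : Fin L → ℝ)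
    (ha0 : a 0 = 0) (haL : a (Fin.last L) = 1) (haMono : StrictMono a)
    (hC0 : 0 < C ⟨0, hL⟩) (hCmono : StrictMono C)
    (τ ρ : ℝ) (hτ : 0 < τ) (hρ : 0 < ρ) :
    Set.Subsingleton {w : ℂ | 0 < w.im ∧
      w * (Real.exp (γ * (τ + 1)) : ℝ) * (w * (Real.exp (γ * ρ) : ℝ) - 1) *
          ∏ i : Fin L, (w * (Real.exp (γ * (a i.castSucc + C i)) : ℝ) - 1)
        = (w - 1) * (w * (Real.exp (γ * (ρ + τ)) : ℝ) - 1) *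
            ∏ i : Fin L, (w * (Real.exp (γ * (a i.succ + C i)) : ℝ) - 1)} := by
  let r : ℝ := Real.exp (-(γ * ρ))
  let s : ℝ := Real.exp (-(γ * (ρ + τ)))
  let p : Fin (L + 1) → ℝ := Fin.cons 1 fun i => Real.exp (-(γ * (a i.succ + C i)))
  let z : Fin (L + 1) → ℝ := Fin.snoc (fun i => Real.exp (-(γ * (a i.castSucc + C i)))) 0
  have hp0 : p 0 = 1 := rfl
  have hps (i : Fin L) : p i.succ = Real.exp (-(γ * (a i.succ + C i))) := rfl
  have hzl : z (Fin.last L) = 0 := Fin.snoc_last _ _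
  have hzc (i : Fin L) : z i.castSucc = Real.exp (-(γ * (a i.castSucc + C i))) :=
    Fin.snoc_castSucc _ _ _
  have hexp {x y : ℝ} (h : x < y) : Real.exp (-(γ * y)) < Real.exp (-(γ * x)) :=
    Real.exp_lt_exp.2 (neg_lt_neg (mul_lt_mul_of_pos_left h hγ))
  have hzp (k : Fin (L + 1)) : z k < p k := by
    induction k using Fin.lastCases with
    | last =>
      rw [hzl]
      refine Fin.cases (by simp [hp0]) (fun i => ?_) (Fin.last L)
      rw [hps]
      exact Real.exp_pos _
    | cast i =>
      rw [hzc]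
      obtain ⟨m, rfl⟩ := Nat.exists_eq_add_of_le' hL
      induction i using Fin.cases with
      | zero =>
        rw [Fin.castSucc_zero, hp0, ha0, zero_add]
        exact Real.exp_lt_one_iff.2 (neg_lt_zero.2 (mul_pos hγ hC0))
      | succ j =>
        rw [← Fin.succ_castSucc, hps]
        exact hexp (add_lt_add_right (hCmono Fin.castSucc_lt_succ) _)
  have hpz (j k : Fin (L + 1)) (h : j < k) : p k < z j := by
    induction k using Fin.cases with
    | zero => exact absurd h (Fin.not_lt_zero j)
    | succ i =>
      induction j using Fin.lastCases with
      | last => exact absurd h (Fin.le_last _).not_gt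
      | cast j =>
        rw [hps, hzc]
        exact hexp (add_lt_add_of_lt_of_le (haMono h)
          (hCmono.monotone (Fin.castSucc_lt_succ_iff.1 h)))
  have : Nontrivial (Fin (L + 1)) := Fin.nontrivial_iff_two_le.2 (by omega)
  have hfac (w : ℂ) (x : ℝ) :
      w * (Real.exp x : ℝ) - 1 = (Real.exp x : ℝ) * (w - (Real.exp (-x) : ℝ)) := by
    have : ((Real.exp x : ℝ) : ℂ) * (Real.exp (-x) : ℝ) = 1 := by
      rw [← Complex.ofReal_mul, ← Real.exp_add]
      simp
    linear_combination this
  have hconst : Real.exp (γ * (τ + 1)) * Real.exp (γ * ρ) *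
        ∏ i : Fin L, Real.exp (γ * (a i.castSucc + C i)) =
      Real.exp (γ * (ρ + τ)) * ∏ i : Fin L, Real.exp (γ * (a i.succ + C i)) := by
    have htel : ∑ i : Fin L, (a i.succ - a i.castSucc) = 1 := by
      have h := Fin.sum_univ_succ a
      rw [Fin.sum_univ_castSucc, ha0, haL] at h
      rw [Finset.sum_sub_distrib]
      linarith
    rw [Finset.sum_sub_distrib] at htel
    rw [← Real.exp_sum, ← Real.exp_sum, ← Real.exp_add, ← Real.exp_add, ← Real.exp_add]
    simp only [← Finset.mul_sum, Finset.sum_add_distrib]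
    congr 1
    linear_combination -γ * htel
  have key (w : ℂ)
      (e : w * (Real.exp (γ * (τ + 1)) : ℝ) * (w * (Real.exp (γ * ρ) : ℝ) - 1) *
          ∏ i : Fin L, (w * (Real.exp (γ * (a i.castSucc + C i)) : ℝ) - 1)
        = (w - 1) * (w * (Real.exp (γ * (ρ + τ)) : ℝ) - 1) *
            ∏ i : Fin L, (w * (Real.exp (γ * (a i.succ + C i)) : ℝ) - 1)) :
      (w - r) * ∏ i, (w - z i) = (w - s) * ∏ i, (w - p i) := by
    have hc := congrArg (fun x : ℝ => (x : ℂ)) hconst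
    simp only [Complex.ofReal_mul, Complex.ofReal_prod] at hc
    simp only [hfac, Finset.prod_mul_distrib] at e
    rw [Fin.prod_univ_castSucc, Fin.prod_univ_succ (fun i => w - (p i : ℂ))]
    simp only [hp0, hps, hzl, hzc, Complex.ofReal_zero, Complex.ofReal_one, sub_zero]
    have hne : ((Real.exp (γ * (ρ + τ)) : ℝ) : ℂ) *
        ∏ i : Fin L, ((Real.exp (γ * (a i.succ + C i)) : ℝ) : ℂ) ≠ 0 :=
      mul_ne_zero (Complex.ofReal_ne_zero.2 (Real.exp_ne_zero _))
        (Finset.prod_ne_zero_iff.2 fun i _ => Complex.ofReal_ne_zero.2 (Real.exp_ne_zero _))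
    refine mul_left_cancel₀ hne ?_
    simp only [r, s]
    linear_combination e - ((w - (Real.exp (-(γ * ρ)) : ℝ)) *
      ((∏ i : Fin L, (w - (Real.exp (-(γ * (a i.castSucc + C i))) : ℝ))) * w)) * hc
  rintro w₁ ⟨h₁, e₁⟩ w₂ ⟨h₂, e₂⟩
  exact eq_of_prod_sub_mul_eq p z r s hzp hpz h₁ h₂ (key w₁ e₁) (key w₂ e₂)
end

section
/- Fix a real number v ≠ 1. Then lim_{ε→0+} ( − ∫_0^∞ Arg(1 − (v + iε) e^{−u}) du ) = π · (log v) · 1_{v > 1}; that is, the imaginary part of the (integral representation of the) dilogarithm Li₂(v + iε) = −∫_0^∞ log(1 − (v+iε)e^{−u}) du converges, as ε → 0+, to π log v if v > 1 and to 0 if v < 1. -/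
theorem Complex.abs_arg_one_add_le (z : ℂ) : |Complex.arg (1 + z)| ≤ 2 * Real.pi * ‖z‖ := by
  rcases le_or_gt ‖z‖ (1 / 2) with h | h
  · have h1 := Complex.norm_log_one_add_half_le_self h
    have h2 := Complex.abs_im_le_norm (Complex.log (1 + z))
    rw [Complex.log_im] at h2
    nlinarith [Real.pi_gt_three, norm_nonneg z]
  · have h1 := Complex.abs_arg_le_pi (1 + z)
    nlinarith [Real.pi_pos]

/-- The pointwise limit, as `ε → 0+`, of the argument of `1 - (v + iε) t` for `t > 0`. -/
theorem Complex.tendsto_arg_one_sub_mul (v t : ℝ) (ht : 0 < t) (h : v * t ≠ 1) :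
    Filter.Tendsto (fun ε : ℝ => Complex.arg (1 - ((v : ℂ) + (ε : ℂ) * Complex.I) * (t : ℂ)))
      (nhdsWithin 0 (Set.Ioi 0)) (nhds (if 1 < v * t then -Real.pi else 0)) := by
  have hre : (1 - (v : ℂ) * (t : ℂ)).re = 1 - v * t := by simp
  have him : (1 - (v : ℂ) * (t : ℂ)).im = 0 := by simp
  have hc : Filter.Tendsto (fun ε : ℝ => 1 - ((v : ℂ) + (ε : ℂ) * Complex.I) * (t : ℂ))
      (nhdsWithin 0 (Set.Ioi 0)) (nhds (1 - (v : ℂ) * (t : ℂ))) := by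
    have h1 : Continuous (fun ε : ℝ => 1 - ((v : ℂ) + (ε : ℂ) * Complex.I) * (t : ℂ)) := by
      fun_prop
    simpa using (h1.tendsto 0).mono_left nhdsWithin_le_nhds
  split_ifs with hlt
  · refine (Complex.tendsto_arg_nhdsWithin_im_neg_of_re_neg_of_im_zero
      (by rw [hre]; linarith) him).comp (tendsto_nhdsWithin_iff.2 ⟨hc, ?_⟩)
    filter_upwards [self_mem_nhdsWithin] with ε hε
    have : 0 < ε * t := mul_pos hε ht
    simpa using this
  · have hpos : 0 < 1 - v * t := sub_pos.2 (lt_of_le_of_ne (not_lt.1 hlt) h)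
    have h0 : Complex.arg (1 - (v : ℂ) * (t : ℂ)) = 0 := by
      have := Complex.arg_ofReal_of_nonneg hpos.le
      push_cast at this
      exact this
    have harg := (Complex.continuousAt_arg (Or.inl (by rwa [hre]))).tendsto.comp hc
    rwa [h0] at harg

theorem integral_Ioi_ite_one_lt_mul_exp_neg (v c : ℝ) :
    ∫ u in Set.Ioi (0 : ℝ), (if 1 < v * Real.exp (-u) then c else 0) =
      if 1 < v then c * Real.log v else 0 := by
  split_ifs with hv
  · have hlog := Real.log_pos hv
    have heq : ∀ u : ℝ, (if 1 < v * Real.exp (-u) then c else 0) =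
        (Set.Iio (Real.log v)).indicator (fun _ => c) u := by
      intro u
      have : 1 < v * Real.exp (-u) ↔ u ∈ Set.Iio (Real.log v) := by
        rw [Set.mem_Iio, Real.lt_log_iff_exp_lt (by linarith), Real.exp_neg,
          ← div_eq_mul_inv, one_lt_div (Real.exp_pos u)]
      simp only [this, Set.indicator]
    simp_rw [heq]
    rw [MeasureTheory.setIntegral_indicator measurableSet_Iio, Set.Ioi_inter_Iio,
      MeasureTheory.setIntegral_const]
    simp [MeasureTheory.measureReal_def, hlog.le, mul_comm]
  · rw [MeasureTheory.setIntegral_congr_fun (g := fun _ => (0 : ℝ)) measurableSet_Ioi]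
    · simp
    · intro u hu
      have h1 : Real.exp (-u) < 1 := by simpa using hu
      have h2 := Real.exp_pos (-u)
      exact if_neg (by nlinarith)

/-- The boundary limit of the imaginary part of the dilogarithm: as `ε → 0+`,
`−∫_0^∞ Arg(1 − (v+iε)e^{−u}) du → π log v · 1_{v>1}` for real `v ≠ 1`. -/
theorem stmt_16 (v : ℝ) (hv : v ≠ 1) :
    Filter.Tendsto (fun ε : ℝ =>
        -∫ u in Set.Ioi (0 : ℝ),
          Complex.arg (1 - ((v : ℂ) + (ε : ℂ) * Complex.I) * Complex.exp (-(u : ℂ))))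
      (nhdsWithin 0 (Set.Ioi 0))
      (nhds (if 1 < v then Real.pi * Real.log v else 0)) := by
  have hexp : ∀ u : ℝ, Complex.exp (-(u : ℂ)) = ((Real.exp (-u) : ℝ) : ℂ) := by
    intro u; push_cast; rfl
  have hlim : (if 1 < v then Real.pi * Real.log v else 0) =
      -∫ u in Set.Ioi (0 : ℝ), (if 1 < v * Real.exp (-u) then -Real.pi else 0) := by
    rw [integral_Ioi_ite_one_lt_mul_exp_neg]
    split_ifs <;> simp
  rw [hlim]
  refine Filter.Tendsto.neg (MeasureTheory.tendsto_integral_filter_of_dominated_convergence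
    (fun u => 2 * Real.pi * (|v| + 1) * Real.exp (-u)) ?_ ?_ ?_ ?_)
  · refine Filter.Eventually.of_forall fun ε => Measurable.aestronglyMeasurable ?_
    exact Complex.measurable_arg.comp (Continuous.measurable (by fun_prop))
  · filter_upwards [self_mem_nhdsWithin, mem_nhdsWithin_of_mem_nhds (Iio_mem_nhds one_pos)]
      with ε hε hε1
    refine Filter.Eventually.of_forall fun u => ?_
    have h1 := Complex.abs_arg_one_add_le
      (-(((v : ℂ) + (ε : ℂ) * Complex.I) * Complex.exp (-(u : ℂ))))
    have h2 : ‖(v : ℂ) + (ε : ℂ) * Complex.I‖ ≤ |v| + 1 := by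
      refine (norm_add_le _ _).trans ?_
      have : |ε| ≤ 1 := by rw [abs_of_pos hε]; exact le_of_lt hε1
      simpa using this
    rw [← sub_eq_add_neg, norm_neg, norm_mul, hexp, Complex.norm_real, Real.norm_eq_abs,
      Real.abs_exp] at h1
    rw [Real.norm_eq_abs, hexp]
    refine h1.trans ?_
    rw [mul_assoc (2 * Real.pi)]
    gcongr
  · exact (integrableOn_exp_neg_Ioi 0).const_mul _
  · have hne : ∀ᵐ u : ℝ ∂(MeasureTheory.volume.restrict (Set.Ioi (0 : ℝ))), u ≠ Real.log v :=
      MeasureTheory.ae_restrict_of_ae (MeasureTheory.Measure.ae_ne _ _)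
    filter_upwards [hne] with u hu
    simp_rw [hexp]
    refine Complex.tendsto_arg_one_sub_mul v _ (Real.exp_pos _) fun h => hu ?_
    rw [Real.exp_neg, ← div_eq_mul_inv, div_eq_one_iff_eq (Real.exp_pos u).ne'] at h
    rw [h, Real.log_exp]
end

section
/- Fix γ > 0, τ, ρ > 0, and integers Δt, Δp with Δt < 0 and Δt + Δp < 0. For m ≥ 1 set q = e^{−γ/m}, t₁ = ⌊mτ⌋ + Δt, and p₁ = ⌊mρ⌋ + Δp. Then lim_{m→+∞} q^{Δt (p₁ + t₁)} (q^{Δt+Δp+1};q)_{−Δt−1} / (q;q)_{−Δt−1} = (−1)^{−Δt−1} e^{−γ(τ+ρ)Δt} · binom(−Δt−Δp−1, −Δt−1), where binom denotes the binomial coefficient. -/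
open Filter Topology

lemma exp_intCast_mul (x : ℝ) (c : ℤ) : Real.exp (c * x) = Real.exp x ^ c := by
  rw [mul_comm, Real.exp_mul, Real.rpow_intCast]

lemma tendsto_one_sub_exp_zpow_div (a b : ℤ) (hb : b ≠ 0) :
    Tendsto (fun x : ℝ => (1 - Real.exp x ^ a) / (1 - Real.exp x ^ b)) (𝓝[≠] 0)
      (𝓝 ((a : ℝ) / b)) := by
  have key (c : ℤ) : Tendsto (fun x : ℝ => x⁻¹ * (Real.exp x ^ c - 1)) (𝓝[≠] 0) (𝓝 (c : ℝ)) := by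
    have h : HasDerivAt (fun x : ℝ => Real.exp ((c : ℝ) * x)) (c : ℝ) 0 := by
      simpa using ((hasDerivAt_id (0 : ℝ)).const_mul (c : ℝ)).exp
    have h' := h.tendsto_slope_zero
    simpa [exp_intCast_mul] using h'
  refine ((key a).div (key b) (by exact_mod_cast hb)).congr' ?_
  filter_upwards [self_mem_nhdsWithin] with x hx
  simp only [Pi.div_apply]
  rw [mul_div_mul_left _ _ (inv_ne_zero hx), ← neg_sub 1, ← neg_sub 1 (Real.exp x ^ b), neg_div_neg_eq]

lemma prod_range_sub_div_succ_eq_choose (n k : ℕ) :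
    ∏ i ∈ Finset.range k, ((i : ℝ) - n) / (i + 1) = (-1) ^ k * (n.choose k : ℝ) := by
  induction k with
  | zero => simp
  | succ k ih =>
    have h : (n.choose (k + 1) : ℝ) * (k + 1) = n.choose k * ((n : ℝ) - k) := by
      rcases le_or_gt k n with hk | hk
      · rw [← Nat.cast_sub hk]
        exact_mod_cast Nat.choose_succ_right_eq n k
      · simp [Nat.choose_eq_zero_of_lt hk, Nat.choose_eq_zero_of_lt (Nat.lt_succ_of_lt hk)]
    have hk : (k : ℝ) + 1 ≠ 0 := by positivity
    rw [Finset.prod_range_succ, ih, pow_succ]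
    field_simp
    linear_combination h

lemma tendsto_int_floor_mul_nat_div (a : ℝ) :
    Tendsto (fun m : ℕ => (⌊a * m⌋ : ℝ) / m) atTop (𝓝 a) := by
  have h1 : Tendsto (fun m : ℕ => a - 1 / (m : ℝ)) atTop (𝓝 a) := by
    simpa using tendsto_const_nhds.sub (tendsto_one_div_atTop_nhds_zero_nat (𝕜 := ℝ))
  refine tendsto_of_tendsto_of_tendsto_of_le_of_le' h1 tendsto_const_nhds ?_ ?_
  all_goals
    filter_upwards [eventually_gt_atTop 0] with m hm
    have hm' : (0 : ℝ) < m := by exact_mod_cast hm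
  · rw [le_div_iff₀ hm', sub_mul, one_div_mul_cancel hm'.ne']
    exact (Int.sub_one_lt_floor _).le
  · rw [div_le_iff₀ hm']
    exact Int.floor_le _


/-- The q-Pochhammer symbol `(a;q)_k = ∏_{i=0}^{k−1} (1 − a q^i)`. -/
noncomputable def qPoch (q a : ℝ) (k : ℕ) : ℝ := ∏ i ∈ Finset.range k, (1 - a * q ^ i)

/-- `(q^s;q)_k = ∏_{i=0}^{k−1}(1 − q^{s+i})` for an arbitrary integer `s`. -/
noncomputable def qPochInt (q : ℝ) (s : ℤ) (k : ℕ) : ℝ :=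
  ∏ i ∈ Finset.range k, (1 - q ^ (s + i))

/-- With `q = e^{−γ/m}`, `t₁ = ⌊mτ⌋ + Δt`, `p₁ = ⌊mρ⌋ + Δp`, and `Δt < 0`,
`Δt + Δp < 0`, one has
`q^{Δt(p₁+t₁)} (q^{Δt+Δp+1};q)_{−Δt−1}/(q;q)_{−Δt−1}
  → (−1)^{−Δt−1} e^{−γ(τ+ρ)Δt} binom(−Δt−Δp−1, −Δt−1)`. -/
theorem stmt_17 (γ τ ρ : ℝ) (hγ : 0 < γ) (hτ : 0 < τ) (hρ : 0 < ρ)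
    (Δt Δp : ℤ) (hΔt : Δt < 0) (hΔtp : Δt + Δp < 0) :
    Filter.Tendsto (fun m : ℕ =>
        Real.exp (-γ / m) ^ (Δt * ((⌊ρ * m⌋ + Δp) + (⌊τ * m⌋ + Δt))) *
          qPochInt (Real.exp (-γ / m)) (Δt + Δp + 1) (-Δt - 1).toNat /
          qPoch (Real.exp (-γ / m)) (Real.exp (-γ / m)) (-Δt - 1).toNat)
      Filter.atTop
      (nhds ((-1 : ℝ) ^ (-Δt - 1).toNat * Real.exp (-γ * (τ + ρ) * (Δt : ℝ)) *
        (Nat.choose (-Δt - Δp - 1).toNat (-Δt - 1).toNat : ℝ))) := by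
  have hx : Tendsto (fun m : ℕ => -γ / (m : ℝ)) atTop (𝓝[≠] 0) := by
    refine tendsto_nhdsWithin_iff.2 ⟨tendsto_const_div_atTop_nhds_zero_nat (-γ), ?_⟩
    filter_upwards [eventually_gt_atTop 0] with m hm
    exact div_ne_zero (neg_ne_zero.2 hγ.ne') (by exact_mod_cast hm.ne')
  have hpow : Tendsto (fun m : ℕ =>
      Real.exp (-γ / m) ^ (Δt * ((⌊ρ * m⌋ + Δp) + (⌊τ * m⌋ + Δt)))) atTop
      (𝓝 (Real.exp (-γ * (τ + ρ) * (Δt : ℝ)))) := by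
    have hlim : Tendsto (fun m : ℕ => -γ * Δt * (((⌊ρ * m⌋ : ℝ) / m + (Δp : ℝ) / m) +
        ((⌊τ * m⌋ : ℝ) / m + (Δt : ℝ) / m))) atTop (𝓝 (-γ * Δt * ((ρ + 0) + (τ + 0)))) :=
      tendsto_const_nhds.mul
        (((tendsto_int_floor_mul_nat_div ρ).add (tendsto_const_div_atTop_nhds_zero_nat _)).add
          ((tendsto_int_floor_mul_nat_div τ).add (tendsto_const_div_atTop_nhds_zero_nat _)))
    have hval : -γ * Δt * ((ρ + 0) + (τ + 0)) = -γ * (τ + ρ) * Δt := by ring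
    rw [hval] at hlim
    refine ((Real.continuous_exp.tendsto _).comp hlim).congr fun m => ?_
    rw [Function.comp_apply, ← exp_intCast_mul]
    congr 1
    push_cast
    ring
  have hratio : Tendsto (fun m : ℕ =>
      qPochInt (Real.exp (-γ / m)) (Δt + Δp + 1) (-Δt - 1).toNat /
        qPoch (Real.exp (-γ / m)) (Real.exp (-γ / m)) (-Δt - 1).toNat) atTop
      (𝓝 ((-1 : ℝ) ^ (-Δt - 1).toNat *
        (Nat.choose (-Δt - Δp - 1).toNat (-Δt - 1).toNat : ℝ))) := by
    rw [← prod_range_sub_div_succ_eq_choose]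
    have hn : (((-Δt - Δp - 1).toNat : ℤ) : ℝ) = ((-Δt - Δp - 1 : ℤ) : ℝ) := by
      rw [Int.toNat_of_nonneg (by omega)]
    have hlim := tendsto_finsetProd (Finset.range (-Δt - 1).toNat) fun i _ =>
      (tendsto_one_sub_exp_zpow_div (Δt + Δp + 1 + i) ((i : ℤ) + 1) (by omega)).comp hx
    convert hlim using 2
    · simp only [qPochInt, qPoch, ← Finset.prod_div_distrib, Function.comp_apply]
      refine Finset.prod_congr rfl fun i _ => ?_
      rw [← pow_succ', ← zpow_natCast, Nat.cast_succ]
    · refine Finset.prod_congr rfl fun i _ => ?_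
      rw [← Int.cast_natCast (-Δt - Δp - 1).toNat, hn]
      push_cast
      ring
  convert hpow.mul hratio using 2
  · rw [mul_div_assoc]
  · ring
end
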